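/- arXiv:0706.1810 — 2 statements merged into one kernel-verified Lean document; each statement's English description precedes it below -/
import Mathlib

section
/- Let q be a prime power of characteristic p, let d divide q-1, and let 0 < r ≤ p. Let M be the number of elements ξ of F_q such that ξ, ξ+1, ..., ξ+r-1 are all nonzero d-th powers in F_q. Then |M + (r+1)/(2d) - (q+1)/d^r| ≤ (r - 1 - (r+1)/d + 2/d^r)·√q + (r+1)/(2d). -/
open Polynomial in
theorem dvd_natDegree_minpoly_of_pow_eq {K : Type*} [Field K] {f : K[X]} (hf : f ≠ 0) {d : ℕ}
    {c : K} (hc : c ≠ 0)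
    (h : ∀ n, (∀ a, d ∣ n * f.rootMultiplicity a) → d ∣ n)
    {z : AlgebraicClosure (FractionRing K[X])}
    (hz : algebraMap K[X] _ f * z ^ d = algebraMap K[X] _ (C c)) :
    d ∣ (minpoly (FractionRing K[X]) z).natDegree := by
  set E := FractionRing K[X]
  have hint : IsIntegral E z := Algebra.IsIntegral.isIntegral z
  rw [← IntermediateField.adjoin.finrank hint]
  set n := Module.finrank E (IntermediateField.adjoin E {z})
  have hfE : algebraMap K[X] E f ≠ 0 := by simpa using hf
  set g := IntermediateField.AdjoinSimple.gen E z
  have hg : g ^ d = algebraMap E _ (algebraMap K[X] E (C c) / algebraMap K[X] E f) := by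
    apply (algebraMap (IntermediateField.adjoin E {z}) (AlgebraicClosure E)).injective
    rw [map_pow, IntermediateField.AdjoinSimple.algebraMap_gen,
      ← IsScalarTower.algebraMap_apply, map_div₀, ← IsScalarTower.algebraMap_apply,
      ← IsScalarTower.algebraMap_apply, eq_div_iff, mul_comm, hz]
    rw [IsScalarTower.algebraMap_apply K[X] E]
    simpa using hf
  have hN : (Algebra.norm E g) ^ d = (algebraMap K[X] E (C c) / algebraMap K[X] E f) ^ n := by
    rw [← map_pow, hg, Algebra.norm_algebraMap]
  obtain ⟨U, V, hV, hUV⟩ := IsFractionRing.div_surjective (A := K[X]) (Algebra.norm E g)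
  have hV0 : V ≠ 0 := nonZeroDivisors.ne_zero hV
  have hVE : algebraMap K[X] E V ≠ 0 := by simpa using hV0
  have key : U ^ d * f ^ n = C (c ^ n) * V ^ d := by
    apply IsFractionRing.injective K[X] E
    rw [← hUV, div_pow, div_pow, div_eq_div_iff (by positivity) (by positivity)] at hN
    simpa [mul_comm] using hN
  have hU0 : U ^ d ≠ 0 := by
    intro h0
    rw [h0, zero_mul, eq_comm, mul_eq_zero] at key
    rcases key with key | key
    · simp [hc] at key
    · exact hV0 (eq_zero_of_pow_eq_zero key)
  classical
  apply h
  intro a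
  have := congrArg (rootMultiplicity a) key
  rw [rootMultiplicity_mul (mul_ne_zero hU0 (pow_ne_zero _ hf)),
    rootMultiplicity_mul (mul_ne_zero (by simp [hc]) (pow_ne_zero _ hV0)), rootMultiplicity_C,
    ← count_roots, ← count_roots, ← count_roots, roots_pow, roots_pow, roots_pow,
    Multiset.count_nsmul, Multiset.count_nsmul, Multiset.count_nsmul, zero_add,
      count_roots f] at this
  exact (Nat.dvd_add_right (dvd_mul_right d _)).1 (this ▸ dvd_mul_right d _)

open Polynomial in
theorem eq_zero_of_sum_mul_pow_eq_zero {K : Type*} [Field K] {f : K[X]} (hf : f ≠ 0) {d : ℕ}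
    {c : K} (hc : c ≠ 0)
    (h : ∀ n, (∀ a, d ∣ n * f.rootMultiplicity a) → d ∣ n)
    {z : AlgebraicClosure (FractionRing K[X])}
    (hz : algebraMap K[X] _ f * z ^ d = algebraMap K[X] _ (C c)) (u : Fin d → K[X])
    (hu : ∑ i, algebraMap K[X] _ (u i) * z ^ (i : ℕ) = 0) : u = 0 := by
  set E := FractionRing K[X]
  have hint : IsIntegral E z := Algebra.IsIntegral.isIntegral z
  have hdvd := dvd_natDegree_minpoly_of_pow_eq hf hc h hz
  have hpos := minpoly.natDegree_pos hint
  have hle := Nat.le_of_dvd hpos hdvd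
  set A : E[X] := ∑ i : Fin d, C (algebraMap K[X] E (u i)) * X ^ (i : ℕ)
  have hA : aeval z A = 0 := by
    rw [← hu]
    simp [A, ← IsScalarTower.algebraMap_apply]
  have hA0 : A = 0 := by
    by_contra hne
    have h1 := minpoly.degree_le_of_ne_zero E z hne hA
    have h2 : A.degree < d := by
      refine (degree_sum_le _ _).trans_lt ?_
      rw [Finset.sup_lt_iff (by exact WithBot.bot_lt_coe d)]
      intro i _
      exact (degree_C_mul_X_pow_le _ _).trans_lt (by exact_mod_cast i.2)
    rw [degree_eq_natDegree (minpoly.ne_zero hint)] at h1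
    have := h1.trans_lt h2
    norm_cast at this
    omega
  funext i
  have := congrArg (fun B => coeff B i) hA0
  simp only [A, finsetSum_coeff, coeff_C_mul, coeff_X_pow, coeff_zero] at this
  rw [Finset.sum_eq_single i (fun j _ hj => by
    rw [if_neg (fun h => hj (Fin.ext h.symm)), mul_zero]) (by simp)] at this
  simpa using this

/-- The matrix, in the powers of `y`, of multiplication by `f * ∑ i, k i * y ^ i`,
where `f * y ^ d = c`. -/
def powMulMatrix {R : Type*} [CommRing R] {d : ℕ} (f c : R) (k : Fin d → R) :
    Matrix (Fin d) (Fin d) R :=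
  fun a b => ∑ i : Fin d, k i * if (i : ℕ) + a = b then f else if (i : ℕ) + a = b + d then c else 0

theorem sum_powMulMatrix_mul_pow {R S : Type*} [CommRing R] [CommRing S] {d : ℕ} (f c : R)
    (k : Fin d → R) (φ : R →+* S) (w : S) (hw : φ f * w ^ d = φ c) (a : Fin d) :
    ∑ b : Fin d, φ (powMulMatrix f c k a b) * w ^ (b : ℕ) =
      φ f * w ^ (a : ℕ) * ∑ i : Fin d, φ (k i) * w ^ (i : ℕ) := by
  simp only [powMulMatrix, map_sum, map_mul, Finset.sum_mul]
  rw [Finset.sum_comm, Finset.mul_sum]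
  refine Finset.sum_congr rfl fun i _ => ?_
  by_cases hia : (i : ℕ) + a < d
  · rw [Finset.sum_eq_single ⟨i + a, hia⟩]
    · simp only [if_true]
      ring
    · intro b _ hb
      have h1 : ¬ (i : ℕ) + a = b := fun h => hb (Fin.ext h.symm)
      have h2 : ¬ (i : ℕ) + a = b + d := by omega
      simp [h1, h2]
    · simp
  · have hlt : (i : ℕ) + a - d < d := by omega
    rw [Finset.sum_eq_single ⟨i + a - d, hlt⟩]
    · have h1 : ¬ (i : ℕ) + a = i + a - d := by
        have := i.2
        omega
      have h2 : (i : ℕ) + a = i + a - d + d := by omega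
      simp only [h1, ← h2, if_false, if_true]
      have h3 : w ^ (i : ℕ) * w ^ (a : ℕ) = w ^ d * w ^ ((i : ℕ) + a - d) := by
        rw [← pow_add, ← pow_add]
        congr 1
        omega
      rw [← hw]
      linear_combination (-(φ (k i) * φ f)) * h3
    · intro b _ hb
      have h1 : ¬ (i : ℕ) + a = b := by omega
      have h2 : ¬ (i : ℕ) + a = b + d := fun h => hb (Fin.ext (by simp; omega))
      simp [h1, h2]
    · simp

open Polynomial in
theorem natDegree_det_le {R : Type*} [CommRing R] {d N : ℕ} (M : Matrix (Fin d) (Fin d) R[X])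
    (hM : ∀ a b, (M a b).natDegree ≤ N) : M.det.natDegree ≤ d * N := by
  rw [Matrix.det_apply]
  refine natDegree_sum_le_of_forall_le _ _ fun σ _ => ?_
  refine (natDegree_smul_le _ _).trans ((natDegree_prod_le _ _).trans ?_)
  refine (Finset.sum_le_card_nsmul _ _ N fun a _ => hM _ _).trans ?_
  simp

open Polynomial in
theorem eq_zero_of_pow_dvd_sum_mul_pow {K : Type*} [Field K] {f : K[X]} (hf : f ≠ 0) {d : ℕ}
    (hd : 0 < d) {c : K} (hc : c ≠ 0)
    (h : ∀ n, (∀ a, d ∣ n * f.rootMultiplicity a) → d ∣ n) {N B : ℕ} {v : K[X]}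
    (hv : X ^ N ∣ f * v ^ d - C c) (k : Fin d → K[X]) (hk : ∀ i, (k i).natDegree ≤ B)
    (hN : d * (B + f.natDegree) < N) (hdvd : X ^ N ∣ ∑ i, k i * v ^ (i : ℕ)) : k = 0 := by
  set M := powMulMatrix f (C c) k
  have hdeg : M.det.natDegree < N := by
    refine (natDegree_det_le M fun a b => ?_).trans_lt hN
    refine natDegree_sum_le_of_forall_le _ _ fun i _ => natDegree_mul_le.trans ?_
    refine add_le_add (hk i) ?_
    split_ifs <;> simp
  have hdet_dvd : X ^ N ∣ M.det := by
    have hrow : ∀ a, X ^ N ∣ (M.mulVec fun b => v ^ (b : ℕ)) a := by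
      intro a
      rw [← Ideal.mem_span_singleton, ← Ideal.Quotient.eq_zero_iff_mem] at hdvd hv ⊢
      have := sum_powMulMatrix_mul_pow f (C c) k (Ideal.Quotient.mk (Ideal.span {X ^ N}))
        (Ideal.Quotient.mk _ v) (by
          rw [← sub_eq_zero, ← map_pow, ← map_mul, ← map_sub, hv]) a
      simp only [← map_pow, ← map_mul, ← map_sum] at this
      simp only [Matrix.mulVec, dotProduct]
      rw [this, map_mul, hdvd, mul_zero]
    have h1 : (M.adjugate.mulVec (M.mulVec fun b => v ^ (b : ℕ))) ⟨0, hd⟩ = M.det := by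
      rw [Matrix.mulVec_mulVec, Matrix.adjugate_mul, Matrix.smul_mulVec, Matrix.one_mulVec]
      simp
    rw [← h1, Matrix.mulVec, dotProduct]
    exact Finset.dvd_sum fun b _ => (hrow b).mul_left _
  have hdet : M.det = 0 := by
    by_contra hne
    have := natDegree_le_of_dvd hdet_dvd hne
    rw [natDegree_X_pow] at this
    omega
  obtain ⟨u, hu0, hu⟩ := Matrix.exists_vecMul_eq_zero_iff.2 hdet
  set Ω := AlgebraicClosure (FractionRing K[X])
  have hinj : Function.Injective (algebraMap K[X] Ω) := by
    rw [IsScalarTower.algebraMap_eq K[X] (FractionRing K[X]) Ω]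
    exact (algebraMap (FractionRing K[X]) Ω).injective.comp (IsFractionRing.injective _ _)
  have hfΩ : algebraMap K[X] Ω f ≠ 0 := by
    rwa [Ne, map_eq_zero_iff _ hinj]
  obtain ⟨z, hz⟩ := IsAlgClosed.exists_pow_nat_eq
    (algebraMap K[X] Ω (C c) / algebraMap K[X] Ω f) hd
  have hz' : algebraMap K[X] Ω f * z ^ d = algebraMap K[X] Ω (C c) := by
    rw [hz, mul_div_cancel₀ _ hfΩ]
  have hprod : algebraMap K[X] Ω f * (∑ i, algebraMap K[X] Ω (u i) * z ^ (i : ℕ)) *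
      ∑ i, algebraMap K[X] Ω (k i) * z ^ (i : ℕ) = 0 := by
    calc _ = ∑ a, algebraMap K[X] Ω (u a) *
          ∑ b, algebraMap K[X] Ω (M a b) * z ^ (b : ℕ) := by
          simp only [M, sum_powMulMatrix_mul_pow f (C c) k (algebraMap K[X] Ω) z hz']
          rw [mul_assoc, Finset.sum_mul, Finset.mul_sum]
          exact Finset.sum_congr rfl fun a _ => by ring
      _ = ∑ b, algebraMap K[X] Ω (Matrix.vecMul u M b) * z ^ (b : ℕ) := by
          simp only [Matrix.vecMul, dotProduct, map_sum, map_mul]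
          rw [Finset.sum_congr rfl fun a _ => Finset.mul_sum _ _ _, Finset.sum_comm,
            Finset.sum_congr rfl fun b _ => Finset.sum_mul _ _ _]
          exact Finset.sum_congr rfl fun a _ => Finset.sum_congr rfl fun b _ => by ring
      _ = 0 := by simp [hu]
  rcases mul_eq_zero.1 hprod with h0 | h0
  · exact absurd (eq_zero_of_sum_mul_pow_eq_zero hf hc h hz' u
      ((mul_eq_zero.1 h0).resolve_left hfΩ)) hu0
  · exact eq_zero_of_sum_mul_pow_eq_zero hf hc h hz' k h0

open Polynomial in
theorem eq_zero_of_sum_mul_pow_X_pow {K : Type*} [Field K] {P J : ℕ} (A : Fin J → K[X])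
    (hA : ∀ j, X ^ P ∣ A j → A j = 0) (h : ∑ j, A j * (X ^ P) ^ (j : ℕ) = 0) (j : Fin J) :
    A j = 0 := by
  induction J with
  | zero => exact j.elim0
  | succ J ih =>
    have hsum : A 0 + X ^ P * ∑ j : Fin J, A j.succ * (X ^ P) ^ (j : ℕ) = 0 := by
      rw [← h, Fin.sum_univ_succ, Finset.mul_sum]
      simp only [Fin.val_zero, pow_zero, mul_one, Fin.val_succ, pow_succ]
      congr 1
      exact Finset.sum_congr rfl fun i _ => by ring
    have h0 : A 0 = 0 := hA 0 ((dvd_add_left (dvd_mul_right _ _)).1 (hsum ▸ dvd_zero _))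
    rw [h0, zero_add, mul_eq_zero] at hsum
    have h1 := hsum.resolve_left (pow_ne_zero _ X_ne_zero)
    refine Fin.cases h0 (fun i => ?_) j
    exact ih (fun i => A i.succ) (fun i => hA _) h1 i

open Polynomial in
theorem exists_ne_zero_linearCombination_eq_zero {K ι : Type*} [Field K] [Fintype ι] {N : ℕ}
    (hN : N < Fintype.card ι) (w : ι → K[X]) (hw : ∀ i, (w i).natDegree < N) :
    ∃ a : ι → K, a ≠ 0 ∧ ∑ i, C (a i) * w i = 0 := by
  set T : (ι → K) →ₗ[K] (Fin N → K) :=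
    (LinearMap.pi fun n : Fin N => lcoeff K n) ∘ₗ Fintype.linearCombination K w
  have hker : LinearMap.ker T ≠ ⊥ := LinearMap.ker_ne_bot_of_finrank_lt (by simpa using hN)
  obtain ⟨a, ha, ha0⟩ := Submodule.exists_mem_ne_zero_of_ne_bot hker
  refine ⟨a, ha0, ?_⟩
  ext n
  by_cases hn : n < N
  · have := congrFun (LinearMap.mem_ker.1 ha) ⟨n, hn⟩
    simpa [T, Fintype.linearCombination_apply, smul_eq_C_mul] using this
  · rw [coeff_zero, finsetSum_coeff]
    refine Finset.sum_eq_zero fun i _ => ?_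
    rw [coeff_C_mul, coeff_eq_zero_of_natDegree_lt ((hw i).trans_le (not_lt.1 hn)), mul_zero]

open Polynomial in
theorem X_pow_dvd_pow_sub_C {K : Type*} [Field K] (p : ℕ) [Fact p.Prime] [CharP K p] (a : ℕ)
    (f : K[X]) : X ^ p ^ a ∣ f ^ p ^ a - C (f.coeff 0 ^ p ^ a) := by
  have h : f = X * f.divX + C (f.coeff 0) := (X_mul_divX_add f).symm
  have : f ^ p ^ a = (X * f.divX) ^ p ^ a + C (f.coeff 0) ^ p ^ a := by
    conv_lhs => rw [h]
    exact add_pow_char_pow ..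
  rw [this, C_pow, add_sub_cancel_right, mul_pow]
  exact dvd_mul_right _ _

open Polynomial in
theorem card_pow_eq_le_of_coeff_zero_ne_zero {K : Type*} [Field K] [Fintype K] [DecidableEq K]
    (p : ℕ) [Fact p.Prime] [CharP K p] {a P : ℕ} (hP : P = p ^ a) (hcard : Fintype.card K = P ^ 2)
    {d e : ℕ} (hd : 0 < d) (hde : P = d * e + 1) {f : K[X]} (hf : f.coeff 0 ≠ 0)
    (h : ∀ n, (∀ a, d ∣ n * f.rootMultiplicity a) → d ∣ n)
    (he : 9 ≤ e) (heD : 2 * f.natDegree ≤ e) {ζ : K} (hζ : ζ ≠ 0) :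
    (Finset.univ.filter fun x : K => f.eval x ^ (e * (P + 1)) = ζ).card ≤
      P * (e + 5 * f.natDegree + 5) := by
  set D := f.natDegree
  have hf0 : f ≠ 0 := by
    rintro rfl
    simp at hf
  have hP0 : 0 < P := by omega
  set B := e - D with hB
  set J := e + 4 * D + 4 with hJ
  set N := B * P + D * P + J with hNdef
  have hB1 : 0 < B := by omega
  -- The auxiliary polynomial.
  have hcount : N < Fintype.card (Fin d × Fin J × Fin B) := by
    simp only [Fintype.card_prod, Fintype.card_fin]
    obtain ⟨B', hB'⟩ : ∃ B', e = B' + D := ⟨B, by omega⟩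
    have hBB : B = B' := by omega
    rw [hNdef, hJ, hBB, hde, hB']
    have hDB : D ≤ B' := by omega
    have hB9 : 9 ≤ B' + D := by omega
    obtain ⟨d', rfl⟩ : ∃ d', d = d' + 1 := ⟨d - 1, by omega⟩
    nlinarith [Nat.zero_le (d' * B' * D), Nat.zero_le (d' * D * D), mul_le_mul_left hDB D,
      Nat.mul_le_mul_left (d' * D) hDB, Nat.zero_le (d' * B'), Nat.zero_le (D * B'),
      Nat.mul_le_mul_left D hDB]
  obtain ⟨α, hα0, hα⟩ := exists_ne_zero_linearCombination_eq_zero hcount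
    (fun t => C (ζ ^ (t.1 : ℕ)) * X ^ ((t.2.2 : ℕ) * P + t.2.1) * f ^ ((d - t.1) * e))
    (by
      rintro ⟨i, j, b⟩
      refine lt_of_le_of_lt (natDegree_mul_le.trans (add_le_add (natDegree_C_mul_X_pow_le _ _)
        (natDegree_pow_le_of_le _ le_rfl))) ?_
      have h1 : (b : ℕ) * P ≤ B * P := Nat.mul_le_mul_right _ b.2.le
      have h2 : (d - (i : ℕ)) * e * D ≤ D * P := by
        rw [mul_comm D]
        refine Nat.mul_le_mul_right _ ?_
        have := Nat.mul_le_mul_right e (Nat.sub_le d i)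
        omega
      have h3 := j.2
      simp only
      change (b : ℕ) * P + j + (d - (i : ℕ)) * e * D < N
      omega)
  set v := f ^ e
  set k : Fin J → Fin d → K[X] := fun j i => ∑ b : Fin B, C (α (i, j, b) ^ P) * X ^ (b : ℕ)
  set A : Fin J → K[X] := fun j => ∑ i, k j i * v ^ (i : ℕ)
  set H := ∑ j, A j * (X ^ P) ^ (j : ℕ)
  have hkdeg : ∀ j i, (k j i).natDegree ≤ B - 1 := fun j i =>
    natDegree_sum_le_of_forall_le _ _ fun b _ =>
      (natDegree_C_mul_X_pow_le _ _).trans (by have := b.2; omega)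
  have hk0 : ∀ j, X ^ P ∣ A j → k j = 0 := by
    intro j hj
    refine eq_zero_of_pow_dvd_sum_mul_pow hf0 hd (c := f.coeff 0 ^ P) (pow_ne_zero _ hf) h
      (N := P) (B := B - 1) (v := v) ?_ (k j) (hkdeg j) ?_ hj
    · have : f * v ^ d = f ^ P := by
        rw [hde, pow_succ, mul_comm d e, pow_mul, mul_comm]
      rw [this, hP]
      exact X_pow_dvd_pow_sub_C p a f
    · change d * (B - 1 + D) < P
      rw [hde]
      exact Nat.lt_succ_of_le (Nat.mul_le_mul_left d (by omega))
  have hH : H ≠ 0 := by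
    intro hH
    apply hα0
    have hA := eq_zero_of_sum_mul_pow_X_pow A (fun j hj => by
      simp only [A, hk0 j hj]
      simp) hH
    funext ⟨i, j, b⟩
    have h1 := congrArg (fun g => coeff g (b : ℕ)) (congrFun (hk0 j (by simp [hA j])) i)
    simp only [k, finsetSum_coeff, coeff_C_mul_X_pow, Pi.zero_apply, coeff_zero] at h1
    rw [Finset.sum_eq_single b (fun b' _ hb' => by
      rw [if_neg (fun h => hb' (Fin.ext h.symm))]) (by simp), if_pos rfl] at h1
    exact eq_zero_of_pow_eq_zero h1
  have hHdeg : H.natDegree ≤ P * (e + 5 * D + 5) := by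
    refine natDegree_sum_le_of_forall_le _ _ fun j _ => ?_
    rw [← pow_mul]
    refine natDegree_mul_le.trans ?_
    rw [natDegree_X_pow]
    have h1 : (A j).natDegree ≤ B - 1 + D * P := by
      refine natDegree_sum_le_of_forall_le _ _ fun i _ => ?_
      refine natDegree_mul_le.trans (add_le_add (hkdeg j i) ?_)
      rw [← pow_mul]
      refine (natDegree_pow_le_of_le _ le_rfl).trans ?_
      rw [mul_comm D]
      refine Nat.mul_le_mul_right _ ?_
      have := Nat.mul_le_mul_left e i.2.le
      rw [mul_comm e d] at this
      omega
    have h2 : P * (j : ℕ) ≤ P * J := Nat.mul_le_mul_left _ j.2.le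
    have h3 : B ≤ P * (1 : ℕ) := by
      have : 1 * e ≤ d * e := Nat.mul_le_mul_right _ hd
      omega
    calc _ ≤ P * 1 + D * P + P * J := by omega
      _ = P * (e + 5 * D + 5) := by rw [hJ]; ring
  refine le_trans ?_ hHdeg
  refine le_trans (Finset.card_le_card (t := H.roots.toFinset) ?_)
    ((Multiset.toFinset_card_le _).trans (card_roots' H))
  intro x hx
  rw [Finset.mem_filter] at hx
  rw [Multiset.mem_toFinset, mem_roots hH, IsRoot.def]
  have hfx : f.eval x ≠ 0 := by
    intro h0
    rw [h0, zero_pow (by positivity)] at hx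
    exact hζ hx.2.symm
  have hxP : ∀ y : K, (y ^ P) ^ P = y := fun y => by
    rw [← pow_mul, ← sq, ← hcard, FiniteField.pow_card]
  have hadd : ∀ {ι : Type} (s : Finset ι) (g : ι → K), (∑ i ∈ s, g i) ^ P = ∑ i ∈ s, g i ^ P := by
    intro ι s g
    rw [hP]
    exact sum_pow_char_pow ..
  have hmul : f.eval x ^ (d * e) * H.eval x ^ P = 0 := by
    rw [← eval_zero (x := x), ← hα]
    simp only [H, A, k, v, eval_finsetSum, eval_mul, eval_pow, eval_C, eval_X, hadd, mul_pow,
      Finset.sum_mul, Finset.mul_sum, Fintype.sum_prod_type]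
    rw [Finset.sum_comm]
    refine Finset.sum_congr rfl fun i _ => Finset.sum_congr rfl fun j _ =>
      Finset.sum_congr rfl fun b _ => ?_
    rw [hxP, ← hx.2]
    have h1 : ((x ^ P) ^ (j : ℕ)) ^ P = x ^ (j : ℕ) := by
      rw [← pow_mul, mul_comm, pow_mul, hxP]
    have h2 : f.eval x ^ (d * e) * ((f.eval x ^ e) ^ (i : ℕ)) ^ P =
        (f.eval x ^ (e * (P + 1))) ^ (i : ℕ) * f.eval x ^ ((d - i) * e) := by
      rw [← pow_mul, ← pow_mul, ← pow_mul, ← pow_add, ← pow_add]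
      congr 1
      obtain ⟨m, hm⟩ : ∃ m, d = m + i := ⟨d - i, by omega⟩
      have hm' : d - i = m := by omega
      rw [hm']
      linear_combination e * hm
    have h3 : (x ^ (b : ℕ)) ^ P * x ^ (j : ℕ) = x ^ ((b : ℕ) * P + j) := by ring
    rw [h1, ← h3]
    linear_combination α (i, j, b) * (x ^ (b : ℕ)) ^ P * x ^ (j : ℕ) * h2
  exact eq_zero_of_pow_eq_zero ((mul_eq_zero.1 hmul).resolve_left (pow_ne_zero _ hfx))

open Polynomial in
theorem card_pow_eq_le {K : Type*} [Field K] [Fintype K] [DecidableEq K]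
    (p : ℕ) [Fact p.Prime] [CharP K p] {a P : ℕ} (hP : P = p ^ a) (hcard : Fintype.card K = P ^ 2)
    {d e : ℕ} (hd : 0 < d) (hde : P = d * e + 1) {f : K[X]}
    (h : ∀ n, (∀ a, d ∣ n * f.rootMultiplicity a) → d ∣ n) {ζ : K} (hζ : ζ ≠ 0) :
    d * (Finset.univ.filter fun x : K => f.eval x ^ (e * (P + 1)) = ζ).card ≤
      P ^ 2 + d * (d * (9 + 2 * f.natDegree) + 5 * f.natDegree + 6) * P := by
  set D := f.natDegree with hD
  set Z := Finset.univ.filter fun x : K => f.eval x ^ (e * (P + 1)) = ζ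
  have hlarge : 9 ≤ e → 2 * D ≤ e → Z.card ≤ P * (e + 5 * D + 5) := by
    intro he heD
    rcases Z.eq_empty_or_nonempty with hZ | ⟨t, ht⟩
    · simp [hZ]
    have hft : f.eval t ≠ 0 := by
      intro h0
      rw [Finset.mem_filter, h0, zero_pow (by positivity)] at ht
      exact hζ ht.2.symm
    have hdeg : (f.comp (X + C t)).natDegree = D := by
      rw [natDegree_comp, natDegree_X_add_C, mul_one]
    have hmult : ∀ a, (f.comp (X + C t)).rootMultiplicity a = f.rootMultiplicity (a + t) := by
      intro a
      rw [rootMultiplicity_eq_rootMultiplicity, rootMultiplicity_eq_rootMultiplicity (p := f),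
        comp_assoc]
      congr 2
      simp [add_assoc]
    have := card_pow_eq_le_of_coeff_zero_ne_zero p hP hcard hd hde (f := f.comp (X + C t))
      (by rw [coeff_zero_eq_eval_zero, eval_comp]; simpa using hft)
      (fun n hn => h n fun a => by
        have := hn (a - t)
        rwa [hmult, sub_add_cancel] at this)
      he (by rwa [hdeg]) hζ
    rw [hdeg] at this
    refine le_trans (Finset.card_le_card_of_injOn (fun x => x - t) ?_
      (sub_left_injective.injOn)) this
    intro x hx
    simp only [Z, Finset.coe_filter, Finset.mem_univ, true_and, Set.mem_ofPred_eq] at hx ⊢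
    simpa [eval_comp] using hx
  by_cases hc : 9 ≤ e ∧ 2 * D ≤ e
  · have h1 := Nat.mul_le_mul_left d (hlarge hc.1 hc.2)
    refine h1.trans ?_
    rw [hde]
    nlinarith [Nat.zero_le (d * (d * (9 + 2 * D)) * (d * e + 1)), Nat.zero_le (d * (d * e + 1))]
  · have h1 : Z.card ≤ P ^ 2 := hcard ▸ Finset.card_le_univ Z
    have h2 : e ≤ 9 + 2 * D := by omega
    have h3 : P ≤ d * (9 + 2 * D) + 1 := by
      rw [hde]
      exact Nat.succ_le_succ (Nat.mul_le_mul_left d h2)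
    calc d * Z.card ≤ d * P ^ 2 := Nat.mul_le_mul_left d h1
      _ = d * P * P := by ring
      _ ≤ d * (d * (9 + 2 * D) + 1) * P := by gcongr
      _ ≤ d * (d * (9 + 2 * D) + 5 * D + 6) * P :=
        Nat.mul_le_mul_right _ (Nat.mul_le_mul_left _ (by omega))
      _ ≤ _ := Nat.le_add_left _ _

theorem MulChar.pow_card_sub_one_div_orderOf_eq_one {F : Type*} [Field F] [Fintype F]
    {ψ : MulChar F ℂ} {w : F} (hw : ψ w = 1) :
    w ^ ((Fintype.card F - 1) / orderOf ψ) = 1 := by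
  obtain ⟨γ, hγ⟩ := IsCyclic.exists_generator (α := Fˣ)
  have hw0 : w ≠ 0 := by
    rintro rfl
    simp at hw
  obtain ⟨m, hm⟩ := (mem_powers_iff_mem_zpowers).2 (hγ (Units.mk0 w hw0))
  have hm' : w = (γ : F) ^ m := by
    have := congrArg (fun u : Fˣ => (u : F)) hm
    simpa using this.symm
  have hψ : ψ ^ m = 1 := by
    rw [MulChar.eq_one_iff]
    intro u
    obtain ⟨n, rfl⟩ := (mem_powers_iff_mem_zpowers).2 (hγ u)
    rw [MulChar.pow_apply_coe, Units.val_pow_eq_pow_val, map_pow ψ, pow_right_comm, ← map_pow ψ,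
      ← hm', hw, one_pow]
  obtain ⟨m', rfl⟩ := orderOf_dvd_of_pow_eq_one hψ
  have hdvd : orderOf ψ ∣ Fintype.card F - 1 := by
    classical
    rw [← Fintype.card_units]
    exact orderOf_dvd_of_pow_eq_one ψ.pow_card_eq_one
  rw [hm', ← pow_mul, mul_right_comm, Nat.mul_div_cancel' hdvd, pow_mul,
    FiniteField.pow_card_sub_one_eq_one _ γ.ne_zero, one_pow]

theorem sum_abs_le_of_le {ι : Type*} (s : Finset ι) (a : ι → ℝ) {c : ℝ} (hc : 0 ≤ c)
    (h : ∀ i ∈ s, a i ≤ c) : ∑ i ∈ s, |a i| ≤ 2 * s.card * c - ∑ i ∈ s, a i := by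
  calc ∑ i ∈ s, |a i| ≤ ∑ i ∈ s, (2 * c - a i) := by
        refine Finset.sum_le_sum fun i hi => ?_
        have := h i hi
        rw [abs_le]
        constructor <;> linarith
    _ = _ := by
        rw [Finset.sum_sub_distrib, Finset.sum_const, nsmul_eq_mul]
        ring

theorem norm_sum_mulChar_norm_le {F K : Type*} [Field F] [Fintype F] [Field K] [Fintype K]
    [Algebra F K] {n : ℕ} (hcard : Fintype.card K = Fintype.card F ^ (2 * n))
    {ψ : MulChar F ℂ} (hψ : ψ ≠ 1) (f : Polynomial K)
    (h : ∀ n, (∀ a, orderOf ψ ∣ n * f.rootMultiplicity a) → orderOf ψ ∣ n) :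
    ‖∑ x : K, ψ (Algebra.norm F (f.eval x))‖ ≤
      (2 * (orderOf ψ * (orderOf ψ * (9 + 2 * f.natDegree) + 5 * f.natDegree + 6)) +
        f.natDegree) * (Fintype.card F : ℝ) ^ n := by
  classical
  obtain ⟨p, _⟩ := CharP.exists F
  obtain ⟨k, hp, hk⟩ := FiniteField.card F p
  have : Fact p.Prime := ⟨hp⟩
  have : CharP K p := charP_of_injective_algebraMap (algebraMap F K).injective p
  set q := Fintype.card F
  set d := orderOf ψ
  set P := q ^ n
  have hd : 0 < d := ψ.orderOf_pos
  have hd1 : 1 < d := by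
    rcases Nat.lt_or_ge 1 d with h | h
    · exact h
    · exact absurd (orderOf_eq_one_iff.1 (le_antisymm h hd)) hψ
  have hdq : d ∣ q - 1 := by
    rw [← Fintype.card_units]
    exact orderOf_dvd_of_pow_eq_one ψ.pow_card_eq_one
  have hcard' : Fintype.card K = P ^ 2 := by rw [hcard, mul_comm, pow_mul]
  have hq1 : 1 ≤ q := Fintype.card_pos
  have hP1 : 1 ≤ P := Nat.one_le_pow _ _ hq1
  obtain ⟨e, he⟩ : d ∣ P - 1 := hdq.trans (by simpa using Nat.sub_dvd_pow_sub_pow q 1 n)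
  have hde : P = d * e + 1 := by omega
  have hf0 : f ≠ 0 := by
    rintro rfl
    have := h 1 (by simp)
    rw [Nat.dvd_one] at this
    omega
  have hexp : (Nat.card K - 1) / (Nat.card F - 1) * ((q - 1) / d) = e * (P + 1) := by
    rw [Nat.card_eq_fintype_card, Nat.card_eq_fintype_card]
    have h1 : q - 1 ∣ Fintype.card K - 1 := by
      rw [hcard]
      simpa using Nat.sub_dvd_pow_sub_pow q 1 (2 * n)
    rw [Nat.div_mul_div_comm h1 hdq]
    have hq2 : 0 < q - 1 := Nat.sub_pos_of_lt Fintype.one_lt_card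
    change (Fintype.card K - 1) * (q - 1) / ((q - 1) * d) = _
    rw [mul_comm (q - 1) d, Nat.mul_div_mul_right _ _ hq2, hcard', hde]
    apply Nat.div_eq_of_eq_mul_left hd
    have : (d * e + 1) ^ 2 = e * (d * e + 1 + 1) * d + 1 := by ring
    omega
  set Cst := d * (d * (9 + 2 * f.natDegree) + 5 * f.natDegree + 6)
  set V := Polynomial.nthRootsFinset d (1 : ℂ)
  have hprim : IsPrimitiveRoot (Complex.exp (2 * Real.pi * Complex.I / d)) d :=
    Complex.isPrimitiveRoot_exp d hd.ne'
  have hVcard : V.card = d := hprim.card_nthRootsFinset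
  set g : K → ℂ := fun x => ψ (Algebra.norm F (f.eval x))
  set N : ℂ → ℕ := fun u => (Finset.univ.filter fun x => g x = u).card
  have hgV : ∀ x, f.eval x ≠ 0 → g x ∈ V := by
    intro x hx
    rw [Polynomial.mem_nthRootsFinset hd]
    have hne : Algebra.norm F (f.eval x) ≠ 0 := by rwa [Ne, Algebra.norm_eq_zero_iff]
    change ψ _ ^ d = 1
    rw [← MulChar.pow_apply' _ hd.ne', pow_orderOf_eq_one, MulChar.one_apply hne.isUnit]
  have hg0 : ∀ x, f.eval x = 0 → g x = 0 := fun x hx => by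
    simp only [g]
    rw [hx, Algebra.norm_zero]
    exact MulChar.map_zero ψ
  have hN : ∀ u ∈ V, d * N u ≤ P ^ 2 + Cst * P := by
    intro u hu
    rcases (Finset.univ.filter fun x => g x = u).eq_empty_or_nonempty with hZ | ⟨x₀, hx₀⟩
    · simp [N, hZ]
    have hgx₀ : g x₀ = u := (Finset.mem_filter.1 hx₀).2
    have hu0 : u ≠ 0 := by
      rintro rfl
      rw [Polynomial.mem_nthRootsFinset hd, zero_pow hd.ne'] at hu
      exact zero_ne_one hu
    have hfx : ∀ x, g x = u → f.eval x ≠ 0 := fun x hx h0 => hu0 (by rw [← hx, hg0 x h0])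
    refine le_trans (Nat.mul_le_mul_left d (Finset.card_le_card ?_))
      (card_pow_eq_le (a := k * n) p (by rw [pow_mul, ← hk]) hcard' hd hde h
        (ζ := f.eval x₀ ^ (e * (P + 1))) (pow_ne_zero _ (hfx _ hgx₀)))
    intro x hx
    have hgx : g x = u := (Finset.mem_filter.1 hx).2
    rw [Finset.mem_filter]
    refine ⟨Finset.mem_univ _, ?_⟩
    rw [← hexp, pow_mul, pow_mul, ← FiniteField.algebraMap_norm_eq_pow,
      ← FiniteField.algebraMap_norm_eq_pow, ← map_pow (algebraMap F K),
      ← map_pow (algebraMap F K)]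
    congr 1
    have hn0 : Algebra.norm F (f.eval x₀) ≠ 0 := by
      rw [Ne, Algebra.norm_eq_zero_iff]
      exact hfx _ hgx₀
    have := MulChar.pow_card_sub_one_div_orderOf_eq_one (ψ := ψ)
      (w := Algebra.norm F (f.eval x) / Algebra.norm F (f.eval x₀)) (by
        rw [div_eq_mul_inv, map_mul, ← MulChar.inv_apply', MulChar.inv_apply_eq_inv']
        change g x * (g x₀)⁻¹ = 1
        rw [hgx, hgx₀, mul_inv_cancel₀ hu0])
    rwa [div_pow, div_eq_one_iff_eq (pow_ne_zero _ hn0)] at this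
  have hsumN : (P ^ 2 : ℝ) ≤ ∑ u ∈ V, (N u : ℝ) + f.natDegree := by
    have h1 : Fintype.card K ≤ (Finset.univ.filter fun x => g x ∈ V).card + f.natDegree := by
      rw [← Finset.card_univ, ← Finset.card_filter_add_card_filter_not (fun x => g x ∈ V)]
      refine Nat.add_le_add_left (le_trans (Finset.card_le_card (t := f.roots.toFinset) ?_)
        ((Multiset.toFinset_card_le _).trans (Polynomial.card_roots' f))) _
      intro x hx
      rw [Multiset.mem_toFinset, Polynomial.mem_roots hf0, Polynomial.IsRoot.def]
      by_contra hne
      exact (Finset.mem_filter.1 hx).2 (hgV x hne)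
    have h2 : (Finset.univ.filter fun x => g x ∈ V).card = ∑ u ∈ V, N u := by
      rw [Finset.card_eq_sum_card_fiberwise (f := g) (t := V) (by
        intro x hx
        simpa using hx)]
      refine Finset.sum_congr rfl fun u hu => ?_
      rw [Finset.filter_filter]
      congr 1
      ext x
      simp only [Finset.mem_filter, Finset.mem_univ, true_and, and_iff_right_iff_imp]
      rintro rfl
      exact hu
    rw [hcard', h2] at h1
    exact_mod_cast h1
  have hsum : ∑ x, g x = ∑ u ∈ V, (((N u : ℝ) - P ^ 2 / d : ℝ) : ℂ) * u := by
    have h1 : ∑ x, g x = ∑ u ∈ V, (N u : ℂ) * u := by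
      have : ∑ x, g x = ∑ x with g x ∈ V, g x := by
        symm
        refine Finset.sum_subset (Finset.filter_subset _ _) fun x _ hx => ?_
        by_contra hne
        refine hx (Finset.mem_filter.2 ⟨Finset.mem_univ _, hgV x fun h0 => hne (hg0 x h0)⟩)
      rw [this, ← Finset.sum_fiberwise_of_maps_to (g := g) (t := V) (by
        intro x hx
        simpa using hx)]
      refine Finset.sum_congr rfl fun u hu => ?_
      rw [Finset.sum_congr rfl (g := fun _ => u) (by
        intro x hx
        exact (Finset.mem_filter.1 hx).2), Finset.sum_const, nsmul_eq_mul]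
      congr 3
      ext x
      simp only [Finset.mem_filter, Finset.mem_univ, true_and, and_iff_right_iff_imp]
      rintro rfl
      exact hu
    have h0 : ∑ u ∈ V, u = 0 := by
      have hζ := hprim.ne_one hd1
      set ζ := Complex.exp (2 * Real.pi * Complex.I / d)
      have hζ0 : ζ ≠ 0 := hprim.ne_zero hd.ne'
      have h2 : ζ * ∑ u ∈ V, u = ∑ u ∈ V, u := by
        rw [Finset.mul_sum]
        refine Finset.sum_bij' (fun u _ => ζ * u) (fun u _ => ζ⁻¹ * u) ?_ ?_ ?_ ?_ ?_
        · intro u hu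
          rw [Polynomial.mem_nthRootsFinset hd] at hu ⊢
          rw [mul_pow, hu, hprim.pow_eq_one, one_mul]
        · intro u hu
          rw [Polynomial.mem_nthRootsFinset hd] at hu ⊢
          rw [mul_pow, hu, inv_pow, hprim.pow_eq_one, inv_one, one_mul]
        · intro u _
          rw [inv_mul_cancel_left₀ hζ0]
        · intro u _
          rw [mul_inv_cancel_left₀ hζ0]
        · intro u _
          rfl
      by_contra hne
      exact hζ (mul_right_cancel₀ hne (h2.trans (one_mul _).symm))
    rw [h1]
    push_cast
    simp only [sub_mul, Finset.sum_sub_distrib]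
    rw [← Finset.mul_sum, h0, mul_zero, sub_zero]
  change ‖∑ x, g x‖ ≤ _
  rw [hsum]
  have hdR : (0 : ℝ) < d := by exact_mod_cast hd
  calc ‖∑ u ∈ V, (((N u : ℝ) - P ^ 2 / d : ℝ) : ℂ) * u‖
      ≤ ∑ u ∈ V, |(N u : ℝ) - P ^ 2 / d| := by
        refine (norm_sum_le _ _).trans (Finset.sum_le_sum fun u hu => ?_)
        rw [norm_mul, Complex.norm_real, Real.norm_eq_abs,
          Complex.norm_eq_one_of_pow_eq_one ((Polynomial.mem_nthRootsFinset hd _).1 hu) hd.ne',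
          mul_one]
    _ ≤ 2 * V.card * (Cst * P / d) - ∑ u ∈ V, ((N u : ℝ) - P ^ 2 / d) := by
        refine sum_abs_le_of_le _ _ (by positivity) fun u hu => ?_
        have : (d * N u : ℝ) ≤ P ^ 2 + Cst * P := by exact_mod_cast hN u hu
        rw [sub_le_iff_le_add, ← add_div, le_div_iff₀ hdR]
        linarith
    _ = 2 * (Cst * P) - (∑ u ∈ V, (N u : ℝ) - P ^ 2) := by
        rw [Finset.sum_sub_distrib, Finset.sum_const, nsmul_eq_mul, hVcard]
        field_simp
    _ ≤ 2 * (Cst * P) + f.natDegree * 1 := by linarith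
    _ ≤ 2 * (Cst * P) + f.natDegree * P := by
        gcongr
        exact_mod_cast hP1
    _ = _ := by
        simp only [Cst, P]
        push_cast
        ring

open Polynomial in
theorem rootMultiplicity_prod_C_sub_X_pow {K ι : Type*} [Field K] [Fintype ι] {b : ι → K}
    (hb : Function.Injective b) (e : ι → ℕ) (i : ι) :
    (∏ j, (C (b j) - X) ^ e j).rootMultiplicity (b i) = e i := by
  classical
  have hne : ∀ j, C (b j) - X ≠ 0 := fun j h => by
    have := congrArg natDegree h
    rw [← neg_sub, natDegree_neg, natDegree_X_sub_C] at this
    simp at this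
  have hroots : ∀ j, (C (b j) - X).roots = {b j} := fun j => by
    rw [← neg_sub, roots_neg, roots_X_sub_C]
  rw [← count_roots, roots_prod _ _ (Finset.prod_ne_zero_iff.2 fun j _ => pow_ne_zero _ (hne j)),
    Multiset.count_bind]
  simp only [roots_pow, hroots, Multiset.count_nsmul, Multiset.count_singleton]
  change ∑ j, _ = _
  simp [hb.eq_iff]

open Polynomial in
theorem natDegree_prod_C_sub_X_pow {K ι : Type*} [Field K] [Fintype ι] (b : ι → K) (e : ι → ℕ) :
    (∏ j, (C (b j) - X) ^ e j).natDegree = ∑ j, e j := by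
  have hdeg : ∀ j, (C (b j) - X).natDegree = 1 := fun j => by
    rw [← neg_sub, natDegree_neg, natDegree_X_sub_C]
  rw [natDegree_prod _ _ fun j _ => pow_ne_zero _ fun h => by simpa [h] using hdeg j]
  simp [natDegree_pow, hdeg]

theorem MulChar.exists_forall_eq_pow {F ι : Type*} [Field F] [Fintype F] (χ : ι → MulChar F ℂ) :
    ∃ ψ : MulChar F ℂ, (∀ i, ∃ e, 0 < e ∧ χ i = ψ ^ e) ∧
      ∀ n, (∀ i, χ i ^ n = 1) → ψ ^ n = 1 := by
  have : IsCyclic (MulChar F ℂ) := by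
    obtain ⟨φ⟩ := MulChar.mulEquiv_units F ℂ
    exact isCyclic_of_injective φ.toMonoidHom φ.injective
  obtain ⟨⟨ψ, hψ⟩, hgen⟩ :=
    IsCyclic.exists_generator (α := Subgroup.closure (Set.range χ))
  refine ⟨ψ, fun i => ?_, fun n hn => ?_⟩
  · obtain ⟨e, he⟩ := mem_powers_iff_mem_zpowers.2
      (hgen ⟨χ i, Subgroup.subset_closure (Set.mem_range_self i)⟩)
    refine ⟨e + orderOf ψ, Nat.add_pos_right _ ψ.orderOf_pos, ?_⟩
    rw [pow_add, pow_orderOf_eq_one, mul_one]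
    exact (congrArg Subtype.val he).symm
  · have hle : Subgroup.closure (Set.range χ) ≤ (powMonoidHom n).ker := by
      rw [Subgroup.closure_le]
      rintro _ ⟨i, rfl⟩
      exact hn i
    exact hle hψ

open Polynomial in
theorem exists_norm_sum_prod_mulChar_norm_le {F ι : Type*} [Field F] [Fintype F] [Fintype ι]
    {χ : ι → MulChar F ℂ} (hχ : ∃ i, χ i ≠ 1) {b : ι → F} (hb : Function.Injective b) :
    ∃ A : ℝ, ∀ (n : ℕ) (K : Type) [Field K] [Fintype K] [Algebra F K],
      Fintype.card K = Fintype.card F ^ (2 * n) →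
        ‖∑ x : K, ∏ i, χ i (Algebra.norm F (algebraMap F K (b i) - x))‖ ≤
          A * (Fintype.card F : ℝ) ^ n := by
  obtain ⟨ψ, hpow, hone⟩ := MulChar.exists_forall_eq_pow χ
  choose e he heq using hpow
  have hψ : ψ ≠ 1 := by
    rintro rfl
    obtain ⟨i, hi⟩ := hχ
    exact hi (by rw [heq, one_pow])
  refine ⟨2 * (orderOf ψ * (orderOf ψ * (9 + 2 * (∑ i, e i : ℕ)) + 5 * (∑ i, e i : ℕ) + 6)) +
    (∑ i, e i : ℕ), fun n K _ _ _ hcard => ?_⟩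
  have hb' : Function.Injective fun i => algebraMap F K (b i) :=
    (algebraMap F K).injective.comp hb
  have := norm_sum_mulChar_norm_le hcard hψ (∏ i, (C (algebraMap F K (b i)) - X) ^ e i)
    (fun n hn => orderOf_dvd_of_pow_eq_one (hone n fun i => by
      have := hn (algebraMap F K (b i))
      rw [rootMultiplicity_prod_C_sub_X_pow hb'] at this
      rw [heq, ← pow_mul, mul_comm]
      exact orderOf_dvd_iff_pow_eq_one.1 this))
  rw [natDegree_prod_C_sub_X_pow] at this
  convert this using 4 with x
  rw [eval_prod, map_prod, map_prod]
  refine Finset.prod_congr rfl fun i _ => ?_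
  rw [eval_pow, map_pow, map_pow, heq, MulChar.pow_apply' _ (he i).ne', eval_sub, eval_C, eval_X]

theorem MulChar.prod_apply_units {R R' ι : Type*} [CommMonoid R] [CommMonoidWithZero R']
    (s : Finset ι) (χ : ι → MulChar R R') (a : Rˣ) : (∏ i ∈ s, χ i) a = ∏ i ∈ s, χ i a := by
  classical
  induction s using Finset.induction_on with
  | empty => simp
  | insert i s hi ih => rw [Finset.prod_insert hi, Finset.prod_insert hi, MulChar.mul_apply, ih]

section PolynomialCharacterSums

open Polynomial

/-- The completely multiplicative function on polynomials obtained by evaluating characters at the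
values of a polynomial at given points. -/
noncomputable def evalCharacter {F ι : Type*} [Field F] [Fintype ι] (χ : ι → MulChar F ℂ)
    (b : ι → F) : F[X] →* ℂ where
  toFun f := ∏ s, χ s (f.eval (b s))
  map_one' := by simp
  map_mul' f g := by simp [Finset.prod_mul_distrib]

theorem evalCharacter_apply {F ι : Type*} [Field F] [Fintype ι] (χ : ι → MulChar F ℂ)
    (b : ι → F) (f : F[X]) :
    evalCharacter χ b f = ∏ s, χ s (f.eval (b s)) := rfl

variable {F : Type*} [Field F] [Fintype F]

theorem finite_setOf_degree_lt (n : ℕ) : {f : F[X] | f.degree < n}.Finite := by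
  have : Finite (degreeLT F n) := Finite.of_equiv _ (degreeLTEquiv F n).symm.toEquiv
  refine (Set.toFinite (degreeLT F n : Set F[X])).subset fun f hf => mem_degreeLT.2 hf

variable (F) in
/-- The polynomials over a finite field of degree less than `n`. -/
noncomputable def polynomialsDegreeLT (n : ℕ) : Finset F[X] :=
  (finite_setOf_degree_lt n).toFinset

variable (F) in
/-- The monic polynomials over a finite field of degree `n`. -/
noncomputable def monicPolynomials (n : ℕ) : Finset F[X] := by
  classical
  exact (polynomialsDegreeLT F (n + 1)).filter fun f => f.Monic ∧ f.natDegree = n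

theorem mem_polynomialsDegreeLT {n : ℕ} {f : F[X]} :
    f ∈ polynomialsDegreeLT F n ↔ f.degree < n := by
  simp [polynomialsDegreeLT]

theorem mem_monicPolynomials {n : ℕ} {f : F[X]} :
    f ∈ monicPolynomials F n ↔ f.Monic ∧ f.natDegree = n := by
  classical
  simp only [monicPolynomials, Finset.mem_filter, mem_polynomialsDegreeLT, and_iff_right_iff_imp]
  rintro ⟨_, rfl⟩
  exact degree_le_natDegree.trans_lt (by exact_mod_cast Nat.lt_succ_self _)

theorem sum_monicPolynomials (n : ℕ) (g : F[X] → ℂ) :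
    ∑ f ∈ monicPolynomials F n, g f = ∑ h ∈ polynomialsDegreeLT F n, g (X ^ n + h) := by
  refine Finset.sum_bij' (fun f _ => f - X ^ n) (fun h _ => X ^ n + h) ?_ ?_ ?_ ?_ ?_
  · intro f hf
    obtain ⟨hm, rfl⟩ := mem_monicPolynomials.1 hf
    rw [mem_polynomialsDegreeLT, ← degree_eq_natDegree hm.ne_zero]
    refine degree_sub_lt_left ?_ hm.ne_zero ?_
    · rw [degree_X_pow, degree_eq_natDegree hm.ne_zero]
    · rw [hm.leadingCoeff, leadingCoeff_X_pow]
  · intro h hh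
    rw [mem_polynomialsDegreeLT] at hh
    exact mem_monicPolynomials.2 ⟨monic_X_pow_add hh, natDegree_eq_of_degree_eq_some
      (by rw [degree_add_eq_left_of_degree_lt (by rwa [degree_X_pow]), degree_X_pow])⟩
  · intro f _
    ring
  · intro h _
    ring
  · intro f _
    congr 1
    ring

variable {ι : Type*} [Fintype ι]

theorem sum_evalCharacter_add_eq_zero {χ : ι → MulChar F ℂ} {b : ι → F}
    (hb : Function.Injective b) (hχ : ∃ s, χ s ≠ 1) {n : ℕ} (hn : Fintype.card ι ≤ n) (g : F[X]) :
    ∑ h ∈ polynomialsDegreeLT F n, evalCharacter χ b (g + h) = 0 := by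
  classical
  obtain ⟨s₀, hs₀⟩ := hχ
  set u := Lagrange.basis Finset.univ b s₀
  have hu : u.degree < n := by
    rw [Lagrange.degree_basis hb.injOn (Finset.mem_univ _), Finset.card_univ]
    have : 0 < Fintype.card ι := Fintype.card_pos_iff.2 ⟨s₀⟩
    exact_mod_cast (by omega : Fintype.card ι - 1 < n)
  have hu₀ : u.eval (b s₀) = 1 := Lagrange.eval_basis_self hb.injOn (Finset.mem_univ _)
  have hu₁ : ∀ s ≠ s₀, u.eval (b s) = 0 := fun s hs =>
    Lagrange.eval_basis_of_ne hs.symm (Finset.mem_univ _)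
  have hinner : ∀ f : F[X], ∑ t : F, evalCharacter χ b (f + C t * u) = 0 := by
    intro f
    have : ∀ t : F, evalCharacter χ b (f + C t * u) =
        χ s₀ (f.eval (b s₀) + t) * ∏ s ∈ Finset.univ.erase s₀, χ s (f.eval (b s)) := by
      intro t
      rw [evalCharacter_apply, ← Finset.mul_prod_erase _ _ (Finset.mem_univ s₀)]
      congr 1
      · simp [hu₀]
      · refine Finset.prod_congr rfl fun s hs => ?_
        simp [hu₁ s (Finset.ne_of_mem_erase hs)]
    simp only [this]
    have hsum : ∑ t, χ s₀ (f.eval (b s₀) + t) = ∑ t, χ s₀ t :=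
      Fintype.sum_equiv (Equiv.addLeft (f.eval (b s₀))) _ _ fun _ => rfl
    rw [← Finset.sum_mul, hsum, MulChar.sum_eq_zero_of_ne_one hs₀, zero_mul]
  have hshift : ∀ t : F, ∑ h ∈ polynomialsDegreeLT F n, evalCharacter χ b (g + h) =
      ∑ h ∈ polynomialsDegreeLT F n, evalCharacter χ b (g + h + C t * u) := by
    intro t
    have htu : (C t * u).degree < n := by
      rw [← smul_eq_C_mul]
      exact (degree_smul_le t u).trans_lt hu
    refine Finset.sum_bij' (fun h _ => h - C t * u) (fun h _ => h + C t * u) ?_ ?_ ?_ ?_ ?_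
    · intro h hh
      rw [mem_polynomialsDegreeLT] at hh ⊢
      exact (degree_sub_le _ _).trans_lt (max_lt hh htu)
    · intro h hh
      rw [mem_polynomialsDegreeLT] at hh ⊢
      exact (degree_add_le _ _).trans_lt (max_lt hh htu)
    · intro h _
      ring
    · intro h _
      ring
    · intro h _
      congr 1
      ring
  have hq : (Fintype.card F : ℂ) ≠ 0 := Nat.cast_ne_zero.2 Fintype.card_ne_zero
  refine (mul_eq_zero.1 ?_).resolve_left hq
  rw [← nsmul_eq_mul, ← Finset.card_univ, ← Finset.sum_const, Finset.sum_congr rfl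
    (fun t _ => hshift t), Finset.sum_comm]
  exact Finset.sum_eq_zero fun h _ => hinner _

theorem sum_monicPolynomials_evalCharacter_eq_zero {χ : ι → MulChar F ℂ} {b : ι → F}
    (hb : Function.Injective b) (hχ : ∃ s, χ s ≠ 1) {n : ℕ} (hn : Fintype.card ι ≤ n) :
    ∑ f ∈ monicPolynomials F n, evalCharacter χ b f = 0 := by
  rw [sum_monicPolynomials]
  exact sum_evalCharacter_add_eq_zero hb hχ hn _

theorem sum_range_sum_monicPolynomials_eq_zero {χ : ι → MulChar F ℂ} {b : ι → F}
    (hb : Function.Injective b) (hχ : ∃ s, χ s ≠ 1) (hprod : ∏ s, χ s = 1) :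
    ∑ n ∈ Finset.range (Fintype.card ι),
      ∑ f ∈ monicPolynomials F n, evalCharacter χ b f = 0 := by
  classical
  have hne : Nonempty ι := ⟨hχ.choose⟩
  have h0 : evalCharacter χ b 0 = 0 := by
    rw [evalCharacter_apply]
    refine Finset.prod_eq_zero (Finset.mem_univ hne.some) ?_
    rw [eval_zero, MulChar.map_zero]
  have hC : ∀ (c : Fˣ) (f : F[X]), evalCharacter χ b (C (c : F) * f) = evalCharacter χ b f := by
    intro c f
    rw [map_mul]
    convert one_mul _
    have : (∏ s, χ s) c = 1 := by rw [hprod, MulChar.one_apply_coe]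
    rw [← this, evalCharacter_apply, MulChar.prod_apply_units]
    simp
  have hsum := sum_evalCharacter_add_eq_zero hb hχ le_rfl 0
  simp only [zero_add] at hsum
  have key : ∑ h ∈ polynomialsDegreeLT F (Fintype.card ι), evalCharacter χ b h =
      ∑ c : Fˣ, ∑ n ∈ Finset.range (Fintype.card ι),
        ∑ f ∈ monicPolynomials F n, evalCharacter χ b f := by
    rw [← Finset.sum_erase _ h0]
    have hmonic : ∑ n ∈ Finset.range (Fintype.card ι), ∑ f ∈ monicPolynomials F n,
        evalCharacter χ b f = ∑ f ∈ (polynomialsDegreeLT F (Fintype.card ι)).filter Monic,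
          evalCharacter χ b f := by
      rw [← Finset.sum_fiberwise_of_maps_to (t := Finset.range (Fintype.card ι))
        (g := natDegree) fun f hf => ?_]
      · refine Finset.sum_congr rfl fun n hn => Finset.sum_congr ?_ fun _ _ => rfl
        ext f
        simp only [mem_monicPolynomials, Finset.mem_filter, mem_polynomialsDegreeLT]
        refine ⟨fun ⟨hm, hf⟩ => ⟨⟨?_, hm⟩, hf⟩, fun ⟨⟨_, hm⟩, hf⟩ => ⟨hm, hf⟩⟩
        rw [degree_eq_natDegree hm.ne_zero, hf]
        exact_mod_cast Finset.mem_range.1 hn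
      · obtain ⟨hf, hm⟩ := Finset.mem_filter.1 hf
        rw [mem_polynomialsDegreeLT, degree_eq_natDegree hm.ne_zero] at hf
        exact Finset.mem_range.2 (by exact_mod_cast hf)
    rw [hmonic, ← Finset.sum_product']
    symm
    refine Finset.sum_bij (fun x _ => C (x.1 : F) * x.2) ?_ ?_ ?_ ?_
    · rintro ⟨c, f⟩ hx
      obtain ⟨hf, hm⟩ := Finset.mem_filter.1 (Finset.mem_product.1 hx).2
      rw [mem_polynomialsDegreeLT] at hf
      refine Finset.mem_erase.2 ⟨mul_ne_zero (C_ne_zero.2 c.ne_zero) hm.ne_zero, ?_⟩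
      rw [mem_polynomialsDegreeLT, degree_C_mul c.ne_zero]
      exact hf
    · rintro ⟨c, f⟩ hx ⟨c', f'⟩ hx' h
      obtain ⟨_, hm⟩ := Finset.mem_filter.1 (Finset.mem_product.1 hx).2
      obtain ⟨_, hm'⟩ := Finset.mem_filter.1 (Finset.mem_product.1 hx').2
      simp only at h hm hm'
      have hc : c = c' := by
        have := congrArg leadingCoeff h
        simpa [hm.leadingCoeff, hm'.leadingCoeff, Units.ext_iff] using this
      subst hc
      rw [mul_left_cancel₀ (C_ne_zero.2 c.ne_zero) h]
    · intro h hh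
      obtain ⟨h0, hh⟩ := Finset.mem_erase.1 hh
      rw [mem_polynomialsDegreeLT] at hh
      have hlc : h.leadingCoeff ≠ 0 := leadingCoeff_ne_zero.2 h0
      refine ⟨⟨Units.mk0 _ hlc, C h.leadingCoeff⁻¹ * h⟩, ?_, ?_⟩
      · refine Finset.mem_product.2 ⟨Finset.mem_univ _, Finset.mem_filter.2 ⟨?_, ?_⟩⟩
        · rw [mem_polynomialsDegreeLT, degree_C_mul (inv_ne_zero hlc)]
          exact hh
        · exact monic_C_mul_of_mul_leadingCoeff_eq_one (inv_mul_cancel₀ hlc)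
      · simp only [Units.val_mk0]
        rw [← mul_assoc, ← C_mul, mul_inv_cancel₀ hlc, C_1, one_mul]
    · rintro ⟨c, f⟩ _
      exact (hC c f).symm
  rw [key, Finset.sum_const, nsmul_eq_mul] at hsum
  refine (mul_eq_zero.1 hsum).resolve_left ?_
  exact Nat.cast_ne_zero.2 Fintype.card_ne_zero

end PolynomialCharacterSums

section NewtonIdentity

open Finset.HasAntidiagonal (antidiagonal)

open Polynomial

variable {F : Type*} [Field F] [Fintype F]

variable (F) in
/-- The monic irreducible polynomials over a finite field of degree `n`. -/
noncomputable def irreduciblePolynomials (n : ℕ) : Finset F[X] := by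
  classical
  exact (monicPolynomials F n).filter Irreducible

theorem mem_irreduciblePolynomials {n : ℕ} {f : F[X]} :
    f ∈ irreduciblePolynomials F n ↔ f.Monic ∧ f.natDegree = n ∧ Irreducible f := by
  classical
  simp [irreduciblePolynomials, mem_monicPolynomials, and_assoc]

open UniqueFactorizationMonoid in
theorem natDegree_eq_sum_irreduciblePolynomials [DecidableRel (α := F[X]) (· ∣ ·)] {n : ℕ}
    {f : F[X]} (hf : f ∈ monicPolynomials F n) :
    n = ∑ j ∈ Finset.Icc 1 n, ∑ i ∈ Finset.Icc 1 n, ∑ P ∈ irreduciblePolynomials F j,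
      if P ^ i ∣ f then j else 0 := by
  classical
  obtain ⟨hm, rfl⟩ := mem_monicPolynomials.1 hf
  have hf0 := hm.ne_zero
  have hP : ∀ P ∈ normalizedFactors f, P.Monic ∧ Irreducible P ∧ P ∣ f := fun P hP => by
    have h1 := irreducible_of_normalized_factor P hP
    refine ⟨?_, h1, dvd_of_mem_normalizedFactors hP⟩
    rw [← normalize_normalized_factor P hP]
    exact monic_normalize h1.ne_zero
  have hcount : ∀ P : F[X], P.Monic → Irreducible P → ∀ i,
      P ^ i ∣ f ↔ i ≤ (normalizedFactors f).count P := by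
    intro P hPm hPi i
    rw [dvd_iff_normalizedFactors_le_normalizedFactors (pow_ne_zero _ hPi.ne_zero) hf0,
      normalizedFactors_pow, normalizedFactors_irreducible hPi, hPm.normalize_eq_self,
      Multiset.nsmul_singleton, Multiset.le_count_iff_replicate_le]
  have hmul : ∀ P ∈ normalizedFactors f, (normalizedFactors f).count P ≤ f.natDegree := by
    intro P hPf
    obtain ⟨hPm, hPi, -⟩ := hP P hPf
    have h1 := natDegree_le_of_dvd ((hcount P hPm hPi _).2 le_rfl) hf0
    rw [natDegree_pow] at h1
    exact (Nat.le_mul_of_pos_right _ hPi.natDegree_pos).trans h1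
  have hdeg : f.natDegree =
      ∑ P ∈ (normalizedFactors f).toFinset, (normalizedFactors f).count P * P.natDegree := by
    conv_lhs => rw [← hm.normalize_eq_self, ← prod_normalizedFactors_eq hf0,
      natDegree_multiset_prod_of_monic _ fun P h => (hP P h).1,
      Finset.sum_multiset_map_count]
    rfl
  conv_lhs => rw [hdeg]
  rw [← Finset.sum_fiberwise_of_maps_to (t := Finset.Icc 1 f.natDegree) (g := natDegree)
    fun P h => ?_]
  · refine Finset.sum_congr rfl fun j hj => ?_
    rw [Finset.sum_comm]
    refine Finset.sum_subset_zero_on_sdiff (fun P h => ?_) (fun P h => ?_) fun P h => ?_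
    · obtain ⟨hPf, hPj⟩ := Finset.mem_filter.1 h
      obtain ⟨hPm, hPi, -⟩ := hP P (Multiset.mem_toFinset.1 hPf)
      exact mem_irreduciblePolynomials.2 ⟨hPm, hPj, hPi⟩
    · obtain ⟨h, hnot⟩ := Finset.mem_sdiff.1 h
      obtain ⟨hPm, hPj, hPi⟩ := mem_irreduciblePolynomials.1 h
      have h0 : (normalizedFactors f).count P = 0 := by
        rw [Multiset.count_eq_zero]
        exact fun h => hnot (Finset.mem_filter.2 ⟨Multiset.mem_toFinset.2 h, hPj⟩)
      refine Finset.sum_eq_zero fun i hi => ?_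
      rw [if_neg]
      rw [hcount P hPm hPi, h0]
      have := (Finset.mem_Icc.1 hi).1
      omega
    · obtain ⟨hPf, hPj⟩ := Finset.mem_filter.1 h
      have hPf := Multiset.mem_toFinset.1 hPf
      obtain ⟨hPm, hPi, -⟩ := hP P hPf
      simp only [hcount P hPm hPi]
      have hfil : (Finset.Icc 1 f.natDegree).filter
          (fun i => i ≤ (normalizedFactors f).count P) =
          Finset.Icc 1 ((normalizedFactors f).count P) := by
        ext i
        have := hmul P hPf
        simp only [Finset.mem_filter, Finset.mem_Icc]
        omega
      rw [← Finset.sum_filter, hfil, Finset.sum_const, Nat.card_Icc, smul_eq_mul, hPj]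
      rfl
  · obtain ⟨hPm, hPi, hPf⟩ := hP P (Multiset.mem_toFinset.1 h)
    exact Finset.mem_Icc.2 ⟨hPi.natDegree_pos, natDegree_le_of_dvd hPf hf0⟩

theorem sum_monicPolynomials_dvd [DecidableRel (α := F[X]) (· ∣ ·)] (Λ : F[X] →* ℂ) {m n : ℕ}
    {g : F[X]} (hg : g ∈ monicPolynomials F m) :
    ∑ f ∈ (monicPolynomials F n).filter (g ∣ ·), Λ f =
      if m ≤ n then Λ g * ∑ f ∈ monicPolynomials F (n - m), Λ f else 0 := by
  obtain ⟨hm, rfl⟩ := mem_monicPolynomials.1 hg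
  split_ifs with h
  · rw [Finset.mul_sum]
    symm
    refine Finset.sum_bij (fun f _ => g * f) ?_ ?_ ?_ ?_
    · intro f hf
      obtain ⟨hfm, hf⟩ := mem_monicPolynomials.1 hf
      refine Finset.mem_filter.2 ⟨mem_monicPolynomials.2 ⟨hm.mul hfm, ?_⟩, dvd_mul_right _ _⟩
      rw [hm.natDegree_mul hfm, hf]
      omega
    · intro f _ f' _ h
      exact mul_left_cancel₀ hm.ne_zero h
    · intro f hf
      obtain ⟨hf, g', rfl⟩ := Finset.mem_filter.1 hf
      obtain ⟨hfm, hf⟩ := mem_monicPolynomials.1 hf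
      have hg' := hm.of_mul_monic_left hfm
      refine ⟨g', mem_monicPolynomials.2 ⟨hg', ?_⟩, rfl⟩
      rw [hm.natDegree_mul hg'] at hf
      omega
    · intro f _
      exact (map_mul Λ g f).symm
  · refine Finset.sum_eq_zero fun f hf => ?_
    obtain ⟨hf, hdvd⟩ := Finset.mem_filter.1 hf
    obtain ⟨hfm, rfl⟩ := mem_monicPolynomials.1 hf
    exact absurd (natDegree_le_of_dvd hdvd hfm.ne_zero) h

/-- The coefficients of the logarithmic derivative of the `L`-function of `Λ`. -/
noncomputable def primePowerSum (Λ : F[X] →* ℂ) (k : ℕ) : ℂ :=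
  ∑ j ∈ k.divisors, ∑ P ∈ irreduciblePolynomials F j, j * Λ P ^ (k / j)

theorem mul_sum_monicPolynomials (Λ : F[X] →* ℂ) (n : ℕ) :
    n * ∑ f ∈ monicPolynomials F n, Λ f =
      ∑ x ∈ antidiagonal n,
        primePowerSum Λ x.1 * ∑ f ∈ monicPolynomials F x.2, Λ f := by
  classical
  set c : ℕ → ℂ := fun n => ∑ f ∈ monicPolynomials F n, Λ f
  set H : ℕ → ℕ → ℂ := fun j i => ∑ P ∈ irreduciblePolynomials F j, j * Λ P ^ i
  have hleft : n * c n = ∑ j ∈ Finset.Icc 1 n, ∑ i ∈ Finset.Icc 1 n,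
      if j * i ≤ n then H j i * c (n - j * i) else 0 := by
    calc (n : ℂ) * c n = ∑ f ∈ monicPolynomials F n,
          ∑ j ∈ Finset.Icc 1 n, ∑ i ∈ Finset.Icc 1 n, ∑ P ∈ irreduciblePolynomials F j,
            if P ^ i ∣ f then j * Λ f else 0 := by
          rw [Finset.mul_sum]
          refine Finset.sum_congr rfl fun f hf => ?_
          conv_lhs => rw [natDegree_eq_sum_irreduciblePolynomials hf]
          push_cast
          simp only [Finset.sum_mul, ite_mul, zero_mul]
      _ = ∑ j ∈ Finset.Icc 1 n, ∑ i ∈ Finset.Icc 1 n, ∑ P ∈ irreduciblePolynomials F j,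
            j * ∑ f ∈ (monicPolynomials F n).filter (P ^ i ∣ ·), Λ f := by
          rw [Finset.sum_comm]
          refine Finset.sum_congr rfl fun j _ => ?_
          rw [Finset.sum_comm]
          refine Finset.sum_congr rfl fun i _ => ?_
          rw [Finset.sum_comm]
          refine Finset.sum_congr rfl fun P _ => ?_
          rw [Finset.mul_sum, Finset.sum_filter]
      _ = _ := by
          refine Finset.sum_congr rfl fun j _ => Finset.sum_congr rfl fun i _ => ?_
          have hsum : ∀ P ∈ irreduciblePolynomials F j,
              (j : ℂ) * ∑ f ∈ (monicPolynomials F n).filter (P ^ i ∣ ·), Λ f =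
              if j * i ≤ n then j * Λ P ^ i * c (n - j * i) else 0 := by
            intro P hP
            obtain ⟨hm, hj, -⟩ := mem_irreduciblePolynomials.1 hP
            rw [sum_monicPolynomials_dvd Λ (m := j * i)
              (mem_monicPolynomials.2 ⟨hm.pow i, by rw [natDegree_pow, hj, mul_comm]⟩), map_pow]
            split_ifs
            · rw [mul_assoc]
            · rw [mul_zero]
          rw [Finset.sum_congr rfl hsum]
          split_ifs
          · rw [← Finset.sum_mul]
          · rw [Finset.sum_const_zero]
  change n * c n = ∑ x ∈ antidiagonal n, primePowerSum Λ x.1 * c x.2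
  have hright : ∀ k, primePowerSum Λ k = ∑ x ∈ k.divisorsAntidiagonal, H x.1 x.2 := fun k =>
    (Nat.sum_divisorsAntidiagonal H).symm
  rw [hleft, ← Finset.sum_product', ← Finset.sum_filter]
  simp only [hright, Finset.sum_mul]
  rw [Finset.sum_sigma']
  refine Finset.sum_bij' (fun x _ => ⟨(x.1 * x.2, n - x.1 * x.2), x⟩) (fun x _ => x.2)
    ?_ ?_ ?_ ?_ ?_
  · rintro ⟨j, i⟩ hx
    simp only [Finset.mem_filter, Finset.mem_product, Finset.mem_Icc] at hx
    have : j * i ≠ 0 := mul_ne_zero (by omega) (by omega)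
    simp only [Finset.mem_sigma, Finset.HasAntidiagonal.mem_antidiagonal,
      Nat.mem_divisorsAntidiagonal]
    exact ⟨Nat.add_sub_cancel' hx.2, trivial, this⟩
  · rintro ⟨⟨k, l⟩, ⟨j, i⟩⟩ hx
    simp only [Finset.mem_sigma, Finset.HasAntidiagonal.mem_antidiagonal,
      Nat.mem_divisorsAntidiagonal] at hx
    obtain ⟨hkl, rfl, h0⟩ := hx
    have hj : 0 < j := Nat.pos_of_ne_zero (left_ne_zero_of_mul h0)
    have hi : 0 < i := Nat.pos_of_ne_zero (right_ne_zero_of_mul h0)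
    have h1 := Nat.le_mul_of_pos_right j hi
    have h2 := Nat.le_mul_of_pos_left i hj
    simp only [Finset.mem_filter, Finset.mem_product, Finset.mem_Icc]
    omega
  · rintro ⟨j, i⟩ _
    rfl
  · rintro ⟨⟨k, l⟩, ⟨j, i⟩⟩ hx
    simp only [Finset.mem_sigma, Finset.HasAntidiagonal.mem_antidiagonal,
      Nat.mem_divisorsAntidiagonal] at hx
    obtain ⟨hkl, rfl, h0⟩ := hx
    have : n - j * i = l := by omega
    simp [this]
  · rintro ⟨j, i⟩ _
    rfl

end NewtonIdentity

section MinpolySums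

open Polynomial Module

theorem Algebra.norm_eq_coeff_zero_minpoly_pow {F K : Type*} [Field F] [Field K] [Algebra F K]
    [FiniteDimensional F K] (y : K) :
    Algebra.norm F y = ((-1) ^ (minpoly F y).natDegree * (minpoly F y).coeff 0) ^
      (finrank F K / (minpoly F y).natDegree) := by
  have hy : IsIntegral F y := Algebra.IsIntegral.isIntegral y
  have h := Algebra.PowerBasis.norm_gen_eq_coeff_zero_minpoly
    (IntermediateField.adjoin.powerBasis hy)
  rw [IntermediateField.adjoin.powerBasis_gen, IntermediateField.minpoly_gen,
    IntermediateField.adjoin.powerBasis_dim] at h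
  rw [Algebra.norm_eq_norm_adjoin, h]
  congr 1
  rw [← IntermediateField.adjoin.finrank hy,
    ← finrank_mul_finrank F (IntermediateField.adjoin F {y}) K,
    Nat.mul_div_cancel_left _ finrank_pos]

theorem Algebra.norm_algebraMap_sub {F K : Type*} [Field F] [Field K] [Algebra F K]
    [FiniteDimensional F K] (b : F) (x : K) :
    Algebra.norm F (algebraMap F K b - x) =
      (minpoly F x).eval b ^ (finrank F K / (minpoly F x).natDegree) := by
  have hmin : minpoly F (algebraMap F K b - x) =
      (-1) ^ (minpoly F x).natDegree * ((minpoly F x).comp (X + C b)).comp (-X) := by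
    rw [← neg_sub, minpoly.neg, minpoly.sub_algebraMap, natDegree_comp, natDegree_X_add_C, mul_one]
  have hdeg : (minpoly F (algebraMap F K b - x)).natDegree = (minpoly F x).natDegree := by
    rw [hmin]
    rcases neg_one_pow_eq_or F[X] (minpoly F x).natDegree with h | h <;>
      simp [h, natDegree_comp]
  have hcoeff : (minpoly F (algebraMap F K b - x)).coeff 0 =
      (-1) ^ (minpoly F x).natDegree * (minpoly F x).eval b := by
    rw [hmin, coeff_zero_eq_eval_zero]
    simp [eval_comp]
  rw [Algebra.norm_eq_coeff_zero_minpoly_pow, hdeg, hcoeff, ← mul_assoc, ← mul_pow]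
  simp

variable {F : Type*} [Field F] [Fintype F]

theorem card_minpoly_eq {K : Type*} [Field K] [Fintype K] [Algebra F K] [DecidableEq F[X]]
    {P : F[X]} (hm : P.Monic) (hP : Irreducible P) (hdeg : P.natDegree ∣ finrank F K) :
    (Finset.univ.filter fun x : K => minpoly F x = P).card = P.natDegree := by
  classical
  have hdvd := hP.natDegree_dvd_iff_dvd_X_pow_card_pow_sub_X.1 hdeg
  have hsplit : (P.map (algebraMap F K)).Splits := by
    refine (FiniteField.isSplittingField_sub K F).splits.of_dvd ?_ (Polynomial.map_dvd _ ?_)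
    · exact map_ne_zero (FiniteField.X_pow_card_sub_X_ne_zero _ Fintype.one_lt_card)
    · rwa [Module.card_eq_pow_finrank (K := F), ← Nat.card_eq_fintype_card]
  rw [← card_rootSet_eq_natDegree (PerfectField.separable_of_irreducible hP) hsplit,
    ← Set.toFinset_card]
  congr 1
  ext x
  rw [Set.mem_toFinset, mem_rootSet_of_ne hm.ne_zero, Finset.mem_filter]
  refine ⟨fun h => h.2 ▸ minpoly.aeval F x, fun h => ⟨Finset.mem_univ _, ?_⟩⟩
  exact (minpoly.eq_of_irreducible_of_monic hP h hm).symm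

theorem sum_norm_eq_primePowerSum {ι K : Type*} [Fintype ι] [Field K] [Fintype K] [Algebra F K]
    (χ : ι → MulChar F ℂ) (b : ι → F) :
    ∑ x : K, ∏ s, χ s (Algebra.norm F (algebraMap F K (b s) - x)) =
      primePowerSum (evalCharacter χ b) (finrank F K) := by
  classical
  have hx : ∀ x : K, ∏ s, χ s (Algebra.norm F (algebraMap F K (b s) - x)) =
      evalCharacter χ b (minpoly F x) ^ (finrank F K / (minpoly F x).natDegree) := by
    intro x
    rw [evalCharacter_apply, ← Finset.prod_pow]
    refine Finset.prod_congr rfl fun s _ => ?_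
    rw [Algebra.norm_algebraMap_sub, map_pow]
  simp only [hx]
  rw [primePowerSum, ← Finset.sum_fiberwise_of_maps_to
    (t := (finrank F K).divisors) (g := fun x : K => (minpoly F x).natDegree) fun x _ => ?_]
  · refine Finset.sum_congr rfl fun j hj => ?_
    rw [← Finset.sum_fiberwise_of_maps_to (t := irreduciblePolynomials F j)
      (g := fun x : K => minpoly F x) fun x hx => ?_]
    · refine Finset.sum_congr rfl fun P hP => ?_
      obtain ⟨hm, rfl, hPi⟩ := mem_irreduciblePolynomials.1 hP
      rw [← card_minpoly_eq (K := K) hm hPi (Nat.dvd_of_mem_divisors hj), Finset.filter_filter,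
        ← nsmul_eq_mul, ← Finset.sum_const]
      have hfil : Finset.univ.filter (fun x : K => (minpoly F x).natDegree =
          (Finset.univ.filter fun x : K => minpoly F x = P).card ∧ minpoly F x = P) =
          Finset.univ.filter fun x : K => minpoly F x = P := by
        ext x
        simp only [Finset.mem_filter, Finset.mem_univ, true_and, and_iff_right_iff_imp]
        rintro rfl
        exact (card_minpoly_eq (K := K) hm hPi (Nat.dvd_of_mem_divisors hj)).symm
      rw [hfil]
      refine Finset.sum_congr rfl fun x hx => ?_
      rw [(Finset.mem_filter.1 hx).2]
      rw [card_minpoly_eq (K := K) hm hPi (Nat.dvd_of_mem_divisors hj)]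
    · have hi : IsIntegral F x := Algebra.IsIntegral.isIntegral x
      exact mem_irreduciblePolynomials.2
        ⟨minpoly.monic hi, (Finset.mem_filter.1 hx).2, minpoly.irreducible hi⟩
  · exact Nat.mem_divisors.2 ⟨minpoly.degree_dvd (Algebra.IsIntegral.isIntegral x),
      finrank_pos.ne'⟩

theorem exists_norm_primePowerSum_le {ι : Type*} [Fintype ι] {χ : ι → MulChar F ℂ}
    (hχ : ∃ i, χ i ≠ 1) {b : ι → F} (hb : Function.Injective b) :
    ∃ A : ℝ, ∀ n, 0 < n →
      ‖primePowerSum (evalCharacter χ b) (2 * n)‖ ≤ A * (Fintype.card F : ℝ) ^ n := by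
  obtain ⟨A, hA⟩ := exists_norm_sum_prod_mulChar_norm_le hχ hb
  refine ⟨A, fun n hn => ?_⟩
  obtain ⟨p, _⟩ := CharP.exists F
  have : Fact p.Prime := ⟨CharP.char_is_prime F p⟩
  have : NeZero (2 * n) := ⟨by omega⟩
  have := Fintype.ofFinite (FiniteField.Extension F p (2 * n))
  have h := hA n (FiniteField.Extension F p (2 * n)) (by
    rw [← Nat.card_eq_fintype_card, FiniteField.natCard_extension, Nat.card_eq_fintype_card])
  rwa [sum_norm_eq_primePowerSum, FiniteField.finrank_extension] at h

end MinpolySums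

section LogarithmicDerivative

open Polynomial
open Finset.HasAntidiagonal (antidiagonal)

theorem PowerSeries.tsum_coeff_mul {A B : PowerSeries ℂ} {z : ℂ}
    (hA : Summable fun n => ‖PowerSeries.coeff n A * z ^ n‖)
    (hB : Summable fun n => ‖PowerSeries.coeff n B * z ^ n‖) :
    ∑' n, PowerSeries.coeff n (A * B) * z ^ n =
      (∑' n, PowerSeries.coeff n A * z ^ n) * ∑' n, PowerSeries.coeff n B * z ^ n := by
  rw [tsum_mul_tsum_eq_tsum_sum_antidiagonal_of_summable_norm hA hB]
  refine tsum_congr fun n => ?_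
  rw [PowerSeries.coeff_mul, Finset.sum_mul]
  refine Finset.sum_congr rfl fun x hx => ?_
  rw [← Finset.HasAntidiagonal.mem_antidiagonal.1 hx, pow_add]
  ring

theorem Polynomial.summable_norm_coeff_mul_pow (f : ℂ[X]) (z : ℂ) :
    Summable fun n => ‖PowerSeries.coeff n (f : PowerSeries ℂ) * z ^ n‖ := by
  refine summable_of_ne_finset_zero (s := Finset.range (f.natDegree + 1)) fun n hn => ?_
  rw [coeff_coe, coeff_eq_zero_of_natDegree_lt (by simpa using hn), zero_mul, norm_zero]

theorem Polynomial.tsum_coeff_mul_pow (f : ℂ[X]) (z : ℂ) :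
    ∑' n, PowerSeries.coeff n (f : PowerSeries ℂ) * z ^ n = f.eval z := by
  rw [eval_eq_sum_range, tsum_eq_sum (s := Finset.range (f.natDegree + 1)) fun n hn => ?_]
  · simp only [coeff_coe]
  · rw [coeff_coe, coeff_eq_zero_of_natDegree_lt (by simpa using hn), zero_mul]

theorem Polynomial.eval_ne_zero_of_X_mul_derivative_eq {M : ℂ[X]} (hM : M ≠ 0)
    {D : PowerSeries ℂ} (hD : ((X * derivative M : ℂ[X]) : PowerSeries ℂ) = D * M) {z : ℂ}
    (hz0 : z ≠ 0) (hz : Summable fun n => ‖PowerSeries.coeff n D * z ^ n‖) : M.eval z ≠ 0 := by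
  intro hroot
  obtain ⟨G, hG, hndvd⟩ := exists_eq_pow_rootMultiplicity_mul_and_not_dvd M hM z
  obtain ⟨ν, hν⟩ := Nat.exists_eq_add_of_lt ((rootMultiplicity_pos hM).2 hroot)
  rw [hν, zero_add] at hG
  have hder : X * derivative M =
      (X - C z) ^ ν * (X * (C ((ν : ℂ) + 1) * G + (X - C z) * derivative G)) := by
    rw [hG]
    simp only [derivative_mul, derivative_X_sub_C_pow, Nat.add_sub_cancel]
    push_cast
    simp only [map_add, map_natCast, map_one]
    ring
  have hcancel : ((X * (C ((ν : ℂ) + 1) * G + (X - C z) * derivative G) : ℂ[X]) : PowerSeries ℂ) =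
      D * (((X - C z) * G : ℂ[X]) : PowerSeries ℂ) := by
    have hne : (((X - C z) ^ ν : ℂ[X]) : PowerSeries ℂ) ≠ 0 := by
      rw [Ne, coe_eq_zero_iff]
      exact pow_ne_zero _ (X_sub_C_ne_zero z)
    refine mul_left_cancel₀ hne ?_
    rw [← coe_mul, ← hder, hD, hG, mul_left_comm, ← coe_mul]
    congr 2
    ring
  have heval := congrArg (fun A => ∑' n, PowerSeries.coeff n A * z ^ n) hcancel
  simp only [PowerSeries.tsum_coeff_mul hz (summable_norm_coeff_mul_pow _ z),
    tsum_coeff_mul_pow] at heval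
  simp only [eval_mul, eval_add, eval_sub, eval_X, eval_C, sub_self, zero_mul, mul_zero,
    add_zero] at heval
  refine hndvd (dvd_iff_isRoot.2 ?_)
  have h1 : (ν : ℂ) + 1 ≠ 0 := Nat.cast_add_one_ne_zero ν
  simpa [hz0, h1] using heval

theorem Polynomial.one_le_mul_norm_sq_of_eval_eq_zero {L : ℂ[X]} (h0 : L.coeff 0 = 1) {S : ℕ → ℂ}
    (hS : ∀ n : ℕ, n * L.coeff n = ∑ x ∈ antidiagonal n, S x.1 * L.coeff x.2)
    {A q : ℝ} (hq : 0 ≤ q) (hA : ∀ n, 0 < n → ‖S (2 * n)‖ ≤ A * q ^ n) {z : ℂ}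
    (hz : L.eval z = 0) : 1 ≤ q * ‖z‖ ^ 2 := by
  have hS0 : S 0 = 0 := by simpa [h0] using (hS 0).symm
  have hlog : ∀ (f : ℂ[X]) (T : ℕ → ℂ),
      (∀ n : ℕ, n * f.coeff n = ∑ x ∈ antidiagonal n, T x.1 * f.coeff x.2) →
      ((X * derivative f : ℂ[X]) : PowerSeries ℂ) = PowerSeries.mk T * f := by
    intro f T h
    ext n
    rw [coeff_coe, PowerSeries.coeff_mul]
    simp only [PowerSeries.coeff_mk, coeff_coe]
    rw [← h n]
    cases n with
    | zero => simp
    | succ n =>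
      rw [coeff_X_mul, coeff_derivative]
      push_cast
      ring
  set N := L.comp (-X)
  have hN : ∀ n, N.coeff n = (-1) ^ n * L.coeff n := fun n => by
    have : N = L.comp (C (-1) * X) := by simp [N]
    rw [this, comp_C_mul_X_coeff, mul_comm]
  have h1 := hlog L S hS
  have h2 := hlog N (fun n => (-1) ^ n * S n) fun n => by
    rw [hN, mul_left_comm, hS, Finset.mul_sum]
    refine Finset.sum_congr rfl fun x hx => ?_
    rw [hN, ← Finset.HasAntidiagonal.mem_antidiagonal.1 hx, pow_add]
    ring
  set D := PowerSeries.mk S + PowerSeries.mk fun n => (-1) ^ n * S n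
  have hM0 : L * N ≠ 0 := by
    intro h
    have := congrArg (fun f => coeff f 0) h
    simp [mul_coeff_zero, hN, h0] at this
  have hD : ((X * derivative (L * N) : ℂ[X]) : PowerSeries ℂ) =
      D * ((L * N : ℂ[X]) : PowerSeries ℂ) := by
    have : X * derivative (L * N) = X * derivative L * N + L * (X * derivative N) := by
      rw [derivative_mul]
      ring
    rw [this, coe_add, coe_mul, coe_mul L, h1, h2, coe_mul]
    ring
  by_contra! hlt
  have hz0 : z ≠ 0 := by
    rintro rfl
    rw [← coeff_zero_eq_eval_zero, h0] at hz
    exact one_ne_zero hz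
  refine eval_ne_zero_of_X_mul_derivative_eq hM0 hD hz0 ?_ (by rw [eval_mul, hz, zero_mul])
  have hρ : √q * ‖z‖ < 1 := by
    refine lt_of_pow_lt_pow_left₀ 2 zero_le_one ?_
    rwa [mul_pow, Real.sq_sqrt hq, one_pow]
  refine Summable.of_nonneg_of_le (fun n => norm_nonneg _) (fun n => ?_)
    ((summable_geometric_of_lt_one (by positivity) hρ).mul_left (2 * |A|))
  have hcoeff : PowerSeries.coeff n D = S n + (-1) ^ n * S n := by
    simp [D]
  rw [hcoeff]
  rcases Nat.even_or_odd n with hn | hn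
  · obtain ⟨m, rfl⟩ := hn.two_dvd
    rcases Nat.eq_zero_or_pos m with rfl | hm
    · simp [hS0]
    · rw [hn.neg_one_pow, one_mul, norm_mul, norm_pow, mul_pow, ← two_mul, norm_mul,
        Complex.norm_two, pow_mul √q, Real.sq_sqrt hq]
      have := (hA m hm).trans (mul_le_mul_of_nonneg_right (le_abs_self A) (pow_nonneg hq m))
      calc 2 * ‖S (2 * m)‖ * ‖z‖ ^ (2 * m) ≤ 2 * (|A| * q ^ m) * ‖z‖ ^ (2 * m) := by gcongr
        _ = _ := by ring
  · rw [hn.neg_one_pow, neg_one_mul, add_neg_cancel, zero_mul, norm_zero]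
    positivity

theorem Polynomial.norm_coeff_one_le {L : ℂ[X]} (h0 : L.coeff 0 = 1) {ρ : ℝ}
    (hρ : ∀ z, L.eval z = 0 → 1 ≤ ρ * ‖z‖) : ‖L.coeff 1‖ ≤ L.natDegree * ρ := by
  rcases Nat.eq_zero_or_pos L.natDegree with hd | hd
  · rw [coeff_eq_zero_of_natDegree_lt (by omega), hd]
    simp
  set R := L.reverse
  have htr : L.natTrailingDegree = 0 :=
      natTrailingDegree_eq_zero.2 (Or.inr (by rw [h0]; exact one_ne_zero))
  have hdeg : R.natDegree = L.natDegree := by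
    rw [reverse_natDegree, htr, Nat.sub_zero]
  have hmonic : R.Monic := by
    rw [Monic, reverse_leadingCoeff, trailingCoeff, htr, h0]
  have hnext : R.nextCoeff = L.coeff 1 := by
    rw [nextCoeff_of_natDegree_pos (by omega), hdeg, coeff_reverse, revAt_le (by omega)]
    congr 1
    omega
  have hroots : ∀ w ∈ R.roots, ‖w‖ ≤ ρ := by
    intro w hw
    have hw' := (mem_roots hmonic.ne_zero).1 hw
    have hw0 : w ≠ 0 := by
      rintro rfl
      rw [IsRoot.def, ← coeff_zero_eq_eval_zero, coeff_zero_reverse, leadingCoeff_eq_zero] at hw'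
      rw [hw'] at h0
      simp at h0
    have hev : L.eval w⁻¹ = 0 := by
      let := invertibleOfNonzero (inv_ne_zero hw0)
      have := (eval₂_reverse_eq_zero_iff (RingHom.id ℂ) w⁻¹ L)
      rw [invOf_eq_inv, inv_inv] at this
      exact this.1 hw'
    have := hρ _ hev
    rwa [norm_inv, ← div_eq_mul_inv, le_div_iff₀ (norm_pos_iff.2 hw0), one_mul] at this
  have hsplit := IsAlgClosed.splits R
  rw [← hnext, hsplit.nextCoeff_eq_neg_sum_roots_of_monic hmonic, norm_neg, ← hdeg,
    hsplit.natDegree_eq_card_roots, ← nsmul_eq_mul, ← Multiset.card_map norm]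
  refine (Multiset.le_sum_of_subadditive norm norm_zero.le norm_add_le _).trans
    (Multiset.sum_le_card_nsmul _ _ fun x hx => ?_)
  obtain ⟨w, hw, rfl⟩ := Multiset.mem_map.1 hx
  exact hroots w hw

theorem Polynomial.norm_coeff_one_add_one_le {L : ℂ[X]} (h0 : L.coeff 0 = 1) {ρ : ℝ}
    (hρ : ∀ z, L.eval z = 0 → 1 ≤ ρ * ‖z‖) (h1 : L.eval 1 = 0) :
    ‖L.coeff 1 + 1‖ ≤ (L.natDegree - 1) * ρ := by
  obtain ⟨L', hL'⟩ := dvd_iff_isRoot.2 h1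
  have hc0 : (-L').coeff 0 = 1 := by
    rw [hL', mul_coeff_zero] at h0
    simpa using h0
  have hne : L' ≠ 0 := by
    rintro rfl
    simp at hc0
  have hc1 : (-L').coeff 1 = L.coeff 1 + 1 := by
    have : (C 1 : ℂ[X]) = 1 := C_1
    rw [hL', sub_mul, coeff_sub, coeff_X_mul, this, one_mul, coeff_neg]
    rw [coeff_neg] at hc0
    linear_combination hc0
  have hdeg : (L.natDegree : ℝ) - 1 = (-L').natDegree := by
    rw [hL', natDegree_mul (X_sub_C_ne_zero 1) hne, natDegree_X_sub_C, natDegree_neg]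
    push_cast
    ring
  rw [← hc1, hdeg]
  refine norm_coeff_one_le hc0 fun z hz => hρ z ?_
  rw [hL', eval_mul]
  rw [eval_neg, neg_eq_zero] at hz
  rw [hz, mul_zero]

end LogarithmicDerivative

section CharacterSumBounds

open Polynomial
open Finset.HasAntidiagonal (antidiagonal)

variable {F : Type*} [Field F] [Fintype F]

theorem sum_monicPolynomials_zero (Λ : F[X] →* ℂ) : ∑ f ∈ monicPolynomials F 0, Λ f = 1 := by
  have : monicPolynomials F 0 = {1} := by
    ext f
    rw [mem_monicPolynomials, Finset.mem_singleton]
    refine ⟨fun h => h.1.natDegree_eq_zero.1 h.2, ?_⟩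
    rintro rfl
    exact ⟨monic_one, natDegree_one⟩
  rw [this, Finset.sum_singleton, map_one]

theorem sum_monicPolynomials_one (g : F[X] → ℂ) :
    ∑ f ∈ monicPolynomials F 1, g f = ∑ x : F, g (X + C x) := by
  symm
  refine Finset.sum_bij (fun x _ => X + C x) ?_ ?_ ?_ ?_
  · intro x _
    exact mem_monicPolynomials.2 ⟨monic_X_add_C x, natDegree_X_add_C x⟩
  · intro x _ y _ h
    exact C_injective (add_left_cancel h)
  · intro f hf
    obtain ⟨hm, hf⟩ := mem_monicPolynomials.1 hf
    exact ⟨f.coeff 0, Finset.mem_univ _, (hm.eq_X_add_C hf).symm⟩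
  · intro x _
    rfl

variable {ι : Type*} [Fintype ι]

/-- The `L`-function of a product of characters. -/
noncomputable def evalCharacterLFunction (χ : ι → MulChar F ℂ) (b : ι → F) : ℂ[X] :=
  ∑ n ∈ Finset.range (Fintype.card ι),
    C (∑ f ∈ monicPolynomials F n, evalCharacter χ b f) * X ^ n

theorem coeff_evalCharacterLFunction {χ : ι → MulChar F ℂ} {b : ι → F}
    (hb : Function.Injective b) (hχ : ∃ s, χ s ≠ 1) (n : ℕ) :
    (evalCharacterLFunction χ b).coeff n =
      ∑ f ∈ monicPolynomials F n, evalCharacter χ b f := by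
  rw [evalCharacterLFunction, finsetSum_coeff]
  simp only [coeff_C_mul_X_pow]
  rw [Finset.sum_ite_eq]
  split_ifs with h
  · rfl
  · exact (sum_monicPolynomials_evalCharacter_eq_zero hb hχ (by simpa using h)).symm

theorem coeff_one_evalCharacterLFunction {χ : ι → MulChar F ℂ} {b : ι → F}
    (hb : Function.Injective b) (hχ : ∃ s, χ s ≠ 1) :
    (evalCharacterLFunction χ b).coeff 1 = ∑ x : F, ∏ s, χ s (x + b s) := by
  rw [coeff_evalCharacterLFunction hb hχ, sum_monicPolynomials_one]
  simp [evalCharacter_apply, add_comm]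

theorem natDegree_evalCharacterLFunction_le (χ : ι → MulChar F ℂ) (b : ι → F) :
    (evalCharacterLFunction χ b).natDegree ≤ Fintype.card ι - 1 := by
  refine natDegree_sum_le_of_forall_le _ _ fun n hn => (natDegree_C_mul_X_pow_le _ _).trans ?_
  have := Finset.mem_range.1 hn
  omega

theorem one_le_sqrt_mul_norm_of_eval_evalCharacterLFunction_eq_zero {χ : ι → MulChar F ℂ}
    {b : ι → F} (hb : Function.Injective b) (hχ : ∃ s, χ s ≠ 1) (z : ℂ)
    (hz : (evalCharacterLFunction χ b).eval z = 0) : 1 ≤ √(Fintype.card F) * ‖z‖ := by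
  obtain ⟨A, hA⟩ := exists_norm_primePowerSum_le hχ hb
  have h := one_le_mul_norm_sq_of_eval_eq_zero (L := evalCharacterLFunction χ b)
    (by rw [coeff_evalCharacterLFunction hb hχ, sum_monicPolynomials_zero])
    (S := primePowerSum (evalCharacter χ b))
    (fun n => by
      simp only [coeff_evalCharacterLFunction hb hχ]
      exact mul_sum_monicPolynomials _ n)
    (Nat.cast_nonneg (Fintype.card F)) hA hz
  rw [← one_le_sq_iff₀ (by positivity), mul_pow, Real.sq_sqrt (Nat.cast_nonneg _)]
  exact h

theorem norm_sum_prod_mulChar_add_le {χ : ι → MulChar F ℂ} {b : ι → F}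
    (hb : Function.Injective b) (hχ : ∃ s, χ s ≠ 1) :
    ‖∑ x : F, ∏ s, χ s (x + b s)‖ ≤ ((Fintype.card ι : ℝ) - 1) * √(Fintype.card F) := by
  have hcard : 1 ≤ Fintype.card ι := Fintype.card_pos_iff.2 ⟨hχ.choose⟩
  rw [← coeff_one_evalCharacterLFunction hb hχ]
  refine (norm_coeff_one_le (by rw [coeff_evalCharacterLFunction hb hχ, sum_monicPolynomials_zero])
    (one_le_sqrt_mul_norm_of_eval_evalCharacterLFunction_eq_zero hb hχ)).trans ?_
  gcongr
  rw [← Nat.cast_one, ← Nat.cast_sub hcard]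
  exact_mod_cast natDegree_evalCharacterLFunction_le χ b

theorem norm_sum_prod_mulChar_add_add_one_le {χ : ι → MulChar F ℂ} {b : ι → F}
    (hb : Function.Injective b) (hχ : ∃ s, χ s ≠ 1) (hprod : ∏ s, χ s = 1) :
    ‖∑ x : F, ∏ s, χ s (x + b s) + 1‖ ≤ ((Fintype.card ι : ℝ) - 2) * √(Fintype.card F) := by
  have hcard : 1 ≤ Fintype.card ι := Fintype.card_pos_iff.2 ⟨hχ.choose⟩
  have h1 : (evalCharacterLFunction χ b).eval 1 = 0 := by
    rw [evalCharacterLFunction, eval_finsetSum]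
    simp only [eval_mul, eval_C, eval_pow, eval_X, one_pow, mul_one]
    exact sum_range_sum_monicPolynomials_eq_zero hb hχ hprod
  rw [← coeff_one_evalCharacterLFunction hb hχ]
  refine (norm_coeff_one_add_one_le
    (by rw [coeff_evalCharacterLFunction hb hχ, sum_monicPolynomials_zero])
    (one_le_sqrt_mul_norm_of_eval_evalCharacterLFunction_eq_zero hb hχ) h1).trans ?_
  refine mul_le_mul_of_nonneg_right ?_ (Real.sqrt_nonneg _)
  have h2 := natDegree_evalCharacterLFunction_le χ b
  have h3 : ((evalCharacterLFunction χ b).natDegree : ℝ) ≤ (Fintype.card ι : ℝ) - 1 := by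
    rw [← Nat.cast_one, ← Nat.cast_sub hcard]
    exact_mod_cast h2
  linarith

end CharacterSumBounds

section TorsionCharacters

variable (F : Type*) [Field F] [Fintype F] (d : ℕ)

/-- The multiplicative characters of order dividing `d`. -/
noncomputable abbrev torsionMulChar : Subgroup (MulChar F ℂ) :=
  (powMonoidHom d : MulChar F ℂ →* MulChar F ℂ).ker

variable {F d}

theorem card_torsionMulChar (hd : d ∣ Fintype.card F - 1) :
    Nat.card (torsionMulChar F d) = d := by
  obtain ⟨e⟩ := MulChar.mulEquiv_units F ℂ
  have : IsCyclic (MulChar F ℂ) := isCyclic_of_surjective e.symm e.symm.surjective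
  rw [IsCyclic.card_powMonoidHom_ker, Nat.card_congr e.toEquiv, Nat.card_units, Nat.gcd_comm,
    Nat.card_eq_fintype_card]
  exact Nat.gcd_eq_left hd

theorem exists_mem_torsionMulChar_apply_ne_one {y : F} (hy : y ≠ 0) (h : ¬∃ z, z ^ d = y) :
    ∃ χ ∈ torsionMulChar F d, χ y ≠ 1 := by
  by_contra! hχ
  set e := MulChar.subgroupOrderIsoSubgroupMulChar F ℂ
  set H : Subgroup Fˣ := (powMonoidHom d : Fˣ →* Fˣ).range
  have hmem : Units.mk0 y hy ∈ H := by
    rw [← e.symm_apply_apply H, ← OrderDual.toDual_ofDual (e H),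
      MulChar.mem_subgroupOrderIsoSubgroupMulChar_symm_iff]
    intro χ hmem
    refine hχ χ ?_
    rw [MonoidHom.mem_ker]
    ext u
    rw [powMonoidHom_apply, MulChar.pow_apply_coe, MulChar.one_apply_coe, ← map_pow,
      ← Units.val_pow_eq_pow_val]
    exact MulChar.mem_subgroupOrderIsoSubgroupMulChar_iff.1 hmem _ ⟨u, rfl⟩
  obtain ⟨z, hz⟩ := hmem
  refine h ⟨z, ?_⟩
  simpa using congrArg Units.val hz

open Classical in
/-- A multiplicative character, with the trivial character taking the value `1` at `0`. -/
noncomputable def extendedMulChar (χ : MulChar F ℂ) (y : F) : ℂ := if χ = 1 then 1 else χ y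

open Classical in
/-- The number of nonzero `d`-th roots, with the value `1` at zero. -/
noncomputable def powerMultiplicity (d : ℕ) (y : F) : ℕ :=
  if y = 0 then 1 else if ∃ z, z ^ d = y then d else 0

theorem extendedMulChar_of_ne_zero (χ : MulChar F ℂ) {y : F} (hy : y ≠ 0) :
    extendedMulChar χ y = χ y := by
  rw [extendedMulChar]
  split_ifs with h
  · rw [h, MulChar.one_apply hy.isUnit]
  · rfl

theorem sum_extendedMulChar (hd : d ∣ Fintype.card F - 1) [Fintype (torsionMulChar F d)] (y : F) :
    ∑ χ : torsionMulChar F d, extendedMulChar χ.1 y = powerMultiplicity d y := by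
  classical
  rw [powerMultiplicity]
  split_ifs with hy h
  · rw [hy, Finset.sum_eq_single 1]
    · simp [extendedMulChar]
    · intro χ _ hχ
      rw [extendedMulChar, if_neg (by simpa using hχ), MulChar.map_zero]
    · simp
  · obtain ⟨z, rfl⟩ := h
    have hone (χ : torsionMulChar F d) : extendedMulChar χ.1 (z ^ d) = 1 := by
      rw [extendedMulChar_of_ne_zero _ hy]
      have hu : IsUnit (z ^ d) := isUnit_iff_ne_zero.2 hy
      by_cases hd0 : d = 0
      · simp [hd0]
      have hz : z ≠ 0 := fun h0 => hy (by rw [h0, zero_pow hd0])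
      rw [map_pow, ← MulChar.pow_apply' _ hd0, show χ.1 ^ d = 1 from χ.2,
        MulChar.one_apply hz.isUnit]
    simp_rw [hone]
    rw [Finset.sum_const, Finset.card_univ, ← Nat.card_eq_fintype_card, card_torsionMulChar hd,
      nsmul_one]
  · obtain ⟨ψ, hψ, hψy⟩ := exists_mem_torsionMulChar_apply_ne_one hy h
    simp_rw [extendedMulChar_of_ne_zero _ hy]
    have hmul : ψ y * ∑ χ : torsionMulChar F d, χ.1 y = ∑ χ : torsionMulChar F d, χ.1 y := by
      rw [Finset.mul_sum]
      exact Fintype.sum_equiv (Equiv.mulLeft ⟨ψ, hψ⟩) _ _ fun χ => rfl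
    rw [Nat.cast_zero]
    by_contra hne
    exact hψy (mul_right_cancel₀ hne (by rw [hmul, one_mul]))

theorem card_mul_card_filter_eq_one {A B : Type*} [Group A] [Group B] [Fintype A] [Fintype B]
    [DecidableEq B] (φ : A →* B) (hφ : Function.Surjective φ) :
    Fintype.card B * (Finset.univ.filter fun a => φ a = 1).card = Fintype.card A := by
  have h := φ.ker.card_mul_index
  rw [Subgroup.index_ker, MonoidHom.range_eq_top.2 hφ, Subgroup.card_top, mul_comm] at h
  rw [← Nat.card_eq_fintype_card (α := A), ← h, Nat.card_eq_fintype_card,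
    ← Fintype.card_subtype, ← Nat.card_eq_fintype_card (α := {a // φ a = 1})]
  rfl

end TorsionCharacters

section ConsecutivePowers

variable {F : Type*} [Field F] [Fintype F] {d : ℕ} {ι : Type*} [Fintype ι]

open Classical in
theorem norm_sum_prod_extendedMulChar_le {b : ι → F} (hb : Function.Injective b)
    (χ : ι → MulChar F ℂ) :
    ‖∑ x : F, ∏ s, extendedMulChar (χ s) (x + b s) + (if ∏ s, χ s = 1 then 1 else 0)
        - (if χ = 1 then ((Fintype.card F : ℂ) + 1) else 0)‖ ≤
      ((∑ s, if χ s = 1 then (0 : ℝ) else 1) - 1 - (if ∏ s, χ s = 1 then 1 else 0)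
        + (if χ = 1 then 2 else 0)) * √(Fintype.card F) := by
  by_cases h1 : χ = 1
  · subst h1
    simp [extendedMulChar]
    norm_num
  have hχ : ∃ s : {s // χ s ≠ 1}, χ s ≠ 1 := by
    obtain ⟨s, hs⟩ := Function.ne_iff.1 h1
    exact ⟨⟨s, hs⟩, hs⟩
  have hb' : Function.Injective fun s : {s // χ s ≠ 1} => b s := hb.comp Subtype.val_injective
  have hcard : (∑ s, if χ s = 1 then (0 : ℝ) else 1) = Fintype.card {s // χ s ≠ 1} := by
    rw [Fintype.card_subtype, Finset.card_filter, Nat.cast_sum]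
    exact Finset.sum_congr rfl fun s _ => by split_ifs <;> simp_all
  have hsum : ∑ x : F, ∏ s, extendedMulChar (χ s) (x + b s) =
      ∑ x : F, ∏ s : {s // χ s ≠ 1}, χ s (x + b s) := by
    refine Finset.sum_congr rfl fun x _ => ?_
    refine (Fintype.prod_of_injective _ Subtype.val_injective _ _ ?_ fun s => ?_).symm
    · intro s hs
      have : χ s = 1 := by simpa using hs
      rw [extendedMulChar, if_pos this]
    · rw [extendedMulChar, if_neg s.2]
  have hprod : ∏ s : {s // χ s ≠ 1}, χ s = ∏ s, χ s := by
    refine Fintype.prod_of_injective _ Subtype.val_injective _ _ ?_ fun s => rfl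
    intro s hs
    simpa using hs
  rw [hcard, hsum, if_neg h1, if_neg h1, sub_zero, add_zero]
  split_ifs with h
  · refine (norm_sum_prod_mulChar_add_add_one_le hb' hχ (hprod.trans h)).trans_eq ?_
    ring
  · rw [add_zero, sub_zero]
    exact norm_sum_prod_mulChar_add_le hb' hχ

theorem sum_prod_powerMultiplicity (hd : d ∣ Fintype.card F - 1)
    [Fintype (torsionMulChar F d)] [DecidableEq ι] (b : ι → F) :
    ((∑ x : F, ∏ s, powerMultiplicity d (x + b s) : ℕ) : ℂ) =
      ∑ χ : ι → torsionMulChar F d, ∑ x : F, ∏ s, extendedMulChar (χ s).1 (x + b s) := by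
  push_cast
  rw [Finset.sum_comm]
  refine Finset.sum_congr rfl fun x _ => ?_
  simp_rw [← sum_extendedMulChar hd]
  rw [Finset.prod_univ_sum, Fintype.piFinset_univ]

theorem card_mul_card_filter_prod_eq_one {G : Type*} [CommGroup G] [Fintype G] [DecidableEq G]
    [DecidableEq ι] [Nonempty ι] :
    Fintype.card G * (Finset.univ.filter fun χ : ι → G => ∏ s, χ s = 1).card =
      Fintype.card G ^ Fintype.card ι := by
  obtain ⟨i⟩ := ‹Nonempty ι›
  let φ : (ι → G) →* G :=
    { toFun := fun χ => ∏ s, χ s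
      map_one' := by simp
      map_mul' := fun χ ψ => Finset.prod_mul_distrib }
  rw [← Fintype.card_fun]
  exact card_mul_card_filter_eq_one φ fun g => ⟨Pi.mulSingle i g, Fintype.prod_pi_mulSingle' i g⟩

theorem card_mul_card_filter_apply_eq_one {G : Type*} [CommGroup G] [Fintype G] [DecidableEq G]
    [DecidableEq ι] (i : ι) :
    Fintype.card G * (Finset.univ.filter fun χ : ι → G => χ i = 1).card =
      Fintype.card G ^ Fintype.card ι := by
  rw [← Fintype.card_fun]
  exact card_mul_card_filter_eq_one (Pi.evalMonoidHom (fun _ => G) i)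
    fun g => ⟨fun _ => g, rfl⟩

theorem abs_sum_prod_powerMultiplicity_le (hd : d ∣ Fintype.card F - 1) (hd0 : d ≠ 0)
    [Nonempty ι] {b : ι → F} (hb : Function.Injective b) :
    |((∑ x : F, ∏ s, powerMultiplicity d (x + b s) : ℕ) : ℝ)
        + (d : ℝ) ^ Fintype.card ι / d - (Fintype.card F + 1)| ≤
      (Fintype.card ι * ((d : ℝ) ^ Fintype.card ι - (d : ℝ) ^ Fintype.card ι / d)
        - (d : ℝ) ^ Fintype.card ι - (d : ℝ) ^ Fintype.card ι / d + 2) * √(Fintype.card F) := by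
  classical
  let : Fintype (torsionMulChar F d) := Fintype.ofFinite _
  have hG : Fintype.card (torsionMulChar F d) = d := by
    rw [← Nat.card_eq_fintype_card, card_torsionMulChar hd]
  have hd' : (d : ℝ) ≠ 0 := Nat.cast_ne_zero.2 hd0
  have hn : ∑ χ : ι → torsionMulChar F d, (if ∏ s, (χ s).1 = 1 then (1 : ℝ) else 0) =
      (d : ℝ) ^ Fintype.card ι / d := by
    rw [eq_div_iff hd', Finset.sum_boole, mul_comm]
    have := card_mul_card_filter_prod_eq_one (G := torsionMulChar F d) (ι := ι)
    rw [hG] at this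
    simp only [Subtype.ext_iff, Subgroup.val_finsetProd, Subgroup.coe_one] at this
    exact_mod_cast this
  have hone {R : Type} [AddCommMonoid R] (c : R) :
      ∑ χ : ι → torsionMulChar F d, (if (fun s => (χ s).1) = 1 then c else 0) = c := by
    rw [Finset.sum_eq_single 1]
    · exact if_pos rfl
    · intro χ _ hχ
      exact if_neg fun h => hχ (funext fun s => Subtype.ext (congrFun h s))
    · simp
  have hm : ∑ χ : ι → torsionMulChar F d, ∑ s, (if (χ s).1 = 1 then (0 : ℝ) else 1) =
      Fintype.card ι * ((d : ℝ) ^ Fintype.card ι - (d : ℝ) ^ Fintype.card ι / d) := by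
    rw [Finset.sum_comm, ← nsmul_eq_mul, ← Finset.card_univ, ← Finset.sum_const]
    refine Finset.sum_congr rfl fun s _ => ?_
    have h1 := card_mul_card_filter_apply_eq_one (G := torsionMulChar F d) s
    rw [hG] at h1
    have h2 : ∀ χ : ι → torsionMulChar F d, (if (χ s).1 = 1 then (0 : ℝ) else 1) =
        1 - if χ s = 1 then (1 : ℝ) else 0 := by
      intro χ
      simp only [Subtype.ext_iff, Subgroup.coe_one]
      split_ifs <;> simp
    simp_rw [h2]
    rw [Finset.sum_sub_distrib, Finset.sum_boole, Finset.sum_const, Finset.card_univ,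
      Fintype.card_fun, hG, nsmul_one]
    congr 1
    · push_cast; rfl
    · rw [eq_div_iff hd', mul_comm]
      exact_mod_cast h1
  have key := (norm_sum_le Finset.univ _).trans (Finset.sum_le_sum fun χ _ =>
    norm_sum_prod_extendedMulChar_le hb fun s => ((χ : ι → torsionMulChar F d) s).1)
  rw [← Finset.sum_mul, Finset.sum_add_distrib, Finset.sum_sub_distrib, Finset.sum_sub_distrib,
    Finset.sum_sub_distrib, Finset.sum_add_distrib,
    ← sum_prod_powerMultiplicity hd] at key
  have hn' : ∑ χ : ι → torsionMulChar F d, (if ∏ s, (χ s).1 = 1 then (1 : ℂ) else 0) =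
      (((d : ℝ) ^ Fintype.card ι / d : ℝ) : ℂ) := by
    rw [← hn, Complex.ofReal_sum]
    exact Finset.sum_congr rfl fun χ _ => by split_ifs <;> simp
  rw [hm, hn, hn', hone, hone, Finset.sum_const, Finset.card_univ, Fintype.card_fun, hG,
    nsmul_one, Nat.cast_pow] at key
  rw [← Real.norm_eq_abs, ← Complex.norm_real]
  push_cast at key ⊢
  exact key

theorem powerMultiplicity_le (hd0 : d ≠ 0) (y : F) : powerMultiplicity d y ≤ d := by
  rw [powerMultiplicity]
  split_ifs <;> omega

open Classical in
theorem pow_mul_card_le_sum_prod_powerMultiplicity (b : ι → F) :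
    d ^ Fintype.card ι * (Finset.univ.filter fun x =>
        ∀ s, x + b s ≠ 0 ∧ ∃ y, y ^ d = x + b s).card ≤
      ∑ x : F, ∏ s, powerMultiplicity d (x + b s) := by
  rw [Finset.card_filter, Finset.mul_sum]
  refine Finset.sum_le_sum fun x _ => ?_
  split_ifs with h
  · rw [mul_one, Finset.prod_congr rfl fun s _ => ?_, Finset.prod_const, Finset.card_univ]
    rw [powerMultiplicity, if_neg (h s).1, if_pos (h s).2]
  · simp

open Classical in
theorem mul_sum_prod_powerMultiplicity_le (hd0 : d ≠ 0) (b : ι → F) :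
    d * ∑ x : F, ∏ s, powerMultiplicity d (x + b s) ≤
      d * (d ^ Fintype.card ι * (Finset.univ.filter fun x =>
        ∀ s, x + b s ≠ 0 ∧ ∃ y, y ^ d = x + b s).card) + d ^ Fintype.card ι * Fintype.card ι := by
  have hzero : Fintype.card ι = ∑ x : F, ∑ s, if x = -b s then 1 else 0 := by
    rw [Finset.sum_comm]
    simp
  nth_rewrite 3 [hzero]
  rw [Finset.card_filter, Finset.mul_sum, Finset.mul_sum, Finset.mul_sum, Finset.mul_sum,
    ← Finset.sum_add_distrib]
  refine Finset.sum_le_sum fun x _ => ?_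
  by_cases h : ∃ s, x + b s = 0
  · obtain ⟨s, hs⟩ := h
    have h1 : 1 ≤ ∑ s, if x = -b s then 1 else 0 := by
      refine le_trans ?_ (Finset.single_le_sum (fun _ _ => Nat.zero_le _) (Finset.mem_univ s))
      rw [if_pos (eq_neg_of_add_eq_zero_left hs)]
    have h2 : d * ∏ s, powerMultiplicity d (x + b s) ≤ d ^ Fintype.card ι := by
      have h3 : powerMultiplicity d (x + b s) = 1 := by rw [powerMultiplicity, if_pos hs]
      rw [← Finset.mul_prod_erase _ _ (Finset.mem_univ s), h3, one_mul]
      refine (Nat.mul_le_mul_left d (Finset.prod_le_pow_card _ _ d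
        fun s _ => powerMultiplicity_le hd0 _)).trans_eq ?_
      rw [← pow_succ', Finset.card_erase_add_one (Finset.mem_univ s), Finset.card_univ]
    exact le_add_left (h2.trans (Nat.le_mul_of_pos_right _ h1))
  · push Not at h
    refine le_add_right (Nat.mul_le_mul_left d ?_)
    split_ifs with hx
    · rw [mul_one]
      exact Finset.prod_le_pow_card _ _ d fun s _ => powerMultiplicity_le hd0 _
    · push Not at hx
      obtain ⟨s, hs⟩ := hx
      rw [Finset.prod_eq_zero (Finset.mem_univ s)]
      · simp
      · rw [powerMultiplicity, if_neg (h s), if_neg]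
        rintro ⟨y, hy⟩
        exact hs (h s) y hy

end ConsecutivePowers

theorem injective_natCast_fin {F : Type*} [Field F] {p : ℕ} [CharP F p] {r : ℕ} (hrp : r ≤ p) :
    Function.Injective fun j : Fin r => ((j : ℕ) : F) := fun i j h =>
  Fin.ext (CharP.natCast_injOn_Iio F p (Set.mem_Iio.2 (i.2.trans_le hrp))
    (Set.mem_Iio.2 (j.2.trans_le hrp)) h)

theorem consecutive_powers_bound' (p q : ℕ) (hp : p.Prime) (k : ℕ) (hk : 0 < k) (hq : q = p ^ k)
    (F : Type*) [Field F] [Fintype F] [CharP F p] (hcard : Fintype.card F = q)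
    (d : ℕ) (hd : d ∣ q - 1) (r : ℕ) (hr : 0 < r) (hrp : r ≤ p)
    (M : ℕ)
    (hM : M = Nat.card {ξ : F // ∀ j : Fin r, ξ + (j : ℕ) ≠ 0 ∧ ∃ y : F, y ^ d = ξ + (j : ℕ)}) :
    |(M : ℝ) + ((r : ℝ) + 1) / (2 * d) - ((q : ℝ) + 1) / (d : ℝ) ^ r| ≤
      ((r : ℝ) - 1 - ((r : ℝ) + 1) / d + 2 / (d : ℝ) ^ r) * Real.sqrt q
        + ((r : ℝ) + 1) / (2 * d) := by
  classical
  subst hcard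
  have hd0 : d ≠ 0 := by
    rintro rfl
    have := Fintype.one_lt_card (α := F)
    have := Nat.zero_dvd.1 hd
    omega
  have : Nonempty (Fin r) := ⟨⟨0, hr⟩⟩
  have hb := injective_natCast_fin (F := F) hrp
  have habs := abs_sum_prod_powerMultiplicity_le hd hd0 hb
  rw [Nat.card_eq_fintype_card, Fintype.card_subtype] at hM
  have hlow : d ^ r * M ≤ ∑ x : F, ∏ j : Fin r, powerMultiplicity d (x + ((j : ℕ) : F)) := by
    rw [hM]
    convert pow_mul_card_le_sum_prod_powerMultiplicity (d := d) fun j : Fin r => ((j : ℕ) : F)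
    rw [Fintype.card_fin]
  have hupp : d * ∑ x : F, ∏ j : Fin r, powerMultiplicity d (x + ((j : ℕ) : F)) ≤
      d * (d ^ r * M) + d ^ r * r := by
    rw [hM]
    convert mul_sum_prod_powerMultiplicity_le hd0 fun j : Fin r => ((j : ℕ) : F) <;>
      rw [Fintype.card_fin]
  rw [Fintype.card_fin] at habs
  generalize ∑ x : F, ∏ j : Fin r, powerMultiplicity d (x + ((j : ℕ) : F)) = T at *
  have hdpos : (0 : ℝ) < d := Nat.cast_pos.2 (Nat.pos_of_ne_zero hd0)
  have hD : (0 : ℝ) < (d : ℝ) ^ r := pow_pos hdpos r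
  have hlow' : (M : ℝ) ≤ T / (d : ℝ) ^ r := by
    rw [le_div_iff₀ hD, mul_comm]
    exact_mod_cast hlow
  have hupp' : (T : ℝ) / (d : ℝ) ^ r ≤ M + r / d := by
    have h : (d : ℝ) * T ≤ d * (d ^ r * M) + d ^ r * r := by exact_mod_cast hupp
    rw [div_le_iff₀ hD, ← mul_le_mul_iff_right₀ hdpos]
    refine h.trans_eq ?_
    field_simp
  have habs' : |T / (d : ℝ) ^ r + 1 / d - (Fintype.card F + 1) / (d : ℝ) ^ r| ≤
      ((r : ℝ) - 1 - ((r : ℝ) + 1) / d + 2 / (d : ℝ) ^ r) * √(Fintype.card F) := by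
    have h1 : T / (d : ℝ) ^ r + 1 / d - (Fintype.card F + 1) / (d : ℝ) ^ r =
        (T + (d : ℝ) ^ r / d - (Fintype.card F + 1)) / (d : ℝ) ^ r := by
      field_simp
    rw [h1, abs_div, abs_of_pos hD, div_le_iff₀ hD]
    refine habs.trans_eq ?_
    field_simp
    ring
  have h2 : ((r : ℝ) + 1) / (2 * d) + (r + 1) / (2 * d) = r / d + 1 / d := by
    field_simp
    ring
  have h3 : (0 : ℝ) ≤ 1 / d := by positivity
  rw [abs_le] at habs' ⊢
  constructor <;> linarith
end

section
/- Let p be a prime, q a power of p, and d a divisor of q-1 with d coprime to p. If q - ((pd - p - d - 1)·d^(p-1) + 2)·√q - (p+1)·d^(p-1) + 1 > 0, then there exists ξ in F_q such that (ξ + λ)^((q-1)/d) = 1 for all λ in the prime field F_p. -/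
section

open Polynomial

theorem resultant_C_mul_X_pow_sub_C_ne_zero {K : Type*} [Field K] {f : K[X]} {d : ℕ}
    (hf0 : f ≠ 0)
    (hf : ∀ e, (∀ a, d ∣ e * f.rootMultiplicity a) → d ∣ e) {κ : K} (hκ : κ ≠ 0)
    {P : K[X][X]} (hP : P ≠ 0) (hPd : P.natDegree < d) :
    P.resultant (C f * X ^ d - C (C κ)) P.natDegree d ≠ 0 := by
  intro hres
  have hd : 0 < d := by omega
  set L := FractionRing K[X]
  set φ := algebraMap K[X] L
  have hφ : Function.Injective φ := IsFractionRing.injective K[X] L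
  have hφf : φ f ≠ 0 := by simpa using (map_ne_zero_iff φ hφ).2 hf0
  set P' := P.map φ
  set E' : L[X] := C (φ f) * X ^ d - C (φ (C κ)) with hE'
  have hE : (C f * X ^ d - C (C κ)).map φ = E' := by simp [hE', Polynomial.map_sub]
  have hEdeg : E'.natDegree = d := by
    rw [hE', natDegree_sub_C, natDegree_C_mul_X_pow _ _ hφf]
  have hPdeg : P'.natDegree = P.natDegree := natDegree_map_eq_of_injective hφ P
  have hP' : P' ≠ 0 := (Polynomial.map_ne_zero_iff hφ).2 hP
  have h0 : P'.resultant E' = 0 := by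
    rw [hPdeg, hEdeg, ← hE, resultant_map_map, hres, map_zero]
  have hnc := (resultant_eq_zero_iff.1 h0).2
  obtain ⟨G, hG, hGP, hGE⟩ : ∃ G : L[X], ¬ IsUnit G ∧ G ∣ P' ∧ G ∣ E' := by
    by_contra! hcon
    exact hnc (isRelPrime_iff_isCoprime.1 fun G h1 h2 => by
      by_contra h3; exact hcon G h3 h1 h2)
  have hG0 : G ≠ 0 := fun h => hP' (by rw [h] at hGP; exact zero_dvd_iff.1 hGP)
  set e := G.natDegree with he
  have he0 : 0 < e := by
    rcases Nat.eq_zero_or_pos e with h | h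
    · exact absurd (isUnit_iff_degree_eq_zero.2 (by rw [degree_eq_natDegree hG0, ← he, h]; rfl)) hG
    · exact h
  have hed : e < d := lt_of_le_of_lt (natDegree_le_of_dvd hGP hP') (by omega)
  set Ω := AlgebraicClosure L
  set ι := algebraMap L Ω
  have hs : (G.map ι).Splits := IsAlgClosed.splits _
  have hroot : ∀ ρ ∈ (G.map ι).roots, ρ ^ d = ι (φ (C κ) / φ f) := by
    intro ρ hρ
    have h1 : (E'.map ι).eval ρ = 0 := by
      have := (mem_roots'.1 hρ).2
      exact IsRoot.dvd this (Polynomial.map_dvd ι hGE)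
    simp only [hE', Polynomial.map_sub, Polynomial.map_mul, Polynomial.map_pow, map_C, map_X,
      eval_sub, eval_mul, eval_pow, eval_C, eval_X] at h1
    rw [map_div₀, eq_div_iff (by simpa using hφf)]
    linear_combination h1
  have hprod : ((G.map ι).roots.prod) ^ d = ι (φ (C κ) / φ f) ^ e := by
    have h1 := map_multiset_prod (powMonoidHom d) (G.map ι).roots
    simp only [powMonoidHom_apply] at h1
    rw [h1, Multiset.map_congr rfl hroot, Multiset.map_const',
      Multiset.prod_replicate, ← hs.natDegree_eq_card_roots, natDegree_map]
  set b := G.coeff 0 / G.leadingCoeff with hb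
  have hlc : G.leadingCoeff ≠ 0 := leadingCoeff_ne_zero.2 hG0
  have hbι : ι b = (-1) ^ e * (G.map ι).roots.prod := by
    have := hs.coeff_zero_eq_leadingCoeff_mul_prod_roots
    rw [coeff_map, leadingCoeff_map, natDegree_map] at this
    rw [hb, map_div₀, div_eq_iff (by simpa using hlc), this]
    ring
  have hbd : b ^ d * φ f ^ e = ((-1) ^ e) ^ d * φ (C κ) ^ e := by
    have hfe : φ f ^ e ≠ 0 := pow_ne_zero _ hφf
    have : b ^ d = ((-1) ^ e) ^ d * (φ (C κ) / φ f) ^ e := by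
      apply ι.injective
      rw [map_pow, hbι, mul_pow, hprod]
      simp
    rw [this, div_pow, mul_assoc, div_mul_cancel₀ _ hfe]
  obtain ⟨u, v, hv, huv⟩ := IsFractionRing.div_surjective (A := K[X]) b
  have hv0 : v ≠ 0 := nonZeroDivisors.ne_zero hv
  have hmain : u ^ d * f ^ e = C (((-1) ^ e) ^ d * κ ^ e) * v ^ d := by
    apply hφ
    have hvφ : φ v ≠ 0 := (map_ne_zero_iff φ hφ).2 hv0
    rw [← huv, div_pow, div_mul_eq_mul_div, div_eq_iff (pow_ne_zero _ hvφ)] at hbd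
    simp only [map_mul, map_pow, map_neg, map_one]
    rw [hbd]
  have hc0 : ((-1) ^ e) ^ d * κ ^ e ≠ 0 := by simp [hκ]
  have hu0 : u ≠ 0 := by
    rintro rfl
    rw [zero_pow hd.ne', zero_mul] at hmain
    exact mul_ne_zero (C_ne_zero.2 hc0) (pow_ne_zero _ hv0) hmain.symm
  classical
  have : d ∣ e := hf e fun a => by
    have h2 := congrArg (rootMultiplicity a) hmain
    rw [rootMultiplicity_mul (mul_ne_zero (pow_ne_zero _ hu0) (pow_ne_zero _ hf0)),
      rootMultiplicity_mul (mul_ne_zero (C_ne_zero.2 hc0) (pow_ne_zero _ hv0)),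
      rootMultiplicity_C] at h2
    simp only [← count_roots, roots_pow, Multiset.count_nsmul] at h2 ⊢
    rw [zero_add] at h2
    exact (Nat.dvd_add_right (dvd_mul_right d _)).1 (h2 ▸ dvd_mul_right d _)
  exact absurd (Nat.le_of_dvd he0 this) (by omega)

theorem natDegree_resultant_le {R : Type*} [CommRing R] (f g : R[X][X]) (m n N : ℕ)
    (hf : ∀ i, (f.coeff i).natDegree ≤ N) (hg : ∀ i, (g.coeff i).natDegree ≤ N) :
    (f.resultant g m n).natDegree ≤ (m + n) * N := by
  rw [resultant, Matrix.det_apply]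
  refine natDegree_sum_le_of_forall_le _ _ fun σ _ => ?_
  refine (natDegree_smul_le _ _).trans ((natDegree_prod_le _ _).trans ?_)
  refine (Finset.sum_le_card_nsmul _ _ N fun i _ => ?_).trans (by simp)
  rw [sylvester, Matrix.of_apply]
  induction i using Fin.addCases <;> simp only [Fin.addCases_left, Fin.addCases_right] <;>
    split_ifs <;> simp [hf, hg]

theorem eq_zero_of_sum_mul_X_pow_mul_pow_eq_zero {K : Type*} [Field K] [Infinite K] (p : ℕ)
    [Fact p.Prime] [CharP K p] {r s d A : ℕ} (hr : r = p ^ s) (hd : 0 < d) (hdr : d ∣ r - 1)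
    {f : K[X]} (hf0 : f ≠ 0)
    (hf : ∀ e, (∀ a, d ∣ e * f.rootMultiplicity a) → d ∣ e)
    (hA : 2 * d * (A + f.natDegree) < r) (J : ℕ) (u : ℕ → ℕ → K[X])
    (hu : ∀ i j, (u i j).natDegree ≤ A)
    (hsum : ∑ i ∈ Finset.range d, ∑ j ∈ Finset.range J,
      u i j * X ^ (j * r) * (f ^ ((r - 1) / d)) ^ i = 0) :
    ∀ i < d, ∀ j < J, u i j = 0 := by
  have hp : p.Prime := Fact.out
  have hr1 : 1 ≤ r := hr ▸ Nat.one_le_pow _ _ hp.pos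
  set g := f ^ ((r - 1) / d) with hg
  have key : ∀ c, f.eval c ≠ 0 → ∀ i < d, ∑ j ∈ Finset.range J, C ((c ^ r) ^ j) * u i j = 0 := by
    intro c hc i hi
    set v : ℕ → K[X] := fun i => ∑ j ∈ Finset.range J, C ((c ^ r) ^ j) * u i j with hv
    set P : K[X][X] := ∑ i ∈ Finset.range d, C (v i) * X ^ i with hPdef
    have hPc : ∀ k, P.coeff k = if k < d then v k else 0 := by
      intro k
      simp [hPdef, coeff_C_mul, coeff_X_pow]
    have hvdeg : ∀ i, (v i).natDegree ≤ A := fun i =>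
      natDegree_sum_le_of_forall_le _ _ fun j _ => (natDegree_C_mul_le _ _).trans (hu i j)
    suffices hP : P = 0 by
      have := hPc i
      rw [hP, if_pos hi] at this
      exact this.symm
    by_contra hP
    have hPd : P.natDegree < d := by
      rw [natDegree_lt_iff_degree_lt hP, degree_lt_iff_coeff_zero]
      intro k hk
      rw [hPc, if_neg (by exact_mod_cast not_lt.2 hk)]
    have hκ : f.eval c ^ r ≠ 0 := pow_ne_zero _ hc
    set E : K[X][X] := C f * X ^ d - C (C (f.eval c ^ r)) with hE
    have hne := resultant_C_mul_X_pow_sub_C_ne_zero hf0 hf hκ hP hPd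
    have hEdeg : E.natDegree ≤ d := by
      rw [hE, natDegree_sub_C]
      exact natDegree_C_mul_X_pow_le _ _
    obtain ⟨a, b, -, -, hab⟩ := exists_mul_add_mul_eq_C_resultant (m := P.natDegree) (n := d)
      P E le_rfl hEdeg (Or.inr hd.ne')
    have hdvdE : (X - C c) ^ r ∣ E.eval g := by
      have : E.eval g = (f - C (f.eval c)) ^ r := by
        have h1 : (f - C (f.eval c)) ^ r = f ^ r - C (f.eval c) ^ r := by
          rw [hr]; exact sub_pow_char_pow _ _ _
        rw [h1, hE, hg]
        simp only [eval_sub, eval_mul, eval_C, eval_pow, eval_X, map_pow]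
        rw [← pow_mul, Nat.div_mul_cancel hdr, ← pow_succ', Nat.sub_add_cancel hr1]
      rw [this]
      exact pow_dvd_pow_of_dvd (dvd_iff_isRoot.2 (by simp)) _
    have hdvdP : (X - C c) ^ r ∣ P.eval g := by
      have h1 : P.eval g = P.eval g - ∑ i ∈ Finset.range d, ∑ j ∈ Finset.range J,
          u i j * X ^ (j * r) * g ^ i := by rw [hsum, sub_zero]
      rw [h1]
      simp only [hPdef, hv, eval_finsetSum, eval_mul, eval_C, eval_pow, eval_X,
        Finset.sum_mul, ← Finset.sum_sub_distrib]
      refine Finset.dvd_sum fun i _ => Finset.dvd_sum fun j _ => ?_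
      have h2 : C ((c ^ r) ^ j) * u i j * g ^ i - u i j * X ^ (j * r) * g ^ i
          = ((C c ^ r) ^ j - (X ^ r) ^ j) * (u i j * g ^ i) := by
        rw [mul_comm j r, pow_mul, map_pow, map_pow]; ring
      rw [h2]
      refine Dvd.dvd.mul_right ?_ _
      have h3 : (X - C c) ^ r = X ^ r - C c ^ r := by
        rw [hr]; exact sub_pow_char_pow _ _ _
      rw [h3, ← dvd_neg, neg_sub]
      exact sub_dvd_pow_sub_pow _ _ _
    have hdvd : (X - C c) ^ r ∣ P.resultant E P.natDegree d := by
      have := congrArg (eval g) hab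
      rw [eval_add, eval_mul, eval_mul, eval_C] at this
      rw [← this]
      exact dvd_add (hdvdP.mul_right _) (hdvdE.mul_right _)
    have hle := natDegree_le_of_dvd hdvd hne
    rw [natDegree_pow, natDegree_X_sub_C, mul_one] at hle
    have hle2 := natDegree_resultant_le P E P.natDegree d (A + f.natDegree)
      (fun k => by
        rw [hPc]; split_ifs
        · exact (hvdeg k).trans (by omega)
        · simp)
      (fun k => by
        rw [hE, coeff_sub, coeff_C_mul_X_pow, coeff_C]
        split_ifs <;> first | omega | simp)
    have : (P.natDegree + d) * (A + f.natDegree) ≤ 2 * d * (A + f.natDegree) :=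
      Nat.mul_le_mul_right _ (by omega)
    omega
  intro i hi j hj
  ext k
  set W : K[X] := ∑ j ∈ Finset.range J, C ((u i j).coeff k) * X ^ j with hW
  have hW0 : W = 0 := by
    apply eq_zero_of_infinite_isRoot
    have hinf : {c : K | f.eval c ≠ 0}.Infinite := by
      have h1 : {c : K | f.eval c = 0}.Finite := by
        classical
        refine (f.roots.toFinset.finite_toSet).subset fun c hc => ?_
        simpa [hf0] using hc
      exact h1.infinite_compl
    have hinj : Function.Injective fun c : K => c ^ r := by
      intro x y hxy
      have h1 : (x - y) ^ r = 0 := by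
        rw [hr, sub_pow_char_pow, ← hr]; exact sub_eq_zero.2 hxy
      exact sub_eq_zero.1 (pow_eq_zero_iff (by omega) |>.1 h1)
    refine (hinf.image (hinj.injOn)).mono ?_
    rintro _ ⟨c, hc, rfl⟩
    have h1 := congrArg (fun q => coeff q k) (key c hc i hi)
    simp only [finsetSum_coeff, coeff_C_mul, coeff_zero] at h1
    simp only [hW, Set.mem_ofPred_eq, IsRoot.def, eval_finsetSum, eval_mul, eval_C, eval_pow,
      eval_X]
    rw [← h1]
    exact Finset.sum_congr rfl fun _ _ => mul_comm _ _
  have := congrArg (fun q => coeff q j) hW0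
  simpa [hW, finsetSum_coeff, coeff_C_mul, coeff_X_pow, hj] using this

theorem natCard_degreeLT {F : Type*} [Field F] (n : ℕ) :
    Nat.card (degreeLT F n) = Nat.card F ^ n := by
  rw [Nat.card_congr (degreeLTEquiv F n).toEquiv, Nat.card_fun, Nat.card_fin]

theorem card_le_of_pow_eq {F K : Type*} [Field F] [Finite F] [Field K] [Fintype K] [Algebra F K]
    (p : ℕ) [Fact p.Prime] [CharP F p] {r s d A J : ℕ} (hr : r = p ^ s)
    (hK : Fintype.card K = r ^ 2) (hd : 0 < d) (hdr : d ∣ r - 1) {f : F[X]} (hf0 : f ≠ 0)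
    (hf : ∀ e, (∀ a, d ∣ e * f.rootMultiplicity a) → d ∣ e)
    (hA : 2 * d * (A + f.natDegree) < r)
    (hAJ : r * A + J + r * f.natDegree < d * (A + 1) * J)
    {ζ : F} (hζ : ζ ≠ 0) (T : Finset K)
    (hT : ∀ x ∈ T, aeval x f ^ ((r ^ 2 - 1) / d) = algebraMap F K ζ) :
    T.card ≤ A + r * J + r * f.natDegree := by
  classical
  have hp : p.Prime := Fact.out
  have hr1 : 1 ≤ r := hr ▸ Nat.one_le_pow _ _ hp.pos
  have : CharP K p := charP_of_injective_algebraMap (algebraMap F K).injective p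
  set D := f.natDegree with hD
  set t := (r - 1) / d with ht
  have htd : t * d = r - 1 := Nat.div_mul_cancel hdr
  set g := f ^ t with hg
  have hgdeg : g.natDegree = t * D := natDegree_pow _ _
  have hgpow : ∀ i < d, (g ^ i).natDegree ≤ r * D := fun i hi => by
    rw [natDegree_pow, hgdeg, ← mul_assoc]
    refine Nat.mul_le_mul_right _ ?_
    calc i * t ≤ d * t := Nat.mul_le_mul_right _ hi.le
      _ ≤ r := by rw [mul_comm, htd]; omega
  set M := r * A + J + r * D with hM
  set Ψ : (ℕ → ℕ → F[X]) → F[X] := fun w => ∑ i ∈ Finset.range d, ∑ j ∈ Finset.range J,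
    w i j ^ r * X ^ j * C (ζ ^ i) * g ^ (d - 1 - i) with hΨ
  have hΨsub : ∀ w₁ w₂, Ψ (w₁ - w₂) = Ψ w₁ - Ψ w₂ := by
    intro w₁ w₂
    simp only [hΨ, ← Finset.sum_sub_distrib]
    refine Finset.sum_congr rfl fun i _ => Finset.sum_congr rfl fun j _ => ?_
    have : (w₁ i j - w₂ i j) ^ r = w₁ i j ^ r - w₂ i j ^ r := by
      rw [hr]; exact sub_pow_char_pow _ _ _
    rw [Pi.sub_apply, Pi.sub_apply, this]
    ring
  have hΨdeg : ∀ w : ℕ → ℕ → F[X], (∀ i j, (w i j).natDegree ≤ A) → Ψ w ∈ degreeLT F M := by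
    intro w hw
    refine Submodule.sum_mem _ fun i hi => Submodule.sum_mem _ fun j hj => ?_
    rw [Finset.mem_range] at hi hj
    rw [mem_degreeLT]
    refine lt_of_le_of_lt degree_le_natDegree (Nat.cast_lt.2 ?_)
    calc (w i j ^ r * X ^ j * C (ζ ^ i) * g ^ (d - 1 - i)).natDegree
        ≤ r * A + j + 0 + r * D := by
          refine natDegree_mul_le_of_le (natDegree_mul_le_of_le (natDegree_mul_le_of_le ?_ ?_) ?_)
            ?_
          · exact natDegree_pow_le.trans (Nat.mul_le_mul_left _ (hw i j))
          · simp
          · simp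
          · exact hgpow _ (by omega)
      _ < M := by omega
  let ext : (Fin d × Fin J → degreeLT F (A + 1)) → ℕ → ℕ → F[X] := fun U i j =>
    if h : i < d ∧ j < J then (U (⟨i, h.1⟩, ⟨j, h.2⟩)).1 else 0
  have hext : ∀ U i j, (ext U i j).natDegree ≤ A := by
    intro U i j
    simp only [ext]
    split_ifs with h
    · have : (U (⟨i, h.1⟩, ⟨j, h.2⟩)).1 ∈ degreeLE F A := by
        rw [← degreeLT_succ_eq_degreeLE]
        exact Subtype.property _
      exact natDegree_le_of_degree_le (mem_degreeLE.1 this)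
    · simp
  have : Finite (degreeLT F M) := Finite.of_equiv _ (degreeLTEquiv F M).toEquiv.symm
  obtain ⟨U₁, U₂, hU, hne⟩ : ∃ U₁ U₂, Ψ (ext U₁) = Ψ (ext U₂) ∧ U₁ ≠ U₂ := by
    by_contra! hcon
    have hinj : Function.Injective fun U => (⟨Ψ (ext U), hΨdeg _ (hext U)⟩ : degreeLT F M) :=
      fun U₁ U₂ h => hcon U₁ U₂ (congrArg Subtype.val h)
    have hle := Nat.card_le_card_of_injective _ hinj
    rw [Nat.card_fun, natCard_degreeLT, natCard_degreeLT, ← pow_mul, Nat.card_prod, Nat.card_fin,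
      Nat.card_fin] at hle
    have h1 : 1 < Nat.card F := Finite.one_lt_card
    have := (Nat.pow_le_pow_iff_right h1).1 hle
    have h2 : (A + 1) * (d * J) = d * (A + 1) * J := by ring
    omega
  set u := ext U₁ - ext U₂ with hu
  have hudeg : ∀ i j, (u i j).natDegree ≤ A := fun i j =>
    (natDegree_sub_le_of_le (hext U₁ i j) (hext U₂ i j)).trans (max_self A).le
  have hΨu : Ψ u = 0 := by rw [hu, hΨsub, hU, sub_self]
  set h := ∑ i ∈ Finset.range d, ∑ j ∈ Finset.range J, u i j * X ^ (j * r) * g ^ i with hh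
  have hh0 : h ≠ 0 := by
    intro hzero
    apply hne
    set Ω := AlgebraicClosure F
    set ι := algebraMap F Ω
    have : CharP Ω p := charP_of_injective_algebraMap ι.injective p
    have : Infinite Ω := IsAlgClosed.instInfinite
    have key := eq_zero_of_sum_mul_X_pow_mul_pow_eq_zero (K := Ω) p hr hd hdr (f := f.map ι)
      ((Polynomial.map_ne_zero_iff ι.injective).2 hf0)
      (fun e he => hf e fun a => by
        have := he (ι a)
        rwa [← eq_rootMultiplicity_map ι.injective] at this)
      (by rwa [natDegree_map]) J (fun i j => (u i j).map ι)
      (fun i j => natDegree_map_le.trans (hudeg i j))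
      (by
        have := congrArg (Polynomial.map ι) hzero
        simpa [hh, Polynomial.map_sum, hg] using this)
    funext ⟨i, j⟩
    have h1 := key i i.2 j j.2
    rw [Polynomial.map_eq_zero_iff ι.injective] at h1
    have h2 : ext U₁ i j - ext U₂ i j = 0 := h1
    simp only [ext, i.2, j.2, and_self, dif_pos] at h2
    exact Subtype.ext (sub_eq_zero.1 h2)
  have hhdeg : h.natDegree ≤ A + r * J + r * D := by
    refine natDegree_sum_le_of_forall_le _ _ fun i hi =>
      natDegree_sum_le_of_forall_le _ _ fun j hj => ?_
    rw [Finset.mem_range] at hi hj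
    refine natDegree_mul_le_of_le (natDegree_mul_le_of_le (hudeg i j) ?_) (hgpow i hi)
    rw [natDegree_X_pow, mul_comm]
    exact Nat.mul_le_mul_left _ hj.le
  have hroot : ∀ x ∈ T, aeval x h = 0 := by
    intro x hx
    have hxT := hT x hx
    have hx2 : x ^ (r * r) = x := by
      rw [← pow_two, ← hK]; exact FiniteField.pow_card x
    have hgζ : aeval x g ^ r * aeval x g = algebraMap F K ζ := by
      rw [← hxT, hg, map_pow, ← pow_succ, ← pow_mul]
      congr 1
      have : r ^ 2 - 1 = (t * (r + 1)) * d := by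
        rw [mul_right_comm, htd]
        have := Nat.sq_sub_sq r 1
        rw [one_pow] at this
        rw [this, mul_comm]
      rw [this, Nat.mul_div_cancel _ hd]
    have hg0 : aeval x g ≠ 0 := by
      intro h0
      rw [h0, mul_zero] at hgζ
      exact hζ ((map_eq_zero_iff _ (algebraMap F K).injective).1 hgζ.symm)
    have hpow : aeval x h ^ r * aeval x g ^ (d - 1) = aeval x (Ψ u) := by
      simp only [hh, hΨ, map_sum]
      rw [hr, sum_pow_char_pow, Finset.sum_mul]
      refine Finset.sum_congr rfl fun i hi => ?_
      rw [sum_pow_char_pow, Finset.sum_mul, ← hr]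
      refine Finset.sum_congr rfl fun j _ => ?_
      rw [Finset.mem_range] at hi
      have h1 : aeval x g ^ (d - 1) = aeval x g ^ i * aeval x g ^ (d - 1 - i) := by
        rw [← pow_add]; congr 1; omega
      simp only [map_mul, map_pow, aeval_X, aeval_C]
      rw [h1, ← hgζ]
      have h2 : (x ^ (j * r)) ^ r = x ^ j := by
        rw [← pow_mul, mul_assoc, mul_comm, pow_mul, hx2]
      rw [mul_pow, mul_pow, h2]
      ring
    rw [hΨu, map_zero] at hpow
    rcases mul_eq_zero.1 hpow with h1 | h1
    · exact pow_eq_zero_iff (by omega) |>.1 h1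
    · exact absurd h1 (pow_ne_zero _ hg0)
  have hmap0 : h.map (algebraMap F K) ≠ 0 :=
    (Polynomial.map_ne_zero_iff (algebraMap F K).injective).2 hh0
  calc T.card ≤ (h.map (algebraMap F K)).natDegree := by
        refine card_le_degree_of_subset_roots fun x hx => ?_
        rw [mem_roots hmap0, IsRoot.def, eval_map_algebraMap]
        exact hroot x hx
    _ ≤ _ := by rwa [natDegree_map]

/-- Stepanov's bound, up to the value of the constant. -/
theorem mul_card_le_of_pow_eq {F K : Type*} [Field F] [Finite F] [Field K] [Fintype K]
    [Algebra F K] (p : ℕ) [Fact p.Prime] [CharP F p] {r s d : ℕ} (hr : r = p ^ s)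
    (hK : Fintype.card K = r ^ 2) (hd : 0 < d) (hdr : d ∣ r - 1) {f : F[X]} (hf0 : f ≠ 0)
    (hf : ∀ e, (∀ a, d ∣ e * f.rootMultiplicity a) → d ∣ e)
    (hr₁ : 4 * d * f.natDegree < r) (hr₂ : 4 * f.natDegree + 8 ≤ r)
    {ζ : F} (hζ : ζ ≠ 0) (T : Finset K)
    (hT : ∀ x ∈ T, aeval x f ^ ((r ^ 2 - 1) / d) = algebraMap F K ζ) :
    d * T.card ≤ r ^ 2 + d * (5 * f.natDegree + 9) * r := by
  set D := f.natDegree with hD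
  set k := (r - 1) / (2 * d) with hk
  have hk1 : 2 * d * k ≤ r - 1 := Nat.mul_div_le _ _
  have hk2 : r - 1 < 2 * d * (k + 1) := Nat.lt_mul_div_succ _ (by omega)
  have hDk : D ≤ k := by
    rw [hk, Nat.le_div_iff_mul_le (by omega)]
    have : 4 * d * D = 2 * (D * (2 * d)) := by ring
    omega
  obtain ⟨A, hA⟩ := Nat.exists_eq_add_of_le' hDk
  obtain ⟨t, ht⟩ := hdr
  set c := 4 * D + 8 with hc
  have htr : t ≤ r - 1 := by rw [ht]; exact Nat.le_mul_of_pos_left _ hd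
  have hA1 : 2 * d * (A + D) < r := by rw [← hA]; omega
  have hrt : r = d * t + 1 := by omega
  have hA2 : r ≤ 4 * d * (A + 1) := by
    have h1 : 2 * d * (k + 1) = 2 * d * (A + 1) + 2 * d * D := by rw [hA]; ring
    have h2 : 4 * d * D = 2 * (2 * d * D) := by ring
    have h3 : 4 * d * (A + 1) = 2 * (2 * d * (A + 1)) := by ring
    omega
  have hmain := card_le_of_pow_eq p hr hK hd ⟨t, ht⟩ hf0 hf (A := A) (J := t + 1 + c) hA1 (by
      have h1 : d * (A + 1) * (t + 1 + c) = (A + 1) * (d * t + 1) + (A + 1) * (d - 1)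
          + d * (A + 1) * c := by
        obtain ⟨d, rfl⟩ : ∃ d', d = d' + 1 := ⟨d - 1, by omega⟩
        simp only [Nat.add_sub_cancel]; ring
      rw [h1, ← hrt, ← hD]
      have h2 : (D + 2) * r ≤ d * (A + 1) * c := by
        calc (D + 2) * r ≤ (D + 2) * (4 * d * (A + 1)) := Nat.mul_le_mul_left _ hA2
          _ = _ := by rw [hc]; ring
      have h3 : (A + 1) * r = r * A + r := by ring
      have h4 : (D + 2) * r = r * D + 2 * r := by ring
      omega) hζ T hT
  calc d * T.card ≤ d * (A + r * (t + 1 + c) + r * D) := Nat.mul_le_mul_left _ hmain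
    _ = d * A + r * (d * t) + r * (d * (1 + c + D)) := by ring
    _ ≤ r + r * (r - 1) + r * (d * (1 + c + D)) := by
      rw [← ht]
      have : 2 * d * (A + D) = d * A + (d * A + 2 * d * D) := by ring
      gcongr
      omega
    _ = r ^ 2 + d * (5 * D + 9) * r := by
      have : r + r * (r - 1) = r ^ 2 := by
        rw [add_comm, ← Nat.mul_succ, pow_two]; congr 1; omega
      rw [this, hc]; ring

theorem MulChar.apply_eq_one_of_pow_eq_one {F : Type*} [Field F] [Fintype F] {θ : MulChar F ℂ}
    {d : ℕ} (hd : d ∣ Fintype.card F - 1) (hθ : θ ^ d = 1) {b : Fˣ}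
    (hb : b ^ ((Fintype.card F - 1) / d) = 1) : θ b = 1 := by
  obtain ⟨g, hg⟩ := IsCyclic.exists_generator (α := Fˣ)
  obtain ⟨j, rfl⟩ := Subgroup.mem_zpowers_iff.1 (hg b) 
  have hord : orderOf g = Fintype.card F - 1 := by
    classical
    rw [orderOf_eq_card_of_forall_mem_zpowers hg, Nat.card_eq_fintype_card, Fintype.card_units]
  have hcard : 0 < Fintype.card F - 1 := by
    have := Fintype.one_lt_card (α := F); omega
  obtain ⟨m, hm⟩ := hd
  have hd0 : 0 < d := Nat.pos_of_ne_zero (by rintro rfl; omega)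
  have hm0 : m ≠ 0 := by rintro rfl; omega
  rw [hm, Nat.mul_div_cancel_left _ hd0, ← zpow_natCast, ← zpow_mul,
    ← orderOf_dvd_iff_zpow_eq_one, hord, hm] at hb
  push_cast at hb
  obtain ⟨i, rfl⟩ : (d : ℤ) ∣ j := Int.dvd_of_mul_dvd_mul_right (by exact_mod_cast hm0) hb
  have : (θ ^ d) (g ^ i : Fˣ) = 1 := by rw [hθ, MulChar.one_apply_coe]
  rw [mul_comm, zpow_mul, zpow_natCast, Units.val_pow_eq_pow_val, map_pow,
    ← MulChar.pow_apply_coe, this]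

theorem card_pow_eq_pow {F : Type*} [Field F] [Fintype F] [DecidableEq F] {n : ℕ}
    (hn : n ∣ Fintype.card F - 1) (u : Fˣ) :
    (Finset.univ.filter fun c : Fˣ => c ^ n = u ^ n).card = n := by
  have h1 : (Finset.univ.filter fun c : Fˣ => c ^ n = 1).card = n := by
    have := IsCyclic.card_powMonoidHom_ker (G := Fˣ) n
    rw [Nat.card_eq_fintype_card (α := Fˣ), Fintype.card_units, Nat.gcd_eq_right hn] at this
    rw [Nat.card_eq_fintype_card] at this
    refine Eq.trans ?_ this
    rw [← Fintype.card_subtype]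
    exact Fintype.card_congr (Equiv.subtypeEquivRight fun c => by simp [MonoidHom.mem_ker])
  refine Eq.trans ?_ h1
  refine Finset.card_equiv (Equiv.mulRight u⁻¹) fun c => ?_
  simp [mul_pow, mul_inv_eq_one]

theorem norm_sum_le_of_mul_card_le {F X : Type*} [Field F] [Fintype F] [DecidableEq F] [Fintype X]
    {θ : MulChar F ℂ} (hθ : θ ≠ 1) {d : ℕ} (hd : d ∣ Fintype.card F - 1) (hθd : θ ^ d = 1)
    (w : X → F) {B : ℝ}
    (hB : ∀ c : Fˣ, (d : ℝ) * (Finset.univ.filter fun x =>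
      w x ^ ((Fintype.card F - 1) / d) = c ^ ((Fintype.card F - 1) / d)).card ≤ B) :
    ‖∑ x, θ (w x)‖ ≤ B - Fintype.card X + (Finset.univ.filter fun x => w x = 0).card := by
  obtain ⟨n, hn⟩ := hd
  have hcard : 0 < Fintype.card F - 1 := by
    have := Fintype.one_lt_card (α := F); omega
  have hd0 : 0 < d := Nat.pos_of_ne_zero (by rintro rfl; omega)
  have hn0 : 0 < n := Nat.pos_of_ne_zero (by rintro rfl; omega)
  have hdiv : (Fintype.card F - 1) / d = n := by rw [hn, Nat.mul_div_cancel_left _ hd0]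
  rw [hdiv] at hB
  set N : Fˣ → ℕ := fun c => (Finset.univ.filter fun x => w x ^ n = (c : F) ^ n).card with hN
  have hfib : ∀ φ : Fˣ → ℂ, ∑ c, φ c * N c
      = ∑ x, ∑ c ∈ Finset.univ.filter (fun c : Fˣ => w x ^ n = (c : F) ^ n), φ c := by
    intro φ
    simp_rw [hN, Finset.card_filter, Nat.cast_sum, Finset.mul_sum, Finset.sum_filter]
    rw [Finset.sum_comm]
    simp
  have hzero : ∀ x, w x = 0 → (Finset.univ.filter fun c : Fˣ => w x ^ n = (c : F) ^ n) = ∅ := by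
    intro x hx
    ext c
    simp [hx, zero_pow hn0.ne', (pow_ne_zero n c.ne_zero).symm]
  have hunit : ∀ x (u : Fˣ), w x = u → (Finset.univ.filter fun c : Fˣ => w x ^ n = (c : F) ^ n)
      = Finset.univ.filter fun c : Fˣ => c ^ n = u ^ n := by
    intro x u hu
    ext c
    simp only [hu, Finset.mem_filter, Finset.mem_univ, true_and, Units.ext_iff,
      Units.val_pow_eq_pow_val, eq_comm]
  have hnd : n ∣ Fintype.card F - 1 := ⟨d, by rw [hn, mul_comm]⟩
  have h1 : ∑ c : Fˣ, θ c * N c = n * ∑ x, θ (w x) := by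
    rw [hfib, Finset.mul_sum]
    refine Finset.sum_congr rfl fun x _ => ?_
    by_cases hx : w x = 0
    · rw [hzero x hx, hx, Finset.sum_empty, MulChar.map_zero, mul_zero]
    · rw [hunit x (Units.mk0 _ hx) rfl, Finset.sum_congr rfl (g := fun _ => θ (w x)),
        Finset.sum_const, card_pow_eq_pow hnd, nsmul_eq_mul]
      intro c hc
      rw [Finset.mem_filter] at hc
      have : θ ((c / Units.mk0 _ hx : Fˣ)) = 1 :=
        MulChar.apply_eq_one_of_pow_eq_one ⟨n, hn⟩ hθd (by rw [hdiv, div_pow, hc.2, div_self'])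
      have h2 : (c : F) = (c / Units.mk0 _ hx : Fˣ) * w x := by simp [hx]
      rw [h2, map_mul, this, one_mul]
  have h2 : ∑ c : Fˣ, (N c : ℝ) =
      n * (Fintype.card X - (Finset.univ.filter fun x => w x = 0).card) := by
    have := hfib 1
    simp only [Pi.one_apply, one_mul] at this
    have h3 : ∀ x, (∑ c ∈ Finset.univ.filter (fun c : Fˣ => w x ^ n = (c : F) ^ n), (1 : ℂ))
        = n * (1 - if w x = 0 then 1 else 0) := by
      intro x
      by_cases hx : w x = 0
      · rw [hzero x hx, if_pos hx, Finset.sum_empty, sub_self, mul_zero]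
      · rw [hunit x (Units.mk0 _ hx) rfl, Finset.sum_const, card_pow_eq_pow hnd]
        simp [hx]
    simp_rw [h3] at this
    rw [← Finset.mul_sum, Finset.sum_sub_distrib, Finset.sum_boole] at this
    simp only [Finset.sum_const, Finset.card_univ, nsmul_eq_mul, mul_one] at this
    exact_mod_cast this
  have h3 : ∑ c : Fˣ, θ c = 0 := by
    have := MulChar.sum_eq_zero_of_ne_one hθ
    rw [Fintype.sum_eq_add_sum_subtype_ne _ (0 : F), MulChar.map_zero, zero_add] at this
    rw [← this]
    exact Fintype.sum_equiv unitsEquivNeZero _ _ fun c => rfl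
  have hθnorm : ∀ c : Fˣ, ‖θ c‖ = 1 := by
    intro c
    refine Complex.norm_eq_one_of_pow_eq_one (n := d) ?_ hd0.ne'
    rw [← MulChar.pow_apply_coe, hθd, MulChar.one_apply_coe]
  have h4 : (n : ℂ) * ∑ x, θ (w x) = ∑ c : Fˣ, θ c * ((N c : ℂ) - (B / d : ℝ)) := by
    simp_rw [mul_sub, Finset.sum_sub_distrib, ← Finset.sum_mul, h3, h1]
    simp
  have hcu : (Fintype.card Fˣ : ℝ) = d * n := by
    rw [Fintype.card_units, hn]; push_cast; ring
  have hd0' : (0 : ℝ) < d := by exact_mod_cast hd0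
  have hn0' : (0 : ℝ) < n := by exact_mod_cast hn0
  have h5 : n * ‖∑ x, θ (w x)‖ ≤
      n * (B - Fintype.card X + (Finset.univ.filter fun x => w x = 0).card) := by
    calc (n : ℝ) * ‖∑ x, θ (w x)‖ = ‖(n : ℂ) * ∑ x, θ (w x)‖ := by simp
      _ ≤ ∑ c : Fˣ, (B / d - N c) := by
        rw [h4]
        refine norm_sum_le_of_le _ fun c _ => ?_
        rw [norm_mul, hθnorm, one_mul, ← Complex.ofReal_natCast, ← Complex.ofReal_sub,
          Complex.norm_real, Real.norm_eq_abs, abs_sub_comm, abs_of_nonneg]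
        rw [sub_nonneg, le_div_iff₀ hd0', mul_comm]
        exact_mod_cast hB c
      _ = _ := by
        rw [Finset.sum_sub_distrib, h2, Finset.sum_const, Finset.card_univ, nsmul_eq_mul, hcu]
        field_simp
        ring
  exact le_of_mul_le_mul_left h5 hn0'

theorem norm_sum_norm_aeval_le {F K : Type*} [Field F] [Fintype F] [Field K] [Fintype K]
    [Algebra F K] (p : ℕ) [Fact p.Prime] [CharP F p] {r s d : ℕ} (hr : r = p ^ s)
    (hK : Fintype.card K = r ^ 2) (hd : d ∣ Fintype.card F - 1) (hdr : d ∣ r - 1) {f : F[X]}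
    (hf0 : f ≠ 0)
    (hf : ∀ e, (∀ a, d ∣ e * f.rootMultiplicity a) → d ∣ e)
    (hr₁ : 4 * d * f.natDegree < r) (hr₂ : 4 * f.natDegree + 8 ≤ r)
    {θ : MulChar F ℂ} (hθ : θ ≠ 1) (hθd : θ ^ d = 1) :
    ‖∑ x : K, θ (Algebra.norm F (aeval x f))‖
      ≤ d * (5 * f.natDegree + 9) * r + f.natDegree := by
  classical
  have hcard : 0 < Fintype.card F - 1 := by
    have := Fintype.one_lt_card (α := F); omega
  have hd0 : 0 < d := Nat.pos_of_ne_zero (by rintro rfl; rw [zero_dvd_iff] at hd; omega)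
  have hFK : Fintype.card F - 1 ∣ r ^ 2 - 1 := by
    rw [← hK, Module.card_eq_pow_finrank (K := F) (V := K)]
    simpa using Nat.sub_dvd_pow_sub_pow (Fintype.card F) 1 (Module.finrank F K)
  refine (norm_sum_le_of_mul_card_le hθ hd hθd _
    (B := ((r ^ 2 + d * (5 * f.natDegree + 9) * r : ℕ) : ℝ)) fun c => ?_).trans ?_
  · rw [← Nat.cast_mul, Nat.cast_le]
    refine mul_card_le_of_pow_eq p hr hK hd0 hdr hf0 hf hr₁ hr₂
      (pow_ne_zero ((Fintype.card F - 1) / d) c.ne_zero) _ fun x hx => ?_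
    rw [Finset.mem_filter] at hx
    rw [← hx.2, map_pow, FiniteField.algebraMap_norm_eq_pow, ← pow_mul,
      Nat.card_eq_fintype_card, Nat.card_eq_fintype_card, hK]
    obtain ⟨m, hm⟩ := hFK
    obtain ⟨n, hn⟩ := hd
    congr 1
    rw [hm, Nat.mul_div_cancel_left _ hcard, hn, Nat.mul_div_cancel_left _ hd0, mul_assoc,
      Nat.mul_div_cancel_left _ hd0, mul_comm]
  · have hZ : (Finset.univ.filter fun x : K => Algebra.norm F (aeval x f) = 0).card
        ≤ f.natDegree := by
      have hmap0 : f.map (algebraMap F K) ≠ 0 :=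
        (Polynomial.map_ne_zero_iff (algebraMap F K).injective).2 hf0
      rw [← natDegree_map (algebraMap F K)]
      refine card_le_degree_of_subset_roots fun x hx => ?_
      rw [mem_roots hmap0, IsRoot.def, eval_map_algebraMap]
      simpa [Algebra.norm_eq_zero_iff] using hx
    have hZ' : ((Finset.univ.filter fun x : K => Algebra.norm F (aeval x f) = 0).card : ℝ)
        ≤ f.natDegree := by exact_mod_cast hZ
    rw [hK]
    push_cast
    linarith

theorem finite_setOf_monic_natDegree_eq (F : Type*) [Field F] [Finite F] (n : ℕ) :
    {h : F[X] | h.Monic ∧ h.natDegree = n}.Finite := by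
  have : Finite (degreeLT F n) := Finite.of_equiv _ (degreeLTEquiv F n).toEquiv.symm
  exact Finite.of_equiv _ (monicEquivDegreeLT n).symm

/-- The monic polynomials of degree `n` over a finite field. -/
noncomputable def monicsOfDegree (F : Type*) [Field F] [Finite F] (n : ℕ) : Finset F[X] :=
  (finite_setOf_monic_natDegree_eq F n).toFinset

theorem mem_monicsOfDegree {F : Type*} [Field F] [Finite F] {n : ℕ} {h : F[X]} :
    h ∈ monicsOfDegree F n ↔ h.Monic ∧ h.natDegree = n := by
  simp [monicsOfDegree]

open Classical in
/-- The monic irreducible polynomials of degree at most `n` over a finite field. -/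
noncomputable def irreduciblesOfDegreeLE (F : Type*) [Field F] [Finite F] (n : ℕ) : Finset F[X] :=
  ((Finset.range (n + 1)).biUnion (monicsOfDegree F)).filter Irreducible

theorem mem_irreduciblesOfDegreeLE {F : Type*} [Field F] [Finite F] {n : ℕ} {P : F[X]} :
    P ∈ irreduciblesOfDegreeLE F n ↔ P.Monic ∧ Irreducible P ∧ P.natDegree ≤ n := by
  simp [irreduciblesOfDegreeLE, mem_monicsOfDegree]
  tauto

open Classical UniqueFactorizationMonoid in
theorem sum_natDegree_of_pow_dvd {F : Type*} [Field F] [Finite F] {n : ℕ} {h : F[X]}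
    (hh : h ∈ monicsOfDegree F n) :
    ∑ P ∈ irreduciblesOfDegreeLE F n, ∑ j ∈ Finset.Icc 1 n, (if P ^ j ∣ h then P.natDegree else 0)
      = n := by
  obtain ⟨hmon, hdeg⟩ := mem_monicsOfDegree.1 hh
  have h0 : h ≠ 0 := hmon.ne_zero
  have hcount : ∀ P ∈ irreduciblesOfDegreeLE F n, ∀ j,
      P ^ j ∣ h ↔ j ≤ (normalizedFactors h).count P := by
    intro P hP j
    obtain ⟨hPm, hPi, -⟩ := mem_irreduciblesOfDegreeLE.1 hP
    rw [pow_dvd_iff_le_emultiplicity, emultiplicity_eq_count_normalizedFactors hPi h0,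
      hPm.normalize_eq_self]
    exact Nat.cast_le
  have hinner : ∀ P ∈ irreduciblesOfDegreeLE F n,
      ∑ j ∈ Finset.Icc 1 n, (if P ^ j ∣ h then P.natDegree else 0)
        = (normalizedFactors h).count P * P.natDegree := by
    intro P hP
    obtain ⟨hPm, hPi, -⟩ := mem_irreduciblesOfDegreeLE.1 hP
    have hle : (normalizedFactors h).count P ≤ n := by
      have h1 := natDegree_le_of_dvd (((hcount P hP) _).2 le_rfl) h0
      rw [natDegree_pow, hdeg] at h1
      exact (Nat.le_mul_of_pos_right _ hPi.natDegree_pos).trans h1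
    rw [← Finset.sum_filter, Finset.sum_const, smul_eq_mul]
    congr 1
    rw [← Nat.add_sub_cancel (n := (normalizedFactors h).count P) (m := 1), ← Nat.card_Icc]
    congr 1
    ext j
    simp only [Finset.mem_filter, Finset.mem_Icc, hcount P hP]
    omega
  rw [Finset.sum_congr rfl hinner, ← hdeg]
  have hprod := prod_normalizedFactors_eq h0
  rw [hmon.normalize_eq_self] at hprod
  conv_rhs => rw [← hprod]
  rw [natDegree_multiset_prod _ (zero_notMem_normalizedFactors h),
    Finset.sum_multiset_map_count]
  simp only [smul_eq_mul]
  symm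
  refine Finset.sum_subset (fun P hP => ?_) fun P _ hP => ?_
  · rw [Multiset.mem_toFinset] at hP
    refine mem_irreduciblesOfDegreeLE.2 ⟨?_, irreducible_of_normalized_factor P hP,
      natDegree_le_of_dvd (dvd_of_mem_normalizedFactors hP) h0⟩
    rw [← normalize_normalized_factor P hP]
    exact monic_normalize (irreducible_of_normalized_factor P hP).ne_zero
  · rw [Multiset.mem_toFinset] at hP
    rw [Multiset.count_eq_zero_of_notMem hP, zero_mul]

open Classical in
theorem sum_monicsOfDegree_of_dvd {F : Type*} [Field F] [Finite F] (χ : F[X] →* ℂ) {n : ℕ}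
    {g : F[X]} (hg : g.Monic) :
    ∑ h ∈ monicsOfDegree F n, (if g ∣ h then χ h else 0)
      = if g.natDegree ≤ n then χ g * ∑ h ∈ monicsOfDegree F (n - g.natDegree), χ h else 0 := by
  split_ifs with hn
  · rw [← Finset.sum_filter, Finset.mul_sum]
    symm
    refine Finset.sum_bij (fun h _ => g * h) ?_ ?_ ?_ ?_
    · intro h hh
      obtain ⟨hm, hd⟩ := mem_monicsOfDegree.1 hh
      rw [Finset.mem_filter, mem_monicsOfDegree, hg.natDegree_mul hm]
      exact ⟨⟨hg.mul hm, by omega⟩, dvd_mul_right _ _⟩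
    · intro a _ b _ hab
      exact mul_left_cancel₀ hg.ne_zero hab
    · intro h hh
      rw [Finset.mem_filter, mem_monicsOfDegree] at hh
      obtain ⟨⟨hm, hd⟩, b, rfl⟩ := hh
      have hb := hg.of_mul_monic_left hm
      rw [hg.natDegree_mul hb] at hd
      exact ⟨b, mem_monicsOfDegree.2 ⟨hb, by omega⟩, rfl⟩
    · intro h _
      rw [map_mul]
  · refine Finset.sum_eq_zero fun h hh => ?_
    obtain ⟨hm, hd⟩ := mem_monicsOfDegree.1 hh
    rw [if_neg]
    intro hdvd
    exact hn (hd ▸ natDegree_le_of_dvd hdvd hm.ne_zero)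

open Classical in
/-- The logarithmic derivative of the Euler product of `∑ χ(h) T ^ deg h`. -/
theorem natCast_mul_sum_monicsOfDegree {F : Type*} [Field F] [Finite F] (χ : F[X] →* ℂ) (n : ℕ) :
    n * ∑ h ∈ monicsOfDegree F n, χ h
      = ∑ k ∈ Finset.Icc 1 n, (∑ P ∈ irreduciblesOfDegreeLE F n,
          if P.natDegree ∣ k then P.natDegree * χ P ^ (k / P.natDegree) else 0)
            * ∑ h ∈ monicsOfDegree F (n - k), χ h := by
  have h1 : ∀ h ∈ monicsOfDegree F n, n * χ h = ∑ P ∈ irreduciblesOfDegreeLE F n,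
      ∑ j ∈ Finset.Icc 1 n, P.natDegree * (if P ^ j ∣ h then χ h else 0) := by
    intro h hh
    conv_lhs => rw [← sum_natDegree_of_pow_dvd hh]
    push_cast
    simp_rw [Finset.sum_mul, ite_mul, mul_ite, zero_mul, mul_zero]
  rw [Finset.mul_sum, Finset.sum_congr rfl h1, Finset.sum_comm]
  simp_rw [Finset.sum_mul]
  rw [Finset.sum_comm (s := Finset.Icc 1 n)]
  refine Finset.sum_congr rfl fun P hP => ?_
  obtain ⟨hPm, hPi, -⟩ := mem_irreduciblesOfDegreeLE.1 hP
  have hpos := hPi.natDegree_pos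
  rw [Finset.sum_comm]
  simp_rw [← Finset.mul_sum, sum_monicsOfDegree_of_dvd χ (hPm.pow _), natDegree_pow, ite_mul,
    zero_mul, Finset.mul_sum _ _ (P.natDegree : ℂ), mul_ite, mul_zero]
  rw [← Finset.sum_filter, ← Finset.sum_filter]
  refine Finset.sum_nbij' (fun j => j * P.natDegree) (fun k => k / P.natDegree) ?_ ?_ ?_ ?_ ?_
  · intro j hj
    simp only [Finset.mem_filter, Finset.mem_Icc] at hj ⊢
    exact ⟨⟨Nat.mul_pos hj.1.1 hpos, hj.2⟩, dvd_mul_left _ _⟩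
  · intro k hk
    simp only [Finset.mem_filter, Finset.mem_Icc] at hk ⊢
    rw [Nat.div_mul_cancel hk.2]
    exact ⟨⟨Nat.div_pos (Nat.le_of_dvd hk.1.1 hk.2) hpos, (Nat.div_le_self _ _).trans hk.1.2⟩,
      hk.1.2⟩
  · intro j _
    exact Nat.mul_div_cancel _ hpos
  · intro k hk
    exact Nat.div_mul_cancel (Finset.mem_filter.1 hk).2
  · intro j _
    simp only [Nat.mul_div_cancel _ hpos, map_pow, mul_assoc]

theorem norm_le_of_norm_sum_pow_le (z : Multiset ℂ) {B Q : ℝ} (hQ : 0 < Q) (N : ℕ)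
    (h : ∀ s, N ≤ s → ‖(z.map (· ^ s)).sum‖ ≤ B * Q ^ s) {w : ℂ} (hw : w ∈ z) : ‖w‖ ≤ Q := by
  classical
  set L : ℂ[X] := ∏ v ∈ z.toFinset.erase w, (X - C v) with hL
  have hLw : L.eval w ≠ 0 := by
    rw [hL, eval_prod, Finset.prod_ne_zero_iff]
    intro v hv
    simpa [sub_ne_zero] using (Finset.ne_of_mem_erase hv).symm
  have hLv : ∀ v ∈ z.toFinset, v ≠ w → L.eval v = 0 := by
    intro v hv hvw
    rw [hL, eval_prod, Finset.prod_eq_zero (Finset.mem_erase.2 ⟨hvw, hv⟩)]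
    simp
  have key : ∀ s, ∑ k ∈ Finset.range (L.natDegree + 1), L.coeff k * (z.map (· ^ (s + k))).sum
      = z.count w * w ^ s * L.eval w := by
    intro s
    have h1 : ∀ v, v ^ s * L.eval v
        = ∑ k ∈ Finset.range (L.natDegree + 1), L.coeff k * v ^ (s + k) := by
      intro v
      rw [eval_eq_sum_range, Finset.mul_sum]
      exact Finset.sum_congr rfl fun k _ => by ring
    calc _ = (z.map fun v => v ^ s * L.eval v).sum := by
          simp_rw [h1, Multiset.sum_map_sum, Multiset.sum_map_mul_left]
      _ = _ := by
          rw [Finset.sum_multiset_map_count, Finset.sum_eq_single w]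
          · simp [mul_assoc]
          · intro v hv hvw
            rw [hLv v hv hvw]; simp
          · intro hw'
            exact absurd (Multiset.mem_toFinset.2 hw) hw'
  have hcount : (0 : ℝ) < z.count w := by exact_mod_cast Multiset.count_pos.2 hw
  have hpos : 0 < z.count w * ‖L.eval w‖ := mul_pos hcount (norm_pos_iff.2 hLw)
  set B' := ∑ k ∈ Finset.range (L.natDegree + 1), ‖L.coeff k‖ * (B * Q ^ k) with hB'
  have hbound : ∀ s, N ≤ s → (‖w‖ / Q) ^ s ≤ B' / (z.count w * ‖L.eval w‖) := by
    intro s hs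
    rw [le_div_iff₀ hpos, div_pow, div_mul_eq_mul_div, div_le_iff₀ (pow_pos hQ s)]
    calc ‖w‖ ^ s * (z.count w * ‖L.eval w‖) = ‖z.count w * w ^ s * L.eval w‖ := by
          simp [norm_pow]; ring
      _ ≤ ∑ k ∈ Finset.range (L.natDegree + 1), ‖L.coeff k‖ * (B * Q ^ (s + k)) := by
          rw [← key]
          refine norm_sum_le_of_le _ fun k _ => ?_
          rw [norm_mul]
          exact mul_le_mul_of_nonneg_left (h _ (by omega)) (norm_nonneg _)
      _ = B' * Q ^ s := by
          rw [hB', Finset.sum_mul]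
          exact Finset.sum_congr rfl fun k _ => by ring
  by_contra! hlt
  have h1 : 1 < ‖w‖ / Q := (one_lt_div hQ).2 hlt
  obtain ⟨s, hs1, hs2⟩ := ((tendsto_pow_atTop_atTop_of_one_lt h1).eventually_gt_atTop
    (B' / (z.count w * ‖L.eval w‖))).and (Filter.eventually_ge_atTop N) |>.exists
  exact absurd (hbound s hs2) (not_le.2 hs1)

theorem exists_eq_prod_one_sub_C_mul_X {K : Type*} [Field K] [IsAlgClosed K] (P : K[X])
    (hP : P.coeff 0 = 1) :
    ∃ ω : Multiset K, ω.card = P.natDegree ∧ P = (ω.map fun a => 1 - C a * X).prod := by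
  refine ⟨P.roots.map (·⁻¹), ?_, ?_⟩
  · rw [Multiset.card_map]
    exact (IsAlgClosed.splits P).natDegree_eq_card_roots.symm
  have hP0 : P ≠ 0 := by rintro rfl; simp at hP
  have h0 : ∀ a ∈ P.roots, a ≠ 0 := by
    rintro a ha rfl
    rw [mem_roots hP0, IsRoot.def, ← coeff_zero_eq_eval_zero, hP] at ha
    exact one_ne_zero ha
  have h1 := (IsAlgClosed.splits P).eq_prod_roots
  have h2 : (P.roots.map fun a => X - C a).prod
      = C ((P.roots.map fun a => -a).prod) * (P.roots.map fun a => 1 - C a⁻¹ * X).prod := by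
    rw [map_multiset_prod, Multiset.map_map, ← Multiset.prod_map_mul]
    refine congrArg _ (Multiset.map_congr rfl fun a ha => ?_)
    have h4 : C a * C a⁻¹ = (1 : K[X]) := by rw [← C_mul, mul_inv_cancel₀ (h0 a ha), C_1]
    simp only [Function.comp, C_neg]
    linear_combination (-X) * h4
  rw [h2, ← mul_assoc, ← C_mul] at h1
  rw [Multiset.map_map]
  set G := (P.roots.map fun a => 1 - C a⁻¹ * X).prod with hG
  have hG0 : G.eval 0 = 1 := by
    rw [hG, eval_multiset_prod, Multiset.map_map]
    simp
  have h3 : P.eval 0 = 1 := by rw [← coeff_zero_eq_eval_zero, hP]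
  rw [h1, eval_mul, eval_C, hG0, mul_one] at h3
  rw [h3, C_1, one_mul] at h1
  exact h1

open PowerSeries in
theorem PowerSeries.X_mul_derivative_prod_one_sub_C_mul_X {K : Type*} [Field K] (ω : Multiset K) :
    (PowerSeries.X : K⟦X⟧) *
      PowerSeries.derivative K (ω.map fun a => 1 - PowerSeries.C a * PowerSeries.X).prod
      = -(PowerSeries.mk fun n => if n = 0 then 0 else (ω.map (· ^ n)).sum)
        * (ω.map fun a => 1 - PowerSeries.C a * PowerSeries.X).prod := by
  induction ω using Multiset.induction_on with
  | empty => 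
    have : (PowerSeries.mk fun n => if n = 0 then (0 : K) else 0) = 0 := by ext; simp
    simpa using this
  | cons a ω ih =>
    simp only [Multiset.map_cons, Multiset.prod_cons, Multiset.sum_cons, Derivation.leibniz,
      smul_eq_mul]
    have h1 : (PowerSeries.mk fun n => if n = 0 then (0 : K) else a ^ n + (ω.map (· ^ n)).sum)
        = (PowerSeries.mk fun n => if n = 0 then (0 : K) else a ^ n)
          + PowerSeries.mk fun n => if n = 0 then (0 : K) else (ω.map (· ^ n)).sum := by
      ext n
      simp only [PowerSeries.coeff_mk, map_add]
      split_ifs <;> simp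
    have h2 : (PowerSeries.mk fun n => if n = 0 then (0 : K) else a ^ n)
        * (1 - PowerSeries.C a * PowerSeries.X) = PowerSeries.C a * PowerSeries.X := by
      ext n
      rw [mul_sub, mul_one, ← mul_assoc, map_sub]
      cases n with
      | zero => simp
      | succ n =>
        rw [PowerSeries.coeff_succ_mul_X, PowerSeries.coeff_succ_mul_X, PowerSeries.coeff_mul_C]
        simp only [PowerSeries.coeff_mk, PowerSeries.coeff_C]
        split_ifs <;> simp_all [pow_succ]
    have h3 : PowerSeries.derivative K (1 - PowerSeries.C a * PowerSeries.X : K⟦X⟧) =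
        - PowerSeries.C a := by
      simp [Derivation.leibniz]
    rw [h1, h3]
    linear_combination (1 - PowerSeries.C a * PowerSeries.X) * ih
      + (ω.map fun a => 1 - PowerSeries.C a * PowerSeries.X).prod * h2

theorem exists_multiset_eq_neg_sum_pow {K : Type*} [Field K] [IsAlgClosed K] {c S : ℕ → K} {m : ℕ}
    (hc0 : c 0 = 1) (hcm : ∀ n, m < n → c n = 0)
    (hS : ∀ n, 0 < n → n * c n = ∑ k ∈ Finset.Icc 1 n, S k * c (n - k)) :
    ∃ ω : Multiset K, ω.card ≤ m ∧ ∀ n, 0 < n → S n = -(ω.map (· ^ n)).sum := by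
  set P : K[X] := ∑ i ∈ Finset.range (m + 1), C (c i) * X ^ i with hP
  have hcoeff : ∀ n, P.coeff n = c n := by
    intro n
    rw [hP, finsetSum_coeff]
    simp only [coeff_C_mul_X_pow]
    rw [Finset.sum_ite_eq]
    split_ifs with h
    · rfl
    · rw [hcm]; simpa using h
  obtain ⟨ω, hω, hPω⟩ := exists_eq_prod_one_sub_C_mul_X P (by rw [hcoeff, hc0])
  refine ⟨ω, hω.le.trans ?_, ?_⟩
  · rw [natDegree_le_iff_coeff_eq_zero]
    exact fun n hn => by rw [hcoeff, hcm n hn]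
  have hPs : (P : PowerSeries K)
      = (ω.map fun a => 1 - PowerSeries.C a * PowerSeries.X).prod := by
    rw [hPω, ← coeToPowerSeries.ringHom_apply, map_multiset_prod, Multiset.map_map]
    refine congrArg _ (Multiset.map_congr rfl fun a _ => ?_)
    simp [coeToPowerSeries.ringHom_apply]
  have h1 := PowerSeries.X_mul_derivative_prod_one_sub_C_mul_X ω
  rw [← hPs] at h1
  have hP0 : (P : PowerSeries K) ≠ 0 := by
    intro h
    have := congrArg (PowerSeries.coeff 0) h
    rw [coeff_coe, hcoeff, hc0, map_zero] at this
    exact one_ne_zero this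
  have h2 : PowerSeries.X * PowerSeries.derivative K (P : PowerSeries K)
      = (PowerSeries.mk fun n => if n = 0 then 0 else S n) * (P : PowerSeries K) := by
    ext n
    cases n with
    | zero => simp [PowerSeries.coeff_mul]
    | succ n =>
      rw [PowerSeries.coeff_succ_X_mul, PowerSeries.coeff_derivative, coeff_coe, hcoeff,
        PowerSeries.coeff_mul,
        Finset.Nat.sum_antidiagonal_eq_sum_range_succ_mk, Finset.sum_range_succ']
      have := hS (n + 1) n.succ_pos
      rw [Finset.range_eq_Ico, Finset.sum_Ico_add' (fun k => (PowerSeries.coeff k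
        (PowerSeries.mk fun n => if n = 0 then 0 else S n)) * PowerSeries.coeff (n + 1 - k)
          (P : PowerSeries K)) 0 (n + 1) 1]
      push_cast at this
      rw [mul_comm, this]
      simp only [PowerSeries.coeff_mk, if_true, zero_mul, add_zero, coeff_coe, hcoeff, zero_add]
      refine Finset.sum_congr (by ext; simp) fun k hk => ?_
      rw [Finset.mem_Ico] at hk
      rw [if_neg (by omega)]
  have h3 := mul_right_cancel₀ hP0 (h2.symm.trans h1)
  intro n hn
  have := congrArg (PowerSeries.coeff n) h3
  simpa [hn.ne'] using this

/-- The norm of `x + a` when `h` is the minimal polynomial of `x`. -/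
noncomputable def signedEval {F : Type*} [Field F] (a : F) : F[X] →* F where
  toFun h := (-1) ^ h.natDegree * h.eval (-a)
  map_one' := by simp
  map_mul' g h := by
    by_cases hg : g = 0
    · simp [hg]
    by_cases hh : h = 0
    · simp [hh]
    rw [natDegree_mul hg hh, eval_mul, pow_add]
    ring

theorem signedEval_apply {F : Type*} [Field F] (a : F) (h : F[X]) :
    signedEval a h = (-1) ^ h.natDegree * h.eval (-a) := rfl

open IntermediateField in
theorem norm_add_algebraMap_eq {F K : Type*} [Field F] [Field K] [Algebra F K]
    [FiniteDimensional F K] (x : K) (a : F) :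
    Algebra.norm F (x + algebraMap F K a)
      = signedEval a (minpoly F x) ^ (Module.finrank F K / (minpoly F x).natDegree) := by
  set y := x + algebraMap F K a with hy
  have hint : IsIntegral F y := Algebra.IsIntegral.isIntegral y
  have hmin : minpoly F y = (minpoly F x).comp (X - C a) := minpoly.add_algebraMap x a
  have hdeg : (minpoly F y).natDegree = (minpoly F x).natDegree := by
    rw [hmin, natDegree_comp, natDegree_X_sub_C, mul_one]
  rw [Algebra.norm_eq_norm_adjoin, ← adjoin.powerBasis_gen hint,
    Algebra.PowerBasis.norm_gen_eq_coeff_zero_minpoly, adjoin.powerBasis_gen, minpoly_gen,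
    adjoin.powerBasis_dim, hdeg, hmin, coeff_zero_eq_eval_zero, eval_comp, signedEval_apply]
  have hfin : Module.finrank F K / (minpoly F x).natDegree = Module.finrank F⟮y⟯ K := by
    rw [← hdeg, ← adjoin.finrank hint, ← Module.finrank_mul_finrank F F⟮y⟯ K]
    exact Nat.mul_div_cancel_left _ Module.finrank_pos
  rw [hfin]
  simp

open Classical in
theorem card_filter_minpoly_eq {F K : Type*} [Field F] [Finite F] [Field K] [Fintype K]
    [Algebra F K] {P : F[X]} (hPm : P.Monic) (hPi : Irreducible P) :
    (Finset.univ.filter fun x : K => minpoly F x = P).card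
      = if P.natDegree ∣ Module.finrank F K then P.natDegree else 0 := by
  split_ifs with h
  · have := Fintype.ofFinite F
    rw [hPi.natDegree_dvd_iff_dvd_X_pow_card_pow_sub_X, Nat.card_eq_fintype_card,
      ← Module.card_eq_pow_finrank] at h
    have hsplit : (P.map (algebraMap F K)).Splits := by
      refine (FiniteField.isSplittingField_sub K F).splits.of_dvd ?_
        (Polynomial.map_dvd _ h)
      exact (Polynomial.map_ne_zero_iff (algebraMap F K).injective).2
        (FiniteField.X_pow_card_sub_X_ne_zero _ Fintype.one_lt_card)
    rw [← card_rootSet_eq_natDegree (K := K) (PerfectField.separable_of_irreducible hPi) hsplit,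
      ← Set.toFinset_card]
    congr 1
    ext x
    simp only [Finset.mem_filter, Finset.mem_univ, true_and, Set.mem_toFinset,
      mem_rootSet_of_ne hPi.ne_zero]
    exact ⟨fun hx => hx ▸ minpoly.aeval F x, fun hx =>
      (minpoly.eq_of_irreducible_of_monic hPi hx hPm).symm⟩
  · rw [Finset.card_eq_zero, Finset.filter_eq_empty_iff]
    rintro x - rfl
    exact h (minpoly.degree_dvd (Algebra.IsIntegral.isIntegral x))

open Classical in
theorem sum_comp_minpoly {F K : Type*} [Field F] [Finite F] [Field K] [Fintype K] [Algebra F K]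
    {n : ℕ} (hn : Module.finrank F K ≤ n) (G : F[X] → ℂ) :
    ∑ x : K, G (minpoly F x) = ∑ P ∈ irreduciblesOfDegreeLE F n,
      if P.natDegree ∣ Module.finrank F K then P.natDegree * G P else 0 := by
  rw [← Finset.sum_fiberwise_of_maps_to (s := Finset.univ) (g := fun x : K => minpoly F x)
    (t := irreduciblesOfDegreeLE F n)]
  · refine Finset.sum_congr rfl fun P hP => ?_
    obtain ⟨hPm, hPi, -⟩ := mem_irreduciblesOfDegreeLE.1 hP
    rw [Finset.sum_congr rfl (g := fun _ => G P) fun x hx => by rw [(Finset.mem_filter.1 hx).2],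
      Finset.sum_const, card_filter_minpoly_eq hPm hPi]
    split_ifs <;> simp
  · intro x _
    have hx : IsIntegral F x := Algebra.IsIntegral.isIntegral x
    exact mem_irreduciblesOfDegreeLE.2 ⟨minpoly.monic hx, minpoly.irreducible hx,
      (minpoly.natDegree_le x).trans hn⟩

/-- The multiplicative function on polynomials whose `L`-function governs the sums
`∑ x, θ (∏ λ ∈ Λ, (x + λ) ^ a λ)`. -/
noncomputable def polyChar {F : Type*} [Field F] (θ : MulChar F ℂ) (Λ : Finset F) (a : F → ℕ) :
    F[X] →* ℂ :=
  θ.toMonoidHom.comp (∏ l ∈ Λ, signedEval l ^ a l)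

theorem polyChar_apply {F : Type*} [Field F] (θ : MulChar F ℂ) (Λ : Finset F) (a : F → ℕ)
    (h : F[X]) : polyChar θ Λ a h = θ (∏ l ∈ Λ, signedEval l h ^ a l) := by
  simp [polyChar, MonoidHom.finsetProd_apply]

open Classical in
theorem sum_norm_eq_sum_polyChar {F K : Type*} [Field F] [Finite F] [Field K] [Fintype K]
    [Algebra F K] (θ : MulChar F ℂ) (Λ : Finset F) (a : F → ℕ) {n : ℕ}
    (hn : Module.finrank F K ≤ n) :
    ∑ x : K, θ (Algebra.norm F (aeval x (∏ l ∈ Λ, (X + C l) ^ a l)))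
      = ∑ P ∈ irreduciblesOfDegreeLE F n, if P.natDegree ∣ Module.finrank F K then
        P.natDegree * polyChar θ Λ a P ^ (Module.finrank F K / P.natDegree) else 0 := by
  rw [← sum_comp_minpoly hn fun P => polyChar θ Λ a P ^ (Module.finrank F K / P.natDegree)]
  refine Finset.sum_congr rfl fun x _ => ?_
  rw [polyChar_apply, ← map_pow, ← Finset.prod_pow, map_prod, map_prod]
  refine congrArg θ (Finset.prod_congr rfl fun l _ => ?_)
  rw [map_pow, map_pow, map_add, aeval_X, aeval_C, norm_add_algebraMap_eq, pow_right_comm]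

theorem sum_polyChar_eq_zero {F : Type*} [Field F] [Fintype F] (θ : MulChar F ℂ) {Λ : Finset F}
    {a : F → ℕ} {l : F} (hl : l ∈ Λ) (hal : a l ≠ 0) (ha : θ ^ a l ≠ 1) {n : ℕ} (hn : Λ.card ≤ n) :
    ∑ h ∈ monicsOfDegree F n, polyChar θ Λ a h = 0 := by
  classical
  set M : F[X] := ∏ k ∈ Λ.erase l, (X + C k) with hM
  have hMdeg : M.natDegree < n := by
    rw [hM, natDegree_prod_of_monic _ _ fun k _ => monic_X_add_C k]
    simp only [natDegree_X_add_C, Finset.sum_const, smul_eq_mul, mul_one,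
      Finset.card_erase_of_mem hl]
    have := Finset.card_pos.2 ⟨l, hl⟩
    omega
  have hMl : M.eval (-l) ≠ 0 := by
    rw [hM, eval_prod, Finset.prod_ne_zero_iff]
    intro k hk
    simp only [eval_add, eval_X, eval_C]
    rw [neg_add_eq_sub, sub_ne_zero]
    exact Finset.ne_of_mem_erase hk
  have hMk : ∀ k ∈ Λ.erase l, M.eval (-k) = 0 := by
    intro k hk
    rw [hM, eval_prod, Finset.prod_eq_zero hk]
    simp
  have hdeg : ∀ c : F, ∀ h : F[X], h.Monic → h.natDegree = n →
      (h + C c * M).Monic ∧ (h + C c * M).natDegree = n := by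
    intro c h hm hd
    have h1 : (C c * M).natDegree < h.natDegree := by
      rw [hd]; exact (natDegree_C_mul_le _ _).trans_lt hMdeg
    refine ⟨hm.add_of_left (degree_lt_degree h1), ?_⟩
    rw [natDegree_add_eq_left_of_natDegree_lt h1, hd]
  have hshift : ∀ c : F, ∑ h ∈ monicsOfDegree F n, polyChar θ Λ a (h + C c * M)
      = ∑ h ∈ monicsOfDegree F n, polyChar θ Λ a h := by
    intro c
    refine Finset.sum_nbij' (fun h => h + C c * M) (fun h => h + C (-c) * M) ?_ ?_ ?_ ?_ ?_
    · intro h hh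
      rw [mem_monicsOfDegree] at hh ⊢
      exact hdeg c h hh.1 hh.2
    · intro h hh
      rw [mem_monicsOfDegree] at hh ⊢
      exact hdeg (-c) h hh.1 hh.2
    · intro h _
      simp
    · intro h _
      simp
    · intro h _
      rfl
  have hinner : ∀ h ∈ monicsOfDegree F n, ∑ c : F, polyChar θ Λ a (h + C c * M) = 0 := by
    intro h hh
    obtain ⟨hm, hd⟩ := mem_monicsOfDegree.1 hh
    have h1 : ∀ c : F, polyChar θ Λ a (h + C c * M)
        = θ (∏ k ∈ Λ.erase l, signedEval k h ^ a k)
          * (θ ^ a l) ((-1) ^ n * (h.eval (-l) + c * M.eval (-l))) := by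
      intro c
      rw [polyChar_apply, ← Finset.mul_prod_erase _ _ hl, map_mul, mul_comm, map_pow,
        ← MulChar.pow_apply' _ hal, signedEval_apply, (hdeg c h hm hd).2]
      simp only [eval_add, eval_mul, eval_C]
      refine congrArg (fun t => θ t * _) (Finset.prod_congr rfl fun k hk => ?_)
      rw [signedEval_apply, signedEval_apply, (hdeg c h hm hd).2, hd]
      simp [hMk k hk]
    simp_rw [h1, ← Finset.mul_sum]
    have h2 : ∑ c : F, (θ ^ a l) ((-1) ^ n * (h.eval (-l) + c * M.eval (-l)))
        = ∑ c : F, (θ ^ a l) c := by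
      refine Fintype.sum_bijective _ (Finite.injective_iff_bijective.1 fun c c' hc => ?_) _ _
        fun c => rfl
      have := mul_left_cancel₀ (pow_ne_zero n (neg_ne_zero.2 one_ne_zero)) hc
      exact mul_right_cancel₀ hMl (add_left_cancel this)
    rw [h2, MulChar.sum_eq_zero_of_ne_one ha, mul_zero]
  have htot : (Fintype.card F : ℂ) * ∑ h ∈ monicsOfDegree F n, polyChar θ Λ a h = 0 := by
    rw [← nsmul_eq_mul, ← Finset.card_univ, ← Finset.sum_const,
      ← Finset.sum_congr rfl fun c _ => hshift c,
      Finset.sum_comm]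
    exact Finset.sum_eq_zero hinner
  exact (mul_eq_zero.1 htot).resolve_left (by exact_mod_cast Fintype.card_ne_zero)

theorem sum_monicsOfDegree_one_polyChar {F : Type*} [Field F] [Fintype F] (θ : MulChar F ℂ)
    (Λ : Finset F) (a : F → ℕ) :
    ∑ h ∈ monicsOfDegree F 1, polyChar θ Λ a h = ∑ x : F, θ (∏ l ∈ Λ, (x + l) ^ a l) := by
  symm
  refine Finset.sum_bij (fun x _ => X - C x) ?_ ?_ ?_ ?_
  · intro x _
    exact mem_monicsOfDegree.2 ⟨monic_X_sub_C x, natDegree_X_sub_C x⟩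
  · intro x _ y _ h
    exact C_injective (sub_right_injective h)
  · intro h hh
    obtain ⟨hm, hd⟩ := mem_monicsOfDegree.1 hh
    refine ⟨-h.coeff 0, Finset.mem_univ _, ?_⟩
    rw [hm.eq_X_add_C hd]
    simp
  · intro x _
    rw [polyChar_apply]
    refine congrArg θ (Finset.prod_congr rfl fun l _ => ?_)
    rw [signedEval_apply, natDegree_X_sub_C]
    congr 1
    simp

theorem monicsOfDegree_zero {F : Type*} [Field F] [Finite F] : monicsOfDegree F 0 = {1} := by
  ext h
  rw [mem_monicsOfDegree, Finset.mem_singleton]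
  exact ⟨fun hh => hh.1.natDegree_eq_zero.1 hh.2, by rintro rfl; simp⟩

theorem rootMultiplicity_prod_X_add_C_pow {F : Type*} [Field F] {Λ : Finset F} (a : F → ℕ) {l : F}
    (hl : l ∈ Λ) : (∏ k ∈ Λ, (X + C k) ^ a k).rootMultiplicity (-l) = a l := by
  classical
  rw [← count_roots, roots_prod _ _ (Finset.prod_ne_zero_iff.2 fun k _ =>
    pow_ne_zero _ (X_add_C_ne_zero k)), Multiset.count_bind]
  simp_rw [roots_pow, roots_X_add_C, Multiset.count_nsmul, Multiset.count_singleton, neg_inj]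
  change ∑ k ∈ Λ, _ = _
  simp [hl]

theorem norm_sum_mulChar_prod_le_of_coprime {F : Type*} [Field F] [Fintype F] {θ : MulChar F ℂ}
    {d : ℕ} (hd : d ∣ Fintype.card F - 1) (hθ : orderOf θ = d) {Λ : Finset F} (hΛ : Λ.Nonempty)
    {a : F → ℕ} (ha : ∀ l ∈ Λ, ¬ d ∣ a l) (hcop : ∀ e, (∀ l ∈ Λ, d ∣ e * a l) → d ∣ e) :
    ‖∑ x : F, θ (∏ l ∈ Λ, (x + l) ^ a l)‖ ≤ ((Λ.card - 1 : ℕ) : ℝ) * √(Fintype.card F) := by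
  classical
  obtain ⟨p, hchar⟩ := CharP.exists F
  have hpF : Fact p.Prime := ⟨CharP.char_is_prime F p⟩
  obtain ⟨t, -, hq⟩ := FiniteField.card F p
  obtain ⟨l, hl⟩ := hΛ
  have hθd : θ ^ d = 1 := hθ ▸ pow_orderOf_eq_one θ
  have hal : θ ^ a l ≠ 1 := fun h => ha l hl (hθ ▸ orderOf_dvd_of_pow_eq_one h)
  have hθ1 : θ ≠ 1 := by rintro rfl; exact hal (one_pow _)
  set S : ℕ → ℂ := fun k => ∑ P ∈ irreduciblesOfDegreeLE F k,
    if P.natDegree ∣ k then P.natDegree * polyChar θ Λ a P ^ (k / P.natDegree) else 0 with hS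
  set c : ℕ → ℂ := fun n => ∑ h ∈ monicsOfDegree F n, polyChar θ Λ a h with hc
  have hSn : ∀ n, 0 < n → n * c n = ∑ k ∈ Finset.Icc 1 n, S k * c (n - k) := by
    intro n _
    rw [hc, natCast_mul_sum_monicsOfDegree]
    refine Finset.sum_congr rfl fun k hk => ?_
    rw [Finset.mem_Icc] at hk
    congr 1
    symm
    refine Finset.sum_subset (fun P hP => ?_) fun P hPn hPk => if_neg fun hdvd => hPk ?_
    · rw [mem_irreduciblesOfDegreeLE] at hP ⊢
      exact ⟨hP.1, hP.2.1, hP.2.2.trans hk.2⟩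
    · rw [mem_irreduciblesOfDegreeLE] at hPn ⊢
      exact ⟨hPn.1, hPn.2.1, Nat.le_of_dvd hk.1 hdvd⟩
  have hc0 : c 0 = 1 := by
    simp [hc, monicsOfDegree_zero]
  have hΛpos : 0 < Λ.card := Finset.card_pos.2 ⟨l, hl⟩
  obtain ⟨ω, hωcard, hω⟩ := exists_multiset_eq_neg_sum_pow (m := Λ.card - 1) hc0 (fun n hn =>
    sum_polyChar_eq_zero θ hl (fun h => ha l hl (by rw [h]; exact dvd_zero d)) hal (by omega)) hSn
  have hc1 : ∑ x : F, θ (∏ l ∈ Λ, (x + l) ^ a l) = -ω.sum := by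
    rw [← sum_monicsOfDegree_one_polyChar]
    have := hSn 1 one_pos
    rw [Finset.Icc_self, Finset.sum_singleton, hω 1 one_pos, hc0] at this
    simpa using this
  set f : F[X] := ∏ k ∈ Λ, (X + C k) ^ a k with hf
  set D := f.natDegree with hD
  have hf0 : f ≠ 0 := Finset.prod_ne_zero_iff.2 fun k _ => pow_ne_zero _ (X_add_C_ne_zero k)
  have hq1 : 1 < Fintype.card F := Fintype.one_lt_card
  have hqpos : (0 : ℝ) < Fintype.card F := by exact_mod_cast Fintype.card_pos
  have hbound : ∀ w ∈ ω, ‖w‖ ^ 2 ≤ Fintype.card F := by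
    intro w hw
    rw [← norm_pow]
    refine norm_le_of_norm_sum_pow_le (ω.map (· ^ 2)) hqpos (4 * d * D + 4 * D + 8)
      (B := d * (5 * D + 9) + D) (fun s hs => ?_) (Multiset.mem_map_of_mem _ hw)
    have hs0 : 0 < s := by omega
    have : NeZero (2 * s) := ⟨by omega⟩
    have := Fintype.ofFinite (FiniteField.Extension F p (2 * s))
    set r := Fintype.card F ^ s with hr
    have hrs : s < r := Nat.lt_pow_self hq1
    have hK : Fintype.card (FiniteField.Extension F p (2 * s)) = r ^ 2 := by
      rw [← Nat.card_eq_fintype_card, FiniteField.natCard_extension, Nat.card_eq_fintype_card, hr,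
        ← pow_mul, mul_comm]
    have hdr : d ∣ r - 1 := hd.trans (by simpa using Nat.sub_dvd_pow_sub_pow (Fintype.card F) 1 s)
    have hmain := norm_sum_norm_aeval_le (F := F) (K := FiniteField.Extension F p (2 * s)) p
      (s := t * s) (by rw [hr, hq, pow_mul]) hK hd hdr hf0 (fun e he => hcop e fun l hl => by
        simpa [hf, rootMultiplicity_prod_X_add_C_pow a hl] using he (-l))
      (by rw [← hD]; omega) (by rw [← hD]; omega) hθ1 hθd
    rw [sum_norm_eq_sum_polyChar θ Λ a (FiniteField.finrank_extension F p (2 * s)).le,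
      FiniteField.finrank_extension] at hmain
    have hSs : (Multiset.map (· ^ s) (ω.map (· ^ 2))).sum = -S (2 * s) := by
      rw [hω _ (by omega), Multiset.map_map, neg_neg]
      simp [pow_mul]
    rw [hSs, norm_neg]
    refine hmain.trans ?_
    have h1 : (1 : ℝ) ≤ r := by exact_mod_cast (show 1 ≤ r by omega)
    have hrr : ((Fintype.card F : ℝ)) ^ s = r := by rw [hr]; push_cast; rfl
    rw [hrr, add_mul]
    have : (D : ℝ) ≤ D * r := le_mul_of_one_le_right (Nat.cast_nonneg _) h1
    rw [← hD]
    linarith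
  rw [hc1, norm_neg]
  calc ‖ω.sum‖ ≤ (ω.map (‖·‖)).sum := norm_multiset_sum_le ω
    _ ≤ ω.card • √(Fintype.card F) := by
      rw [← Multiset.card_map (‖·‖) ω]
      refine Multiset.sum_le_card_nsmul _ _ fun x hx => ?_
      obtain ⟨w, hw, rfl⟩ := Multiset.mem_map.1 hx
      exact Real.le_sqrt_of_sq_le (hbound w hw)
    _ ≤ _ := by
      rw [nsmul_eq_mul]
      gcongr

/-- Weil's bound for multiplicative character sums of products of linear factors. -/
theorem norm_sum_mulChar_prod_le {F : Type*} [Field F] [Fintype F] {θ : MulChar F ℂ}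
    {d : ℕ} (hd : d ∣ Fintype.card F - 1) (hθ : orderOf θ = d) {Λ : Finset F} (hΛ : Λ.Nonempty)
    {a : F → ℕ} (ha : ∀ l ∈ Λ, ¬ d ∣ a l) :
    ‖∑ x : F, θ (∏ l ∈ Λ, (x + l) ^ a l)‖ ≤ ((Λ.card - 1 : ℕ) : ℝ) * √(Fintype.card F) := by
  have hd0 : d ≠ 0 := by
    rintro rfl
    have := Fintype.one_lt_card (α := F)
    rw [zero_dvd_iff] at hd
    omega
  set g := d.gcd (Λ.gcd a) with hg
  have hg0 : g ≠ 0 := Nat.gcd_ne_zero_left hd0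
  obtain ⟨d', hd'⟩ : g ∣ d := Nat.gcd_dvd_left _ _
  have hga : ∀ l ∈ Λ, g ∣ a l := fun l hl => (Nat.gcd_dvd_right _ _).trans (Finset.gcd_dvd hl)
  have hmul : ∀ l ∈ Λ, a l = g * (a l / g) := fun l hl => (Nat.mul_div_cancel' (hga l hl)).symm
  have hcop : Nat.Coprime d' (Λ.gcd fun l => a l / g) := by
    have h1 : Λ.gcd a = g * Λ.gcd fun l => a l / g := by
      rw [Finset.gcd_congr rfl hmul, Finset.gcd_mul_left, normalize_eq]
    rw [h1, hd', Nat.gcd_mul_left] at hg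
    exact Nat.eq_of_mul_eq_mul_left (Nat.pos_of_ne_zero hg0) (by rw [mul_one]; exact hg.symm)
  have hsum : ∀ x : F, θ (∏ l ∈ Λ, (x + l) ^ a l) = (θ ^ g) (∏ l ∈ Λ, (x + l) ^ (a l / g)) := by
    intro x
    rw [MulChar.pow_apply' _ hg0, ← map_pow, ← Finset.prod_pow]
    refine congrArg θ (Finset.prod_congr rfl fun l hl => ?_)
    rw [← pow_mul, mul_comm, ← hmul l hl]
  simp_rw [hsum]
  refine norm_sum_mulChar_prod_le_of_coprime (d := d') ((Dvd.intro_left g hd'.symm).trans hd) ?_ hΛ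
    (fun l hl hdvd => ha l hl ?_) fun e he => ?_
  · rw [orderOf_pow_of_dvd hg0 (hθ ▸ Dvd.intro _ hd'.symm), hθ, hd',
      Nat.mul_div_cancel_left _ (Nat.pos_of_ne_zero hg0)]
  · rw [hd', hmul l hl]
    exact mul_dvd_mul_left g hdvd
  · have h1 : d' ∣ e * Λ.gcd fun l => a l / g := by
      have h2 : (Λ.gcd fun l => e * (a l / g)) = e * Λ.gcd fun l => a l / g := by
        rw [Finset.gcd_mul_left, normalize_eq]
      rw [← h2]
      exact Finset.dvd_gcd he
    exact hcop.dvd_of_dvd_mul_right h1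

theorem norm_sum_mulChar_prod_index_le {F ι : Type*} [Field F] [Fintype F] {θ : MulChar F ℂ}
    {d : ℕ} (hd : d ∣ Fintype.card F - 1) (hθ : orderOf θ = d) {b : ι → F}
    (hb : Function.Injective b) {J : Finset ι} (hJ : J.Nonempty) {a : ι → ℕ}
    (ha : ∀ i ∈ J, ¬ d ∣ a i) :
    ‖∑ x : F, θ (∏ i ∈ J, (x + b i) ^ a i)‖ ≤ ((J.card : ℝ) - 1) * √(Fintype.card F) := by
  have h := norm_sum_mulChar_prod_le hd hθ (Λ := J.map ⟨b, hb⟩) (hJ.map)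
    (a := Function.extend b a 0) (fun l hl => by
      obtain ⟨i, hi, rfl⟩ := Finset.mem_map.1 hl
      simpa [hb.extend_apply] using ha i hi)
  simpa [Finset.prod_map, hb.extend_apply, Nat.cast_sub (Finset.card_pos.2 hJ)] using h

theorem MulChar.norm_apply_of_ne_zero {F : Type*} [Field F] [Fintype F] (θ : MulChar F ℂ) {x : F}
    (hx : x ≠ 0) : ‖θ x‖ = 1 := by
  classical
  refine Complex.norm_eq_one_of_pow_eq_one (n := Fintype.card Fˣ) ?_ Fintype.card_ne_zero
  have := θ.pow_card_eq_one
  rw [← Units.val_mk0 hx, ← MulChar.pow_apply_coe, this, MulChar.one_apply_coe]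

theorem MulChar.norm_apply_le_one {F : Type*} [Field F] [Fintype F] (θ : MulChar F ℂ) (x : F) :
    ‖θ x‖ ≤ 1 := by
  by_cases hx : x = 0
  · simp [hx]
  · exact (θ.norm_apply_of_ne_zero hx).le

theorem MulChar.pow_eq_one_of_apply_eq_one {F : Type*} [Field F] [Fintype F] {θ : MulChar F ℂ}
    {x : F} (hx : x ≠ 0) (hθ : θ x = 1) : x ^ ((Fintype.card F - 1) / orderOf θ) = 1 := by
  classical
  obtain ⟨g, hg⟩ := IsCyclic.exists_generator (α := Fˣ)
  obtain ⟨j, hj⟩ := (mem_powers_iff_mem_zpowers.2 (hg (Units.mk0 x hx)))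
  have hgj : θ g ^ j = 1 := by
    rw [← hθ, ← Units.val_mk0 hx, ← hj, ← map_pow]; simp
  have hpow : θ ^ j = 1 := by
    rw [MulChar.eq_one_iff]
    intro u
    obtain ⟨i, rfl⟩ := (mem_powers_iff_mem_zpowers.2 (hg u))
    rw [MulChar.pow_apply_coe]
    simp only [Units.val_pow_eq_pow_val, map_pow]
    rw [pow_right_comm, hgj, one_pow]
  obtain ⟨m, hm⟩ := orderOf_dvd_of_pow_eq_one hpow
  have hd : orderOf θ ∣ Fintype.card F - 1 := by
    rw [← Fintype.card_units]; exact orderOf_dvd_of_pow_eq_one θ.pow_card_eq_one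
  have h1 : (Units.mk0 x hx) ^ ((Fintype.card F - 1) / orderOf θ) = 1 := by
    rw [← hj]
    change (g ^ j) ^ _ = 1
    rw [← pow_mul, hm, mul_right_comm, Nat.mul_div_cancel' hd, pow_mul, ← Fintype.card_units,
      pow_card_eq_one, one_pow]
  simpa using congrArg Units.val h1

/-- When the exponents sum to a multiple of `d`, the point at infinity is not a ramification point,
which improves Weil's bound. -/
theorem norm_sum_mulChar_prod_index_le_of_dvd_sum {F ι : Type*} [Field F] [Fintype F]
    {θ : MulChar F ℂ} {d : ℕ} (hd : d ∣ Fintype.card F - 1) (hθ : orderOf θ = d) {b : ι → F}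
    (hb : Function.Injective b) {J : Finset ι} (hJ : J.Nonempty) {a : ι → ℕ}
    (ha : ∀ i ∈ J, ¬ d ∣ a i) (hsum : d ∣ ∑ i ∈ J, a i) :
    ‖∑ x : F, θ (∏ i ∈ J, (x + b i) ^ a i)‖
      ≤ ((J.card : ℝ) - 1) * √(Fintype.card F) + (1 - √(Fintype.card F)) := by
  classical
  obtain ⟨i₀, hi₀⟩ := hJ
  have hJ' : (J.erase i₀).Nonempty := by
    rw [Finset.nonempty_iff_ne_empty]
    intro h
    rw [← Finset.add_sum_erase _ _ hi₀, h, Finset.sum_empty, add_zero] at hsum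
    exact ha i₀ hi₀ hsum
  set c : ι → F := fun i => (b i - b i₀)⁻¹ with hc
  have hcinj : Function.Injective c := fun i k hik => hb (sub_left_injective (inv_injective hik))
  set H : F → ℂ := fun y => θ (∏ i ∈ J.erase i₀, (y + c i) ^ a i) with hH
  set κ : ℂ := θ (∏ i ∈ J.erase i₀, (b i - b i₀) ^ a i) with hκ
  have hbne : ∀ i ∈ J.erase i₀, b i - b i₀ ≠ 0 := fun i hi =>
    sub_ne_zero.2 (hb.ne (Finset.ne_of_mem_erase hi))
  have hterm : ∀ y : F, y ≠ 0 → θ (∏ i ∈ J, ((y⁻¹ - b i₀) + b i) ^ a i) = κ * H y := by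
    intro y hy
    have h1 : ∏ i ∈ J, ((y⁻¹ - b i₀) + b i) ^ a i = y⁻¹ ^ (∑ i ∈ J, a i) *
        ((∏ i ∈ J.erase i₀, (b i - b i₀) ^ a i) * ∏ i ∈ J.erase i₀, (y + c i) ^ a i) := by
      rw [← Finset.mul_prod_erase _ _ hi₀, ← Finset.add_sum_erase _ _ hi₀, pow_add,
        ← Finset.prod_pow_eq_pow_sum, sub_add_cancel, mul_assoc, ← Finset.prod_mul_distrib,
        ← Finset.prod_mul_distrib]
      congr 1
      refine Finset.prod_congr rfl fun i hi => ?_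
      rw [← mul_pow, ← mul_pow]
      congr 1
      have := hbne i hi
      simp only [hc]
      field_simp
      ring
    have h2 : θ (y⁻¹ ^ ∑ i ∈ J, a i) = 1 := by
      obtain ⟨m, hm⟩ := hsum
      rw [hm, ← Units.val_mk0 (inv_ne_zero hy), pow_mul, map_pow, map_pow, ← MulChar.pow_apply_coe,
        ← hθ, pow_orderOf_eq_one, MulChar.one_apply_coe, one_pow]
    rw [h1, map_mul, h2, one_mul, map_mul]
  have hzero : θ (∏ i ∈ J, (((0 : F)⁻¹ - b i₀) + b i) ^ a i) = 0 := by
    rw [Finset.prod_eq_zero hi₀, MulChar.map_zero]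
    rw [inv_zero, zero_sub, neg_add_cancel, zero_pow]
    exact fun h => ha i₀ hi₀ (h ▸ dvd_zero d)
  have hmain : ∑ x : F, θ (∏ i ∈ J, (x + b i) ^ a i) = κ * (∑ y : F, H y - H 0) := by
    rw [← Equiv.sum_comp ((Equiv.inv F).trans (Equiv.subRight (b i₀)))]
    simp only [Equiv.trans_apply, Equiv.inv_apply, Equiv.subRight_apply]
    rw [← Finset.add_sum_erase _ _ (Finset.mem_univ (0 : F)), hzero, zero_add,
      ← Finset.add_sum_erase Finset.univ H (Finset.mem_univ (0 : F)), add_sub_cancel_left,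
      Finset.mul_sum]
    exact Finset.sum_congr rfl fun y hy => hterm y (Finset.ne_of_mem_erase hy)
  have hκ1 : ‖κ‖ = 1 := θ.norm_apply_of_ne_zero
    (Finset.prod_ne_zero_iff.2 fun i hi => pow_ne_zero _ (hbne i hi))
  rw [hmain, norm_mul, hκ1, one_mul]
  have hweil := norm_sum_mulChar_prod_index_le hd hθ hcinj hJ'
    (fun i hi => ha i (Finset.mem_of_mem_erase hi))
  rw [Finset.cast_card_erase_of_mem hi₀] at hweil
  calc ‖∑ y : F, H y - H 0‖ ≤ ‖∑ y : F, H y‖ + ‖H 0‖ := norm_sub_le _ _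
    _ ≤ ((J.card : ℝ) - 1 - 1) * √(Fintype.card F) + 1 := add_le_add hweil (θ.norm_apply_le_one _)
    _ = _ := by ring

theorem card_filter_eq_zero_mul {ι : Type*} [Fintype ι] [DecidableEq ι] {d : ℕ} [NeZero d]
    (φ : (ι → ZMod d) →+ ZMod d) (hφ : Function.Surjective φ) :
    (Finset.univ.filter fun a => φ a = 0).card * d = d ^ Fintype.card ι := by
  have h := φ.ker.card_mul_index
  rw [AddSubgroup.index_ker, AddMonoidHom.range_eq_top.2 hφ] at h
  rw [AddSubgroup.card_top, Nat.card_eq_fintype_card, Nat.card_eq_fintype_card,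
    Nat.card_eq_fintype_card, ZMod.card, Fintype.card_fun, ZMod.card] at h
  rw [← h, ← Fintype.card_subtype]
  congr 1
  exact Fintype.card_congr (Equiv.subtypeEquivRight fun a => Iff.rfl)

open Classical in
theorem sum_mulChar_pow_val {F : Type*} [Field F] {θ : MulChar F ℂ} {d : ℕ} [NeZero d]
    (hθ : θ ^ d = 1) (y : F) :
    ∑ e : ZMod d, θ y ^ e.val = if y = 0 then 1 else if θ y = 1 then (d : ℂ) else 0 := by
  have h1 : ∑ e : ZMod d, θ y ^ e.val = ∑ e ∈ Finset.range d, θ y ^ e := by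
    obtain ⟨n, rfl⟩ := Nat.exists_eq_succ_of_ne_zero (NeZero.ne d)
    exact Fin.sum_univ_eq_sum_range (fun e => θ y ^ e) (n + 1)
  rw [h1]
  split_ifs with h h'
  · rw [h, MulChar.map_zero]
    simp [NeZero.ne d, zero_pow_eq]
  · simp [h']
  · rw [geom_sum_eq h', ← Units.val_mk0 h, ← MulChar.pow_apply_coe, hθ, MulChar.one_apply_coe,
      sub_self, zero_div]

theorem sum_card_filter_ne_zero_mul {ι : Type*} [Fintype ι] [DecidableEq ι] {d : ℕ} [NeZero d] :
    (∑ a : ι → ZMod d, (Finset.univ.filter fun i => a i ≠ 0).card) * d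
      = Fintype.card ι * (d - 1) * d ^ Fintype.card ι := by
  simp_rw [Finset.card_filter]
  rw [Finset.sum_comm, Finset.sum_mul, Finset.sum_congr rfl (g := fun _ =>
    (d - 1) * d ^ Fintype.card ι), Finset.sum_const, Finset.card_univ, smul_eq_mul, mul_assoc]
  intro i _
  rw [← Finset.card_filter]
  have h1 := card_filter_eq_zero_mul (Pi.evalAddMonoidHom (fun _ : ι => ZMod d) i)
    (Function.surjective_eval i)
  have h2 := Finset.card_filter_add_card_filter_not (s := (Finset.univ : Finset (ι → ZMod d)))
    (fun a => a i = 0)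
  rw [Finset.card_univ, Fintype.card_fun, ZMod.card] at h2
  simp only [Pi.evalAddMonoidHom_apply] at h1
  obtain ⟨n, rfl⟩ := Nat.exists_eq_succ_of_ne_zero (NeZero.ne d)
  simp only [Nat.succ_eq_add_one, Nat.add_sub_cancel] at *
  linarith [congrArg (· * (n + 1)) h2]

section

variable {F ι : Type*} [Field F] [Fintype F] [Fintype ι] {θ : MulChar F ℂ} {d : ℕ} [NeZero d]
  {b : ι → F}

theorem norm_sum_prod_mulChar_pow_val_le (hd : d ∣ Fintype.card F - 1) (hθ : orderOf θ = d)
    (hb : Function.Injective b) {a : ι → ZMod d} (ha : a ≠ 0) :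
    ‖∑ x : F, ∏ i, θ (x + b i) ^ (a i).val‖
      ≤ (((Finset.univ.filter fun i => a i ≠ 0).card : ℝ) - 1) * √(Fintype.card F)
        + if ∑ i, a i = 0 then 1 - √(Fintype.card F) else 0 := by
  set J := Finset.univ.filter fun i => a i ≠ 0 with hJ
  have hJne : J.Nonempty := by
    obtain ⟨i, hi⟩ := Function.ne_iff.1 ha
    exact ⟨i, by simpa [hJ] using hi⟩
  have hdvd : ∀ i ∈ J, ¬ d ∣ (a i).val := by
    intro i hi h
    rw [← ZMod.natCast_eq_zero_iff, ZMod.natCast_zmod_val] at h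
    exact (Finset.mem_filter.1 hi).2 h
  have hprod : ∀ x : F, ∏ i, θ (x + b i) ^ (a i).val = θ (∏ i ∈ J, (x + b i) ^ (a i).val) := by
    intro x
    rw [map_prod, hJ, Finset.prod_filter]
    refine Finset.prod_congr rfl fun i _ => ?_
    split_ifs with h
    · rw [map_pow]
    · rw [not_not.1 h, ZMod.val_zero, pow_zero]
  simp_rw [hprod]
  split_ifs with hsum
  · refine norm_sum_mulChar_prod_index_le_of_dvd_sum hd hθ hb hJne hdvd ?_
    rw [← ZMod.natCast_eq_zero_iff, hJ, Nat.cast_sum]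
    simp_rw [ZMod.natCast_zmod_val]
    rw [Finset.sum_filter_ne_zero, hsum]
  · rw [add_zero]
    exact norm_sum_mulChar_prod_index_le hd hθ hb hJne hdvd

theorem norm_sum_prod_sum_le_of_forall_exists (hθ : θ ^ d = 1)
    (h : ∀ x : F, ∃ i, x + b i = 0 ∨ θ (x + b i) ≠ 1) :
    ‖∑ x : F, ∏ i, ∑ e : ZMod d, θ (x + b i) ^ e.val‖
      ≤ Fintype.card ι * (d : ℝ) ^ (Fintype.card ι - 1) := by
  classical
  have hd1 : (1 : ℝ) ≤ d := by exact_mod_cast NeZero.one_le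
  have hfac : ∀ y : F, ‖∑ e : ZMod d, θ y ^ e.val‖ ≤ d := by
    intro y
    rw [sum_mulChar_pow_val hθ]
    split_ifs <;> simp [hd1]
  have hzero : ∀ x ∈ Finset.univ, x ∉ Finset.univ.image (fun i => -b i) →
      ∏ i, ∑ e : ZMod d, θ (x + b i) ^ e.val = 0 := by
    intro x _ hx
    have hne : ∀ i, x + b i ≠ 0 := fun i hi =>
      hx (Finset.mem_image.2 ⟨i, Finset.mem_univ i, (eq_neg_of_add_eq_zero_left hi).symm⟩)
    obtain ⟨i, hi⟩ := h x
    refine Finset.prod_eq_zero (Finset.mem_univ i) ?_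
    rw [sum_mulChar_pow_val hθ, if_neg (hne i), if_neg (hi.resolve_left (hne i))]
  rw [← Finset.sum_subset (Finset.subset_univ _) hzero]
  refine (norm_sum_le_of_le (n := fun _ => (d : ℝ) ^ (Fintype.card ι - 1)) _
    fun x hx => ?_).trans ?_
  · obtain ⟨i, -, rfl⟩ := Finset.mem_image.1 hx
    rw [← Finset.mul_prod_erase _ _ (Finset.mem_univ i), sum_mulChar_pow_val hθ,
      if_pos (neg_add_cancel _), one_mul, norm_prod, ← Finset.card_univ,
      ← Finset.card_erase_of_mem (Finset.mem_univ i), ← Finset.prod_const]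
    exact Finset.prod_le_prod (fun _ _ => norm_nonneg _) fun k _ => hfac _
  · rw [Finset.sum_const, nsmul_eq_mul]
    gcongr
    exact Finset.card_image_le

theorem sum_prod_sum_eq [DecidableEq ι] :
    ∑ x : F, ∏ i, ∑ e : ZMod d, θ (x + b i) ^ e.val
      = ∑ a : ι → ZMod d, ∑ x : F, ∏ i, θ (x + b i) ^ (a i).val := by
  rw [Finset.sum_comm]
  refine Finset.sum_congr rfl fun x _ => ?_
  rw [Finset.prod_univ_sum, Fintype.piFinset_univ]

end

theorem exists_forall_add_pow_eq_one {F ι : Type*} [Field F] [Fintype F] [Fintype ι] [Nonempty ι]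
    {d : ℕ} (hd : d ∣ Fintype.card F - 1) {b : ι → F} (hb : Function.Injective b)
    (hineq : (Fintype.card F : ℝ)
      - (((Fintype.card ι : ℝ) * d - Fintype.card ι - d - 1) * (d : ℝ) ^ (Fintype.card ι - 1) + 2)
        * √(Fintype.card F)
      - ((Fintype.card ι : ℝ) + 1) * (d : ℝ) ^ (Fintype.card ι - 1) + 1 > 0) :
    ∃ ξ : F, ∀ i, (ξ + b i) ^ ((Fintype.card F - 1) / d) = 1 := by
  classical
  have hd0 : d ≠ 0 := by
    rintro rfl
    have := Fintype.one_lt_card (α := F)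
    rw [zero_dvd_iff] at hd
    omega
  have : NeZero d := ⟨hd0⟩
  obtain ⟨θ, hθ⟩ := MulChar.exists_mulChar_orderOf F hd (Complex.isPrimitiveRoot_exp d hd0)
  have hθd : θ ^ d = 1 := hθ ▸ pow_orderOf_eq_one θ
  by_contra! hcon
  have hlow := norm_sum_prod_sum_le_of_forall_exists (b := b) hθd fun x => by
    obtain ⟨i, hi⟩ := hcon x
    refine ⟨i, ?_⟩
    by_contra! h
    exact hi (hθ ▸ MulChar.pow_eq_one_of_apply_eq_one h.1 h.2)
  rw [sum_prod_sum_eq, ← Finset.add_sum_erase _ _ (Finset.mem_univ 0)] at hlow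
  set s := Fintype.card ι with hs
  set R := √(Fintype.card F : ℝ) with hR
  have hs0 : 0 < s := Fintype.card_pos
  set E := (d : ℝ) ^ (s - 1) with hE
  have hEd : E * d = (d : ℝ) ^ s := by rw [hE, ← pow_succ, Nat.sub_add_cancel hs0]
  have hdR : (d : ℝ) ≠ 0 := by exact_mod_cast hd0
  have hcount1 : ∑ a : ι → ZMod d, ((Finset.univ.filter fun i => a i ≠ 0).card : ℝ)
      = s * (d - 1) * E := by
    have h1 := congrArg (Nat.cast : ℕ → ℝ) (sum_card_filter_ne_zero_mul (ι := ι) (d := d))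
    rw [← hs] at h1
    push_cast [Nat.cast_sub (Nat.pos_of_ne_zero hd0)] at h1
    refine mul_right_cancel₀ hdR ?_
    rw [h1, mul_assoc _ E, hEd]
  have hcount2 : ((Finset.univ.filter fun a : ι → ZMod d => ∑ i, a i = 0).card : ℝ) = E := by
    have hsurj : Function.Surjective fun a : ι → ZMod d => ∑ i, a i := by
      intro z
      obtain ⟨i⟩ := ‹Nonempty ι›
      exact ⟨Pi.single i z, by simp⟩
    have h1 := congrArg (Nat.cast : ℕ → ℝ) (card_filter_eq_zero_mul (ι := ι) (d := d)
      { toFun := fun a => ∑ i, a i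
        map_zero' := by simp
        map_add' := fun a a' => by simp [Finset.sum_add_distrib] } hsurj)
    rw [← hs] at h1
    push_cast at h1
    refine mul_right_cancel₀ hdR ?_
    rw [hEd, ← h1]
    rfl
  have hupper : ‖∑ a ∈ Finset.univ.erase (0 : ι → ZMod d), ∑ x : F, ∏ i, θ (x + b i) ^ (a i).val‖
      ≤ (s * (d - 1) * E - (d ^ s - 1)) * R + (E - 1) * (1 - R) := by
    refine (norm_sum_le_of_le _ fun a ha =>
      norm_sum_prod_mulChar_pow_val_le hd hθ hb (Finset.ne_of_mem_erase ha)).trans_eq ?_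
    rw [Finset.sum_add_distrib, ← Finset.sum_mul, Finset.sum_sub_distrib]
    have h1 := Finset.add_sum_erase Finset.univ
      (fun a : ι → ZMod d => ((Finset.univ.filter fun i => a i ≠ 0).card : ℝ)) (Finset.mem_univ 0)
    have hsum : ∑ a : ι → ZMod d, (if ∑ i, a i = 0 then 1 - R else 0) = E * (1 - R) := by
      rw [← Finset.sum_filter, Finset.sum_const, nsmul_eq_mul, hcount2]
    have h2 := Finset.add_sum_erase Finset.univ
      (fun a : ι → ZMod d => if ∑ i, a i = 0 then 1 - R else 0) (Finset.mem_univ 0)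
    rw [hcount1] at h1
    rw [hsum] at h2
    simp only [Pi.zero_apply, ne_eq, not_true_eq_false, Finset.filter_false, Finset.card_empty,
      Nat.cast_zero, zero_add, Finset.sum_const_zero, if_true] at h1 h2
    rw [h1, eq_sub_of_add_eq' h2, Finset.sum_const, nsmul_eq_mul,
      Finset.cast_card_erase_of_mem (Finset.mem_univ _), Finset.card_univ, Fintype.card_fun,
      ZMod.card, mul_one]
    push_cast
    ring
  have hT0 : ∑ x : F, ∏ i, θ (x + b i) ^ ((0 : ι → ZMod d) i).val = Fintype.card F := by
    simp
  rw [hT0] at hlow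
  have htri := norm_sub_le ((Fintype.card F : ℂ) + ∑ a ∈ Finset.univ.erase (0 : ι → ZMod d),
    ∑ x : F, ∏ i, θ (x + b i) ^ (a i).val) (∑ a ∈ Finset.univ.erase (0 : ι → ZMod d),
    ∑ x : F, ∏ i, θ (x + b i) ^ (a i).val)
  rw [add_sub_cancel_right, Complex.norm_natCast] at htri
  rw [← hEd] at hupper
  nlinarith

end

theorem exists_xi_of_ineq (p q : ℕ) (hp : p.Prime) (k : ℕ) (hk : 0 < k) (hq : q = p ^ k)
    (F : Type*) [Field F] [Fintype F] [CharP F p] (hcard : Fintype.card F = q)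
    (d : ℕ) (hd : d ∣ q - 1) (hdp : Nat.Coprime d p)
    (hineq : (q : ℝ) - (((p : ℝ) * d - p - d - 1) * (d : ℝ) ^ (p - 1) + 2) * Real.sqrt q
        - ((p : ℝ) + 1) * (d : ℝ) ^ (p - 1) + 1 > 0) :
    ∃ ξ : F, ∀ lam : ZMod p, (ξ + (lam.val : F)) ^ ((q - 1) / d) = 1 := by
  have : NeZero p := ⟨hp.ne_zero⟩
  subst hcard
  refine exists_forall_add_pow_eq_one hd (b := fun lam : ZMod p => (lam.val : F)) ?_ ?_
  · intro x y hxy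
    exact ZMod.val_injective p (CharP.natCast_injOn_Iio F p (ZMod.val_lt x) (ZMod.val_lt y) hxy)
  · rwa [ZMod.card]
end
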